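/- Let 3 ≤ a ≤ b and set p := ab + a − 1. Then κ_{p,1} = p · C((a+1)b, p+1) + p, where C denotes the binomial coefficient. -/

import Mathlib

open MvPolynomial
open scoped TensorProduct

set_option maxHeartbeats 1600000
set_option synthInstance.maxHeartbeats 400000
set_option maxSynthPendingDepth 3

noncomputable section

/-- The space of bihomogeneous polynomials in `k[x,y,z,w]` of bidegree `(d, e)`:
all monomials `x^α y^β z^γ w^δ` occurring satisfy `α + β = d` and `γ + δ = e`. -/
def Bihom (k : Type*) [Field k] (d e : ℕ) : Submodule k (MvPolynomial (Fin 4) k) where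
  carrier := {f | ∀ m ∈ f.support, m 0 + m 1 = d ∧ m 2 + m 3 = e}
  add_mem' := by
    intro f g hf hg m hm
    rcases Finset.mem_union.mp (MvPolynomial.support_add hm) with h | h
    exacts [hf m h, hg m h]
  zero_mem' := by intro m hm; simp at hm
  smul_mem' := by
    intro c f hf m hm
    exact hf m (MvPolynomial.support_smul hm)

/-- `RS k a b q` is the degree-`q` part `R_q` of the homogeneous coordinate ring of the
Segre–Veronese embedding of `ℙ¹×ℙ¹` by `O(a)⊠O(b)`: bihomogeneous polynomials of
bidegree `(q*a, q*b)`. -/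
abbrev RS (k : Type*) [Field k] (a b q : ℕ) : Submodule k (MvPolynomial (Fin 4) k) :=
  Bihom k (q*a) (q*b)

theorem Bihom.mul_mem' {k : Type*} [Field k] {d e d' e' : ℕ} {f g : MvPolynomial (Fin 4) k}
    (hf : f ∈ Bihom k d e) (hg : g ∈ Bihom k d' e') : f * g ∈ Bihom k (d+d') (e+e') := by
  intro m hm
  have h := MvPolynomial.support_mul f g hm
  rw [Finset.mem_add] at h
  obtain ⟨m1, h1, m2, h2, rfl⟩ := h
  obtain ⟨e1, e2⟩ := hf m1 h1
  obtain ⟨e3, e4⟩ := hg m2 h2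
  constructor <;> simp only [Finsupp.add_apply] <;> omega

/-- Multiplication `R_1 × R_q → R_{q+1}`. -/
def segMul (k : Type*) [Field k] (a b q : ℕ) (v : RS k a b 1) (f : RS k a b q) :
    RS k a b (q+1) := by
  refine ⟨(v : MvPolynomial (Fin 4) k) * (f : MvPolynomial (Fin 4) k), ?_⟩
  have h := Bihom.mul_mem' v.2 f.2
  rwa [show 1*a + q*a = (q+1)*a by ring, show 1*b + q*b = (q+1)*b by ring] at h

/-- The wedge product of a family of vectors, as an element of the `n`-th exterior power. -/
def wedge (k : Type*) [Field k] {M : Type*} [AddCommGroup M] [Module k M] (n : ℕ)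
    (v : Fin n → M) : ⋀[k]^n M :=
  ⟨ExteriorAlgebra.ιMulti k n v, ExteriorAlgebra.ιMulti_range k n (Set.mem_range_self v)⟩

/-- The type of a family of Koszul differentials
`δ_{n+1,q} : Λ^{n+1} V ⊗ R_q → Λ^n V ⊗ R_{q+1}` for the Segre–Veronese ring,
where `V = R_1`. -/
abbrev KoszulMaps (k : Type*) [Field k] (a b : ℕ) :=
  ∀ n q : ℕ, ((⋀[k]^(n+1) (RS k a b 1)) ⊗[k] (RS k a b q)) →ₗ[k]
      ((⋀[k]^n (RS k a b 1)) ⊗[k] (RS k a b (q+1)))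

/-- The defining property of the Koszul differentials:
`δ (v_1∧⋯∧v_p ⊗ f) = Σ_i (−1)^{i+1} v_1∧⋯∧v̂_i∧⋯∧v_p ⊗ v_i·f` (1-indexed signs). -/
def IsKoszul (k : Type*) [Field k] (a b : ℕ) (δ : KoszulMaps k a b) : Prop :=
  ∀ (n q : ℕ) (v : Fin (n+1) → RS k a b 1) (f : RS k a b q),
    δ n q (wedge k (n+1) v ⊗ₜ[k] f) =
      ∑ i : Fin (n+1), ((-1:k)^(i:ℕ)) •
        (wedge k n (fun j => v (i.succAbove j)) ⊗ₜ[k] segMul k a b q (v i) f)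

/-- `Kp1 k a b δ n` is the Koszul cohomology `K_{p,1}` for `p = n+1`:
`ker δ_{p,1} / im δ_{p+1,0}`. -/
abbrev Kp1 (k : Type*) [Field k] (a b : ℕ) (δ : KoszulMaps k a b) (n : ℕ) :=
  LinearMap.ker (δ n 1) ⧸
    Submodule.comap (LinearMap.ker (δ n 1)).subtype (LinearMap.range (δ (n+1) 0))

namespace SegreVeronese
open Matrix (vecCons)

section WedgeEv

variable {R M : Type*} [CommRing R] [AddCommGroup M] [Module R M] (ev : M →ₗ[R] R) {n : ℕ}

/-- Exterior multiplication of alternating forms by the linear form `ev`. -/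
def wedgeEv (n : ℕ) : (M [⋀^Fin n]→ₗ[R] R) →ₗ[R] M [⋀^Fin (n + 1)]→ₗ[R] R where
  toFun ω := AlternatingMap.alternatizeUncurryFin (ev.smulRight ω)
  map_add' ω ω' := by
    ext v
    simp [AlternatingMap.alternatizeUncurryFin_apply, Finset.sum_add_distrib]
  map_smul' c ω := by
    ext v
    simp [AlternatingMap.alternatizeUncurryFin_apply, Finset.mul_sum, mul_left_comm]

theorem wedgeEv_apply (ω : M [⋀^Fin n]→ₗ[R] R) (v : Fin (n + 1) → M) :
    wedgeEv ev n ω v = ∑ i : Fin (n + 1), (-1) ^ (i : ℕ) * (ev (v i) * ω (i.removeNth v)) := by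
  simp [wedgeEv, AlternatingMap.alternatizeUncurryFin_apply]

theorem wedgeEv_wedgeEv (ω : M [⋀^Fin n]→ₗ[R] R) : wedgeEv ev (n + 1) (wedgeEv ev n ω) = 0 := by
  have h := AlternatingMap.alternatizeUncurryFin_alternatizeUncurryFinLM_comp_of_symmetric
    (f := ev.smulRight (ev.smulRight ω)) (fun x y => by
      ext v
      simp [mul_left_comm])
  rw [← h]
  ext v
  simp [wedgeEv, AlternatingMap.alternatizeUncurryFin_apply]

theorem wedgeEv_vecCons (ω : M [⋀^Fin (n + 1)]→ₗ[R] R) (u : M) (v : Fin (n + 1) → M) :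
    wedgeEv ev (n + 1) ω (vecCons u v) = ev u * ω v - wedgeEv ev n (ω.curryLeft u) v := by
  rw [wedgeEv_apply, Fin.sum_univ_succ, wedgeEv_apply, sub_eq_add_neg, ← Finset.sum_neg_distrib]
  congr 1
  · have : (0 : Fin (n + 2)).removeNth (vecCons u v) = v := by
      funext j; simp [Fin.removeNth]
    simp [this]
  · refine Finset.sum_congr rfl fun i _ => ?_
    have : (i.succ).removeNth (vecCons u v) = vecCons u (i.removeNth v) := by
      funext j
      refine Fin.cases ?_ (fun j => ?_) j <;> simp [Fin.removeNth]
    rw [this]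
    simp [pow_succ]

theorem wedgeEv_apply_eq_zero (ω : M [⋀^Fin n]→ₗ[R] R) (v : Fin (n + 1) → M)
    (hv : ∀ i, ev (v i) = 0) : wedgeEv ev n ω v = 0 := by
  simp [wedgeEv_apply, hv]

theorem wedgeEv_vecCons_of_ker (ω : M [⋀^Fin n]→ₗ[R] R) (u : M) (v : Fin n → M)
    (hv : ∀ i, ev (v i) = 0) : wedgeEv ev n ω (vecCons u v) = ev u * ω v := by
  cases n with
  | zero =>
    rw [wedgeEv_apply]
    simp [Subsingleton.elim (Fin.removeNth 0 (vecCons u v)) v]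
  | succ n => rw [wedgeEv_vecCons, wedgeEv_apply_eq_zero ev _ v hv, sub_zero]

theorem wedgeEv_vecCons_vecCons_of_ker (ω : M [⋀^Fin (n + 1)]→ₗ[R] R) (u u' : M) (v : Fin n → M)
    (hv : ∀ i, ev (v i) = 0) :
    wedgeEv ev (n + 1) ω (vecCons u (vecCons u' v)) =
      ev u * ω (vecCons u' v) - ev u' * ω (vecCons u v) := by
  rw [wedgeEv_vecCons, wedgeEv_vecCons_of_ker ev _ _ _ hv]
  simp

/-- A closed form is the differential of its contraction by any vector on which `ev` is `1`. -/
theorem wedgeEv_curryLeft_of_closed (ω : M [⋀^Fin (n + 1)]→ₗ[R] R) (hω : wedgeEv ev (n + 1) ω = 0)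
    (u : M) (v : Fin (n + 1) → M) : wedgeEv ev n (ω.curryLeft u) v = ev u * ω v := by
  have h := wedgeEv_vecCons ev ω u v
  rw [hω] at h
  simp only [AlternatingMap.zero_apply] at h
  exact (sub_eq_zero.mp h.symm).symm

theorem map_vecCons_vecCons_of_closed (ω : M [⋀^Fin (n + 2)]→ₗ[R] R)
    (hω : wedgeEv ev (n + 2) ω = 0) (u u' : M) (v : Fin (n + 1) → M) (hv : ∀ i, ev (v i) = 0) :
    ev u * ω (vecCons u' v) = ev u' * ω (vecCons u v) := by
  have h := wedgeEv_vecCons_vecCons_of_ker ev ω u u' v hv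
  rw [hω] at h
  simp only [AlternatingMap.zero_apply] at h
  exact sub_eq_zero.mp h.symm

theorem map_eq_zero_of_closed (ω : M [⋀^Fin (n + 1)]→ₗ[R] R)
    (hω : wedgeEv ev (n + 1) ω = 0) (u : M) (hu : ev u = 1) (v : Fin (n + 1) → M)
    (hv : ∀ i, ev (v i) = 0) : ω v = 0 := by
  have h := wedgeEv_vecCons_of_ker ev ω u v hv
  rw [hω, hu] at h
  simpa using h.symm

theorem map_vecCons_swap (ω : M [⋀^Fin (n + 2)]→ₗ[R] R) (u u' : M) (v : Fin n → M) :
    ω (vecCons u (vecCons u' v)) = - ω (vecCons u' (vecCons u v)) := by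
  have h := ω.map_swap (vecCons u' (vecCons u v)) (i := 0) (j := 1) (by simp)
  rw [← h]
  congr 1
  funext i
  refine Fin.cases ?_ (fun i => ?_) i
  · simp
  · refine Fin.cases ?_ (fun i => ?_) i
    · simp
    · have : Equiv.swap (0 : Fin (n + 2)) 1 i.succ.succ = i.succ.succ :=
        Equiv.swap_apply_of_ne_of_ne (by simp) (by simp [Fin.ext_iff])
      simp [this]

end WedgeEv

/-- Laurent polynomials in two variables. -/
abbrev Lau (k : Type*) [Field k] := AddMonoidAlgebra k (ℤ × ℤ)

variable {k : Type*} [Field k]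

/-- The coefficient of a Laurent polynomial at an exponent. -/
def cf (s : ℤ × ℤ) : Lau k →ₗ[k] k where
  toFun f := f.coeff s
  map_add' f g := by simp
  map_smul' c f := by simp

theorem cf_def (s : ℤ × ℤ) (f : Lau k) : cf s f = f.coeff s := rfl

/-- The monomial with a given exponent. -/
def mon (s : ℤ × ℤ) : Lau k := AddMonoidAlgebra.single s 1

theorem lau_ext {f g : Lau k} (h : ∀ s, cf s f = cf s g) : f = g := by
  apply AddMonoidAlgebra.ext
  ext s
  exact h s

theorem mon_zero : mon (0 : ℤ × ℤ) = (1 : Lau k) := rfl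

theorem mon_zero_zero : mon ((0 : ℤ), (0 : ℤ)) = (1 : Lau k) := rfl

theorem mon_mul_mon (s t : ℤ × ℤ) : (mon s * mon t : Lau k) = mon (s + t) := by
  simp [mon, AddMonoidAlgebra.single_mul_single]

theorem cf_mon (s t : ℤ × ℤ) : cf s (mon t : Lau k) = if t = s then 1 else 0 := by
  simp [cf_def, mon, Finsupp.single_apply]

theorem cf_mon_mul (s t : ℤ × ℤ) (f : Lau k) : cf s (mon t * f) = cf (s - t) f := by
  simp [cf_def, mon, AddMonoidAlgebra.coeff_single_mul_apply, sub_eq_add_neg, add_comm]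

/-- Laurent polynomials all of whose exponents have `lam`-degree at most `d`. -/
def degLE (lam : ℤ × ℤ →+ ℤ) (d : ℤ) : Submodule k (Lau k) where
  carrier := {f | ∀ s, d < lam s → cf s f = 0}
  add_mem' := by
    intro f g hf hg s hs
    rw [map_add, hf s hs, hg s hs, add_zero]
  zero_mem' := by intro s _; simp
  smul_mem' := by
    intro c f hf s hs
    rw [map_smul, hf s hs, smul_zero]

theorem degLE_mono {lam : ℤ × ℤ →+ ℤ} {d d' : ℤ} (h : d ≤ d') {f : Lau k}
    (hf : f ∈ degLE lam d) : f ∈ degLE lam d' := fun s hs => hf s (lt_of_le_of_lt h hs)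

theorem mul_mem_degLE {lam : ℤ × ℤ →+ ℤ} {d e : ℤ} {f g : Lau k}
    (hf : f ∈ degLE lam d) (hg : g ∈ degLE lam e) : f * g ∈ degLE lam (d + e) := by
  classical
  intro s hs
  by_contra hne
  have hm : s ∈ (f * g).coeff.support := by simpa [cf_def] using hne
  have := AddMonoidAlgebra.support_coeff_mul_subset f g hm
  obtain ⟨s1, h1, s2, h2, rfl⟩ := Finset.mem_add.mp this
  rw [map_add] at hs
  rcases lt_or_ge d (lam s1) with h | h
  · exact (by simpa [cf_def] using h1 : cf s1 f ≠ 0) (hf s1 h)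
  · exact (by simpa [cf_def] using h2 : cf s2 g ≠ 0) (hg s2 (by omega))

theorem mon_mem_degLE {lam : ℤ × ℤ →+ ℤ} {d : ℤ} {s : ℤ × ℤ} (h : lam s ≤ d) :
    (mon s : Lau k) ∈ degLE lam d := by
  intro t ht
  rw [cf_mon, if_neg]
  rintro rfl
  omega

theorem one_mem_degLE {lam : ℤ × ℤ →+ ℤ} : (1 : Lau k) ∈ degLE lam 0 := by
  rw [← mon_zero]
  exact mon_mem_degLE (by simp)

theorem prod_mem_degLE {ι : Type*} {lam : ℤ × ℤ →+ ℤ} (S : Finset ι) (d : ι → ℤ) (f : ι → Lau k)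
    (h : ∀ i ∈ S, f i ∈ degLE lam (d i)) : ∏ i ∈ S, f i ∈ degLE lam (∑ i ∈ S, d i) := by
  classical
  induction S using Finset.induction_on with
  | empty => simpa using one_mem_degLE
  | insert i S hi ih =>
    rw [Finset.prod_insert hi, Finset.sum_insert hi]
    exact mul_mem_degLE (h i (Finset.mem_insert_self i S))
      (ih fun j hj => h j (Finset.mem_insert_of_mem hj))

theorem neg_one_pow_mul_mem (P : Submodule k (Lau k)) (n : ℕ) {f : Lau k} (hf : f ∈ P) :
    (-1) ^ n * f ∈ P := by
  rcases neg_one_pow_eq_or (Lau k) n with h | h <;> simpa [h] using hf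

section Weighted

variable {M : Type*} [AddCommGroup M] [Module (Lau k) M] {n : ℕ}

theorem map_sum_smul {S : Type*} [Fintype S] (χ : M [⋀^Fin n]→ₗ[Lau k] Lau k)
    (w : S → M) (c : Fin n → S → Lau k) :
    χ (fun j => ∑ s, c j s • w s) = ∑ i : Fin n → S, (∏ j, c j (i j)) * χ (w ∘ i) := by
  classical
  have h := χ.toMultilinearMap.map_sum (fun j s => c j s • w s)
  refine h.trans (Finset.sum_congr rfl fun i _ => ?_)
  exact χ.toMultilinearMap.map_smul_univ (fun j => c j (i j)) (fun j => w (i j))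

/-- Degree bounds for the values of a form on a weighted family of vectors propagate to
combinations of these vectors with coefficients of bounded degree. -/
theorem map_mem_degLE {S : Type*} [Fintype S] {lam : ℤ × ℤ →+ ℤ}
    (χ : M [⋀^Fin n]→ₗ[Lau k] Lau k) (w : S → M) (wt : S → ℤ) (d : ℤ)
    (hχ : ∀ i : Fin n → S, Function.Injective i → χ (w ∘ i) ∈ degLE lam (d + ∑ j, wt (i j)))
    (u : Fin n → M) (du : Fin n → ℤ) (c : Fin n → S → Lau k)
    (hu : ∀ j, u j = ∑ s, c j s • w s) (hc : ∀ j s, c j s ∈ degLE lam (du j - wt s)) :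
    χ u ∈ degLE lam (d + ∑ j, du j) := by
  rw [show u = fun j => ∑ s, c j s • w s from funext hu, map_sum_smul]
  refine Submodule.sum_mem _ fun i _ => ?_
  by_cases hi : Function.Injective i
  · have h1 := prod_mem_degLE Finset.univ (fun j => du j - wt (i j)) (fun j => c j (i j))
      (fun j _ => hc j (i j))
    have h2 := mul_mem_degLE h1 (hχ i hi)
    rw [Finset.sum_sub_distrib] at h2
    rwa [show ∑ j, du j - ∑ j, wt (i j) + (d + ∑ j, wt (i j)) = d + ∑ j, du j by ring] at h2
  · rw [χ.map_eq_zero_of_not_injective _ (fun h => hi h.of_comp), mul_zero]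
    exact Submodule.zero_mem _

theorem wedgeEv_mem_degLE {lam : ℤ × ℤ →+ ℤ} (ev : M →ₗ[Lau k] Lau k)
    (χ : M [⋀^Fin n]→ₗ[Lau k] Lau k) (v : Fin (n + 1) → M) (d : ℤ) (dv : Fin (n + 1) → ℤ)
    (hev : ∀ i, ev (v i) ∈ degLE lam (dv i))
    (hχ : ∀ i, χ (i.removeNth v) ∈ degLE lam (d - dv i)) :
    wedgeEv ev n χ v ∈ degLE lam d := by
  rw [wedgeEv_apply]
  refine Submodule.sum_mem _ fun i _ => neg_one_pow_mul_mem _ _ ?_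
  have := mul_mem_degLE (hev i) (hχ i)
  rwa [add_sub_cancel] at this

end Weighted

/-- Keep only the terms whose exponent satisfies a given predicate. -/
def trunc (P : ℤ × ℤ → Prop) [DecidablePred P] : Lau k →ₗ[k] Lau k where
  toFun f := AddMonoidAlgebra.ofCoeff (f.coeff.filter P)
  map_add' f g := by
    apply AddMonoidAlgebra.ext
    simp [Finsupp.filter_add]
  map_smul' c f := by
    apply AddMonoidAlgebra.ext
    simp [Finsupp.filter_smul]

theorem cf_trunc (P : ℤ × ℤ → Prop) [DecidablePred P] (s : ℤ × ℤ) (f : Lau k) :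
    cf s (trunc P f) = if P s then cf s f else 0 := by
  simp [cf_def, trunc, Finsupp.filter_apply]

theorem trunc_mem_degLE {lam : ℤ × ℤ →+ ℤ} {d : ℤ} (P : ℤ × ℤ → Prop) [DecidablePred P]
    {f : Lau k} (hf : f ∈ degLE lam d) : trunc P f ∈ degLE lam d := by
  intro s hs
  rw [cf_trunc, hf s hs, ite_self]

theorem trunc_add_trunc_not (P : ℤ × ℤ → Prop) [DecidablePred P] (f : Lau k) :
    trunc P f + trunc (fun s => ¬ P s) f = f := by
  refine lau_ext fun s => ?_
  rw [map_add, cf_trunc, cf_trunc]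
  by_cases h : P s <;> simp [h]

theorem exists_perm_of_range_eq {T : Type*} {n : ℕ} {i i' : Fin n → T} (hi : Function.Injective i)
    (hi' : Function.Injective i') (h : Set.range i = Set.range i') :
    ∃ σ : Equiv.Perm (Fin n), i = i' ∘ σ := by
  refine ⟨(Equiv.ofInjective i hi).trans ((Equiv.setCongr h).trans
    (Equiv.ofInjective i' hi').symm), ?_⟩
  funext j
  simp only [Function.comp_apply, Equiv.trans_apply]
  rw [Equiv.apply_ofInjective_symm hi']
  rfl

section FormOf

variable {S : Type*} [Fintype S] {n : ℕ}

/-- An auxiliary linear order on a finite type. -/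
abbrev finOrd (S : Type*) [Fintype S] : LinearOrder S :=
  LinearOrder.lift' (Fintype.equivFin S) (Equiv.injective _)

/-- An enumeration of a finite set of given cardinality. -/
def srt (U : {U : Finset S // U.card = n}) : Fin n → S :=
  letI := finOrd S
  U.1.orderEmbOfFin U.2

theorem srt_injective (U : {U : Finset S // U.card = n}) : Function.Injective (srt U) := by
  let := finOrd S
  exact (U.1.orderEmbOfFin U.2).injective

theorem range_srt (U : {U : Finset S // U.card = n}) : Set.range (srt U) = U.1 := by
  let := finOrd S
  exact U.1.range_orderEmbOfFin U.2

theorem mem_range_srt (U : {U : Finset S // U.card = n}) (s : S) :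
    (∃ j, srt U j = s) ↔ s ∈ U.1 := by
  have := range_srt U
  rw [Set.ext_iff] at this
  simpa using this s

theorem exists_srt (i : Fin n → S) (hi : Function.Injective i) :
    ∃ (U : {U : Finset S // U.card = n}) (σ : Equiv.Perm (Fin n)),
      i = srt U ∘ σ ∧ ∀ s, s ∈ U.1 ↔ ∃ j, i j = s := by
  classical
  let U : {U : Finset S // U.card = n} :=
    ⟨Finset.univ.image i, by rw [Finset.card_image_of_injective _ hi]; simp⟩
  obtain ⟨σ, hσ⟩ := exists_perm_of_range_eq hi (srt_injective U) (by rw [range_srt]; simp [U])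
  exact ⟨U, σ, hσ, fun s => by simp [U]⟩

variable {R M : Type*} [CommRing R] [AddCommGroup M] [Module R M] (bs : Module.Basis S R M)

/-- The alternating form with prescribed values on the enumerated tuples of basis vectors. -/
def formOf (h : {U : Finset S // U.card = n} → R) : M [⋀^Fin n]→ₗ[R] R :=
  letI := finOrd S
  exteriorPower.alternatingMapLinearEquiv.symm
    ((bs.exteriorPower n).constr R fun s => h ⟨s.1, s.2⟩)

theorem formOf_srt (h : {U : Finset S // U.card = n} → R) (U : {U : Finset S // U.card = n}) :
    formOf bs h (bs ∘ srt U) = h U := by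
  let := finOrd S
  have h1 := (bs.exteriorPower n).constr_basis R (fun s => h ⟨s.1, s.2⟩) ⟨U.1, U.2⟩
  rw [exteriorPower.basis_apply] at h1
  exact h1

theorem form_ext {ω ω' : M [⋀^Fin n]→ₗ[R] R}
    (h : ∀ U : {U : Finset S // U.card = n}, ω (bs ∘ srt U) = ω' (bs ∘ srt U)) : ω = ω' := by
  refine bs.ext_alternating fun i hi => ?_
  obtain ⟨U, σ, rfl, -⟩ := exists_srt i hi
  have h1 := ω.map_perm (bs ∘ srt U) σ
  have h2 := ω'.map_perm (bs ∘ srt U) σ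
  rw [h U, ← h2] at h1
  exact h1

end FormOf

section TruncForm

variable {k : Type*} [Field k] {S : Type*} [Fintype S] {n : ℕ} {M : Type*} [AddCommGroup M]
  [Module (Lau k) M] (bs : Module.Basis S (Lau k) M)

/-- Apply a linear map to the values of a form on tuples of vectors of a given basis. -/
def truncForm (τ : Lau k →ₗ[k] Lau k) (ω : M [⋀^Fin n]→ₗ[Lau k] Lau k) :
    M [⋀^Fin n]→ₗ[Lau k] Lau k :=
  formOf bs fun U => τ (ω (bs ∘ srt U))

theorem truncForm_apply (τ : Lau k →ₗ[k] Lau k) (ω : M [⋀^Fin n]→ₗ[Lau k] Lau k)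
    (i : Fin n → S) : truncForm bs τ ω (bs ∘ i) = τ (ω (bs ∘ i)) := by
  by_cases hi : Function.Injective i
  · obtain ⟨U, σ, rfl, -⟩ := exists_srt i hi
    have h1 := (truncForm bs τ ω).map_perm (bs ∘ srt U) σ
    have h2 := ω.map_perm (bs ∘ srt U) σ
    rw [Function.comp_assoc] at h1 h2
    rw [h1, h2, truncForm, formOf_srt]
    rcases Int.units_eq_one_or (Equiv.Perm.sign σ) with h | h <;> simp [h]
  · rw [AlternatingMap.map_eq_zero_of_not_injective _ _ (fun h => hi h.of_comp),
      AlternatingMap.map_eq_zero_of_not_injective _ _ (fun h => hi h.of_comp), map_zero]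

theorem truncForm_add (τ : Lau k →ₗ[k] Lau k) (ω ω' : M [⋀^Fin n]→ₗ[Lau k] Lau k) :
    truncForm bs τ (ω + ω') = truncForm bs τ ω + truncForm bs τ ω' :=
  form_ext bs fun U => by simp [truncForm_apply]

theorem truncForm_smul (τ : Lau k →ₗ[k] Lau k) (c : k) (ω : M [⋀^Fin n]→ₗ[Lau k] Lau k) :
    truncForm bs τ (c • ω) = c • truncForm bs τ ω :=
  form_ext bs fun U => by simp [truncForm_apply]

theorem truncForm_add_truncForm_not (P : ℤ × ℤ → Prop) [DecidablePred P]
    (ω : M [⋀^Fin n]→ₗ[Lau k] Lau k) :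
    truncForm bs (trunc P) ω + truncForm bs (trunc fun s => ¬ P s) ω = ω :=
  form_ext bs fun U => by
    rw [AlternatingMap.add_apply, truncForm_apply, truncForm_apply, trunc_add_trunc_not]

end TruncForm

section Filt

variable {k : Type*} [Field k] {M : Type*} [AddCommGroup M] [Module (Lau k) M]
  {S T : Type*} [Fintype S] [Fintype T]

variable (k) in
/-- Combinations of a weighted family of vectors of `lam`-degree at most `d`. -/
def filt (lam : ℤ × ℤ →+ ℤ) (w : S → M) (wt : S → ℤ) (d : ℤ) : AddSubgroup M where
  carrier := {u | ∃ c : S → Lau k, u = ∑ s, c s • w s ∧ ∀ s, c s ∈ degLE lam (d - wt s)}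
  add_mem' := by
    rintro _ _ ⟨c, rfl, hc⟩ ⟨c', rfl, hc'⟩
    refine ⟨c + c', ?_, fun s => Submodule.add_mem _ (hc s) (hc' s)⟩
    simp [add_smul, Finset.sum_add_distrib]
  zero_mem' := ⟨0, by simp, fun s => Submodule.zero_mem _⟩
  neg_mem' := by
    rintro _ ⟨c, rfl, hc⟩
    exact ⟨-c, by simp, fun s => Submodule.neg_mem _ (hc s)⟩

variable {lam : ℤ × ℤ →+ ℤ} {w : S → M} {wt : S → ℤ} {d e : ℤ}

theorem self_mem_filt (s : S) : w s ∈ filt k lam w wt (wt s) := by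
  classical
  refine ⟨Pi.single s 1, by simp [Pi.single_apply], fun t => ?_⟩
  rw [Pi.single_apply]
  split_ifs with h
  · rw [h, sub_self]; exact one_mem_degLE
  · exact Submodule.zero_mem _

theorem smul_mem_filt {f : Lau k} {u : M} (hf : f ∈ degLE lam e) (hu : u ∈ filt k lam w wt d) :
    f • u ∈ filt k lam w wt (e + d) := by
  obtain ⟨c, rfl, hc⟩ := hu
  refine ⟨f • c, by simp [Finset.smul_sum, mul_smul], fun s => ?_⟩
  rw [add_sub_assoc]
  exact mul_mem_degLE hf (hc s)

theorem filt_mono (h : d ≤ e) {u : M} (hu : u ∈ filt k lam w wt d) : u ∈ filt k lam w wt e := by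
  obtain ⟨c, rfl, hc⟩ := hu
  exact ⟨c, rfl, fun s => degLE_mono (by omega) (hc s)⟩

theorem smul_mem_filt_of_le {f : Lau k} {u : M} {d' : ℤ} (hf : f ∈ degLE lam e)
    (hu : u ∈ filt k lam w wt d) (h : e + d ≤ d') : f • u ∈ filt k lam w wt d' :=
  filt_mono h (smul_mem_filt hf hu)

theorem filt_trans {w' : T → M} {wt' : T → ℤ} (h : ∀ t, w' t ∈ filt k lam w wt (wt' t)) {u : M}
    (hu : u ∈ filt k lam w' wt' d) : u ∈ filt k lam w wt d := by
  obtain ⟨c, rfl, hc⟩ := hu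
  refine AddSubgroup.sum_mem _ fun t _ => smul_mem_filt_of_le (hc t) (h t) (by omega)

theorem mem_span_of_mem_filt {u : M} (hu : u ∈ filt k lam w wt d) :
    u ∈ Submodule.span (Lau k) (Set.range w) := by
  obtain ⟨c, rfl, -⟩ := hu
  exact Submodule.sum_mem _ fun s _ =>
    Submodule.smul_mem _ _ (Submodule.subset_span (Set.mem_range_self s))

theorem map_mem_degLE_of_filt {n : ℕ} (χ : M [⋀^Fin n]→ₗ[Lau k] Lau k)
    (hχ : ∀ i : Fin n → S, Function.Injective i → χ (w ∘ i) ∈ degLE lam (d + ∑ j, wt (i j)))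
    (u : Fin n → M) (du : Fin n → ℤ) (hu : ∀ j, u j ∈ filt k lam w wt (du j)) :
    χ u ∈ degLE lam (d + ∑ j, du j) := by
  choose c hc hd using hu
  exact map_mem_degLE χ w wt d hχ u du c hc hd

end Filt

section Vectors

variable (k : Type*) [Field k] (a b : ℕ)

/-- The index set of the coordinates. -/
abbrev Ix (a b : ℕ) := Fin (a + 1) × Fin (b + 1)

/-- The free module of rank `(a + 1) * (b + 1)`. -/
abbrev VM := Ix a b → Lau k

/-- The standard basis. -/
def eb : Module.Basis (Ix a b) (Lau k) (VM k a b) := Pi.basisFun (Lau k) (Ix a b)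

/-- The linear form sending the `(m, n)`-th basis vector to `x ^ m z ^ n`. -/
def evm : VM k a b →ₗ[Lau k] Lau k :=
  (eb k a b).constr (Lau k) fun s => mon (((s.1 : ℕ) : ℤ), ((s.2 : ℕ) : ℤ))

/-- The `x`-degree. -/
abbrev xd : ℤ × ℤ →+ ℤ := AddMonoidHom.fst ℤ ℤ

/-- The `z`-degree. -/
abbrev zd : ℤ × ℤ →+ ℤ := AddMonoidHom.snd ℤ ℤ

/-- The index set of the bases adapted to the `z`-direction. -/
abbrev Jx (a b : ℕ) := Fin (a + 1) ⊕ (Fin (a + 1) × Fin b)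

/-- The index set of the bases adapted to both directions. -/
abbrev Kx (a b : ℕ) := Unit ⊕ (Fin a ⊕ (Fin (a + 1) × Fin b))

/-- The syzygies in the `z`-direction. -/
def fv (s : Fin (a + 1) × Fin b) : VM k a b :=
  eb k a b (s.1, s.2.succ) - (mon (0, 1) : Lau k) • eb k a b (s.1, s.2.castSucc)

theorem evm_eb (s : Ix a b) : evm k a b (eb k a b s) = mon (((s.1 : ℕ) : ℤ), ((s.2 : ℕ) : ℤ)) := by
  simp [evm]

theorem evm_fv (s : Fin (a + 1) × Fin b) : evm k a b (fv k a b s) = 0 := by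
  simp only [fv, map_sub, map_smul, evm_eb, smul_eq_mul, mon_mul_mon, Prod.mk_add_mk]
  simp [add_comm]

variable {k a b}

/-- The vectors `ε` together with the syzygies in the `z`-direction. -/
def cvec (ε : Fin (a + 1) → VM k a b) : Jx a b → VM k a b := Sum.elim ε (fv k a b)

/-- Weights of the vectors `cvec`. -/
def cwt (wE wF : ℤ) : Jx a b → ℤ := Sum.elim (fun _ => wE) (fun _ => wF)

/-- The syzygies in the `x`-direction between the vectors `ε`. -/
def gv (ε : Fin (a + 1) → VM k a b) (l : Fin a) : VM k a b :=
  ε l.succ - (mon (1, 0) : Lau k) • ε l.castSucc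

/-- The vector `ε₀` together with the syzygies in both directions. -/
def bvec (ε : Fin (a + 1) → VM k a b) (e₀ : VM k a b) : Kx a b → VM k a b :=
  Sum.elim (fun _ => e₀) (Sum.elim (gv ε) (fv k a b))

/-- Weights of the vectors `bvec`. -/
def bwt (wE wG wF : ℤ) : Kx a b → ℤ :=
  Sum.elim (fun _ => wE) (Sum.elim (fun _ => wG) (fun _ => wF))

variable (k a b) in
/-- Vectors generating, together with the syzygies `fv`, the free module, with degree bounds
for the changes of bases. -/
structure Chart where
  ε : Fin (a + 1) → VM k a b
  lam : ℤ × ℤ →+ ℤ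
  wE : ℤ
  wF : ℤ
  lam_x : ∀ n : ℤ, lam (n, 0) = 0
  ev_ε : ∀ m, evm k a b (ε m) = mon (((m : ℕ) : ℤ), 0)
  eb_mem : ∀ s, eb k a b s ∈ filt k lam (cvec ε) (cwt wE wF) 0
  eb_mem_x : ∀ s, eb k a b s ∈ filt k xd (cvec ε) 0 0
  eb_mem_neg_x : ∀ s, eb k a b s ∈ filt k (-xd) (cvec ε) 0 0
  c_mem : ∀ j, cvec ε j ∈ filt k lam (eb k a b) 0 (cwt wE wF j)
  c_mem_x : ∀ j, cvec ε j ∈ filt k xd (eb k a b) 0 0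
  c_mem_neg_x : ∀ j, cvec ε j ∈ filt k (-xd) (eb k a b) 0 0

theorem fv_mem_filt {lam : ℤ × ℤ →+ ℤ} {d : ℤ} (h0 : 0 ≤ d) (h : lam (0, 1) ≤ d)
    (s : Fin (a + 1) × Fin b) : fv k a b s ∈ filt k lam (eb k a b) 0 d := by
  refine AddSubgroup.sub_mem _ (filt_mono h0 (self_mem_filt (wt := 0) _)) ?_
  exact smul_mem_filt_of_le (mon_mem_degLE h) (self_mem_filt (wt := 0) _) (by simp)

theorem eb_mem_filt_of_zero {lam : ℤ × ℤ →+ ℤ} {ε : Fin (a + 1) → VM k a b} {wt : Jx a b → ℤ}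
    (hε : ∀ m, eb k a b (m, 0) ∈ filt k lam (cvec ε) wt 0) (hz : lam (0, 1) ≤ 0)
    (hf : ∀ s, wt (Sum.inr s) ≤ 0) (s : Ix a b) : eb k a b s ∈ filt k lam (cvec ε) wt 0 := by
  obtain ⟨m, n⟩ := s
  induction n using Fin.induction with
  | zero => exact hε m
  | succ n ih =>
    have : eb k a b (m, n.succ) = cvec ε (Sum.inr (m, n)) +
        (mon (0, 1) : Lau k) • eb k a b (m, n.castSucc) := by
      simp [cvec, fv]
    rw [this]
    exact AddSubgroup.add_mem _ (filt_mono (hf (m, n)) (self_mem_filt _))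
      (smul_mem_filt_of_le (mon_mem_degLE hz) ih (by simp))

theorem eb_mem_filt_of_last {lam : ℤ × ℤ →+ ℤ} {ε : Fin (a + 1) → VM k a b} {wt : Jx a b → ℤ}
    (hε : ∀ m, eb k a b (m, Fin.last b) ∈ filt k lam (cvec ε) wt 0) (hz : lam (0, -1) ≤ 0)
    (hf : ∀ s, lam (0, -1) + wt (Sum.inr s) ≤ 0) (s : Ix a b) :
    eb k a b s ∈ filt k lam (cvec ε) wt 0 := by
  obtain ⟨m, n⟩ := s
  induction n using Fin.reverseInduction with
  | last => exact hε m
  | cast n ih =>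
    have : eb k a b (m, n.castSucc) = (mon (0, -1) : Lau k) • eb k a b (m, n.succ) -
        (mon (0, -1) : Lau k) • cvec ε (Sum.inr (m, n)) := by
      simp only [cvec, Sum.elim_inr, fv, smul_sub, smul_smul, mon_mul_mon]
      simp [mon_zero_zero]
    rw [this]
    exact AddSubgroup.sub_mem _ (smul_mem_filt_of_le (mon_mem_degLE hz) ih (by simp))
      (smul_mem_filt_of_le (mon_mem_degLE le_rfl) (self_mem_filt _) (hf _))

variable (k a b) in
/-- The vectors of the chart at zero. -/
def ez (m : Fin (a + 1)) : VM k a b := eb k a b (m, 0)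

variable (k a b) in
/-- The vectors of the chart at infinity. -/
def ei (m : Fin (a + 1)) : VM k a b := (mon (0, -(b : ℤ)) : Lau k) • eb k a b (m, Fin.last b)

theorem eb_last (m : Fin (a + 1)) :
    eb k a b (m, Fin.last b) = (mon (0, (b : ℤ)) : Lau k) • ei k a b m := by
  rw [ei, smul_smul, mon_mul_mon]
  simp [mon_zero_zero]

theorem cvec_inl_mem {lam : ℤ × ℤ →+ ℤ} {ε : Fin (a + 1) → VM k a b} {wt : Jx a b → ℤ}
    (m : Fin (a + 1)) (h : wt (Sum.inl m) ≤ 0) : ε m ∈ filt k lam (cvec ε) wt 0 :=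
  filt_mono h (self_mem_filt (w := cvec ε) (Sum.inl m))

variable (k a b) in
/-- The chart at `z = 0`. -/
def chartZ : Chart k a b where
  ε := ez k a b
  lam := -zd
  wE := 0
  wF := 0
  lam_x n := by simp
  ev_ε m := by simp [ez, evm_eb]
  eb_mem := eb_mem_filt_of_zero (fun m => cvec_inl_mem m (by simp [cwt])) (by simp)
    (by simp [cwt])
  eb_mem_x := eb_mem_filt_of_zero (fun m => cvec_inl_mem m (by simp)) (by simp) (by simp)
  eb_mem_neg_x := eb_mem_filt_of_zero (fun m => cvec_inl_mem m (by simp)) (by simp) (by simp)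
  c_mem := by
    rintro (m | s)
    · exact self_mem_filt (wt := 0) _
    · exact fv_mem_filt le_rfl (by simp) s
  c_mem_x := by
    rintro (m | s)
    · exact self_mem_filt (wt := 0) _
    · exact fv_mem_filt le_rfl (by simp) s
  c_mem_neg_x := by
    rintro (m | s)
    · exact self_mem_filt (wt := 0) _
    · exact fv_mem_filt le_rfl (by simp) s

variable (k a b) in
/-- The chart at `z = ∞`. -/
def chartI : Chart k a b where
  ε := ei k a b
  lam := zd
  wE := -b
  wF := 1
  lam_x n := by simp
  ev_ε m := by simp [ei, evm_eb, mon_mul_mon]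
  eb_mem := eb_mem_filt_of_last
    (fun m => by
      rw [eb_last]
      exact smul_mem_filt_of_le (mon_mem_degLE le_rfl)
        (self_mem_filt (w := cvec (ei k a b)) (Sum.inl m)) (by simp [cwt]))
    (by simp) (by simp [cwt])
  eb_mem_x := eb_mem_filt_of_last
    (fun m => by
      rw [eb_last]
      exact smul_mem_filt_of_le (mon_mem_degLE le_rfl)
        (self_mem_filt (w := cvec (ei k a b)) (Sum.inl m)) (by simp))
    (by simp) (by simp)
  eb_mem_neg_x := eb_mem_filt_of_last
    (fun m => by
      rw [eb_last]
      exact smul_mem_filt_of_le (mon_mem_degLE le_rfl)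
        (self_mem_filt (w := cvec (ei k a b)) (Sum.inl m)) (by simp))
    (by simp) (by simp)
  c_mem := by
    rintro (m | s)
    · exact smul_mem_filt_of_le (mon_mem_degLE le_rfl) (self_mem_filt (wt := 0) _)
        (by simp [cwt])
    · exact fv_mem_filt (by simp [cwt]) (by simp [cwt]) s
  c_mem_x := by
    rintro (m | s)
    · exact smul_mem_filt_of_le (mon_mem_degLE le_rfl) (self_mem_filt (wt := 0) _) (by simp)
    · exact fv_mem_filt le_rfl (by simp) s
  c_mem_neg_x := by
    rintro (m | s)
    · exact smul_mem_filt_of_le (mon_mem_degLE le_rfl) (self_mem_filt (wt := 0) _) (by simp)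
    · exact fv_mem_filt le_rfl (by simp) s

theorem top_le_span_of_eb {S : Type*} (w : S → VM k a b)
    (h : ∀ s, eb k a b s ∈ Submodule.span (Lau k) (Set.range w)) :
    ⊤ ≤ Submodule.span (Lau k) (Set.range w) := by
  rw [← (eb k a b).span_eq, Submodule.span_le]
  rintro _ ⟨s, rfl⟩
  exact h s

namespace Chart

variable (C : Chart k a b)

/-- The basis adapted to the `z`-direction. -/
def cbasis : Module.Basis (Jx a b) (Lau k) (VM k a b) :=
  basisOfTopLeSpanOfCardEqFinrank (cvec C.ε)
    (top_le_span_of_eb _ fun s => mem_span_of_mem_filt (C.eb_mem s)) (by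
      simp only [Module.finrank_fintype_fun_eq_card, Fintype.card_sum, Fintype.card_prod,
        Fintype.card_fin]
      ring)

theorem coe_cbasis : ⇑C.cbasis = cvec C.ε := by
  simp [cbasis]

theorem ev_gv (l : Fin a) : evm k a b (gv C.ε l) = 0 := by
  simp only [gv, map_sub, map_smul, C.ev_ε, smul_eq_mul, mon_mul_mon, Prod.mk_add_mk]
  simp [add_comm]

theorem ε_mem_bvec {lam : ℤ × ℤ →+ ℤ} {wt : Kx a b → ℤ} {d : ℤ} (hx : lam (1, 0) ≤ 0)
    (h0 : wt (Sum.inl ()) ≤ d) (hg : ∀ l, wt (Sum.inr (Sum.inl l)) ≤ d) (m : Fin (a + 1)) :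
    C.ε m ∈ filt k lam (bvec C.ε (C.ε 0)) wt d := by
  induction m using Fin.induction with
  | zero => exact filt_mono h0 (self_mem_filt (w := bvec C.ε (C.ε 0)) (Sum.inl ()))
  | succ l ih =>
    have : C.ε l.succ = bvec C.ε (C.ε 0) (Sum.inr (Sum.inl l)) +
        (mon (1, 0) : Lau k) • C.ε l.castSucc := by
      simp [bvec, gv]
    rw [this]
    exact AddSubgroup.add_mem _ (filt_mono (hg l) (self_mem_filt _))
      (smul_mem_filt_of_le (mon_mem_degLE hx) ih (by simp))

theorem ε_mem_bvec_last {lam : ℤ × ℤ →+ ℤ} {wt : Kx a b → ℤ} {d : ℤ} (hx : lam (-1, 0) ≤ 0)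
    (h0 : wt (Sum.inl ()) ≤ d) (hg : ∀ l, lam (-1, 0) + wt (Sum.inr (Sum.inl l)) ≤ d)
    (m : Fin (a + 1)) : C.ε m ∈ filt k lam (bvec C.ε (C.ε (Fin.last a))) wt d := by
  induction m using Fin.reverseInduction with
  | last => exact filt_mono h0 (self_mem_filt (w := bvec C.ε (C.ε (Fin.last a))) (Sum.inl ()))
  | cast l ih =>
    have : C.ε l.castSucc = (mon (-1, 0) : Lau k) • C.ε l.succ -
        (mon (-1, 0) : Lau k) • bvec C.ε (C.ε (Fin.last a)) (Sum.inr (Sum.inl l)) := by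
      simp only [bvec, Sum.elim_inr, Sum.elim_inl, gv, smul_sub, smul_smul, mon_mul_mon]
      simp [mon_zero_zero]
    rw [this]
    exact AddSubgroup.sub_mem _ (smul_mem_filt_of_le (mon_mem_degLE hx) ih (by simp))
      (smul_mem_filt_of_le (mon_mem_degLE le_rfl) (self_mem_filt _) (hg l))

theorem eb_mem_bvec (s : Ix a b) :
    eb k a b s ∈ filt k C.lam (bvec C.ε (C.ε 0)) (bwt C.wE C.wE C.wF) 0 := by
  refine filt_trans (w' := cvec C.ε) ?_ (C.eb_mem s)
  rintro (m | s)
  · exact C.ε_mem_bvec (by rw [C.lam_x]) (by simp [cwt, bwt]) (by simp [cwt, bwt]) m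
  · exact self_mem_filt (w := bvec C.ε (C.ε 0)) (Sum.inr (Sum.inr s))

theorem eb_mem_bvec_neg_x (s : Ix a b) :
    eb k a b s ∈ filt k (-xd) (bvec C.ε (C.ε 0)) 0 0 := by
  refine filt_trans (w' := cvec C.ε) ?_ (C.eb_mem_neg_x s)
  rintro (m | s)
  · exact C.ε_mem_bvec (by simp) (by simp) (by simp) m
  · exact self_mem_filt (w := bvec C.ε (C.ε 0)) (wt := 0) (Sum.inr (Sum.inr s))

theorem eb_mem_bvec_x (s : Ix a b) :
    eb k a b s ∈ filt k xd (bvec C.ε (C.ε (Fin.last a))) (bwt 0 1 0) 0 := by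
  refine filt_trans (w' := cvec C.ε) ?_ (C.eb_mem_x s)
  rintro (m | s)
  · exact C.ε_mem_bvec_last (by simp) (by simp [bwt]) (by simp [bwt]) m
  · exact self_mem_filt (w := bvec C.ε (C.ε (Fin.last a))) (wt := bwt 0 1 0) (Sum.inr (Sum.inr s))

/-- The basis adapted to both directions. -/
def bbasis : Module.Basis (Kx a b) (Lau k) (VM k a b) :=
  basisOfTopLeSpanOfCardEqFinrank (bvec C.ε (C.ε 0))
    (top_le_span_of_eb _ fun s => mem_span_of_mem_filt (C.eb_mem_bvec s)) (by
      simp only [Module.finrank_fintype_fun_eq_card, Fintype.card_sum, Fintype.card_prod,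
        Fintype.card_fin, Fintype.card_unit]
      ring)

theorem coe_bbasis : ⇑C.bbasis = bvec C.ε (C.ε 0) := by
  simp [bbasis]

theorem ε_mem (m : Fin (a + 1)) : C.ε m ∈ filt k C.lam (eb k a b) 0 C.wE := C.c_mem (Sum.inl m)

theorem gv_mem (l : Fin a) : gv C.ε l ∈ filt k C.lam (eb k a b) 0 C.wE :=
  AddSubgroup.sub_mem _ (C.ε_mem _)
    (smul_mem_filt_of_le (mon_mem_degLE le_rfl) (C.ε_mem _) (by rw [C.lam_x, zero_add]))

theorem gv_mem_x (l : Fin a) : gv C.ε l ∈ filt k xd (eb k a b) 0 1 :=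
  AddSubgroup.sub_mem _ (filt_mono zero_le_one (C.c_mem_x (Sum.inl _)))
    (smul_mem_filt_of_le (mon_mem_degLE le_rfl) (C.c_mem_x (Sum.inl _)) (by simp))

theorem gv_mem_neg_x (l : Fin a) : gv C.ε l ∈ filt k (-xd) (eb k a b) 0 0 :=
  AddSubgroup.sub_mem _ (C.c_mem_neg_x (Sum.inl _))
    (smul_mem_filt_of_le (mon_mem_degLE le_rfl) (C.c_mem_neg_x (Sum.inl _)) (by simp))

end Chart

theorem sum_fin_succ_sub {G : Type*} [AddCommGroup G] (n : ℕ) (F : Fin (n + 1) → G) :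
    ∑ i : Fin n, (F i.succ - F i.castSucc) = F (Fin.last n) - F 0 := by
  induction n with
  | zero => simp
  | succ n ih =>
    have := ih (fun i => F i.castSucc)
    simp only [Fin.castSucc_zero] at this
    rw [Fin.sum_univ_castSucc]
    simp only [Fin.succ_castSucc, Fin.succ_last]
    rw [this]
    abel

theorem ei_eq (m : Fin (a + 1)) :
    ei k a b m = ez k a b m + ∑ n : Fin b, (mon (0, -1 - (n : ℤ)) : Lau k) • fv k a b (m, n) := by
  have h := sum_fin_succ_sub b fun n => (mon (0, -((n : ℕ) : ℤ)) : Lau k) • eb k a b (m, n)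
  have h2 : ∀ n : Fin b, (mon (0, -1 - (n : ℤ)) : Lau k) • fv k a b (m, n) =
      (mon (0, -((n.succ : ℕ) : ℤ)) : Lau k) • eb k a b (m, n.succ) -
        (mon (0, -((n.castSucc : ℕ) : ℤ)) : Lau k) • eb k a b (m, n.castSucc) := by
    intro n
    rw [fv, smul_sub, smul_smul, mon_mul_mon]
    congr 3
    · simp; ring
    · simp; ring
  rw [Finset.sum_congr rfl fun n _ => h2 n, h]
  simp [ei, ez, mon_zero_zero]

theorem gv_ei_eq (l : Fin a) :
    gv (ei k a b) l = gv (ez k a b) l + ∑ n : Fin b, (mon (0, -1 - (n : ℤ)) : Lau k) •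
      (fv k a b (l.succ, n) - (mon (1, 0) : Lau k) • fv k a b (l.castSucc, n)) := by
  rw [gv, ei_eq, ei_eq, gv]
  simp only [smul_add, smul_sub, Finset.sum_sub_distrib, Finset.smul_sum, smul_smul, mul_comm]
  abel

end Vectors

section TAnalysis

variable (k : Type*) [Field k] (a b : ℕ)

/-- Alternating forms over the Laurent polynomial ring. -/
abbrev Alt (n : ℕ) := VM k a b [⋀^Fin n]→ₗ[Lau k] Lau k

/-- The index set of the syzygies in both directions. -/
abbrev Gx (a b : ℕ) := Fin a ⊕ (Fin (a + 1) × Fin b)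

variable {k a b}

/-- The values of a form on tuples of standard basis vectors have bounded degree. -/
def EB {n : ℕ} (lam : ℤ × ℤ →+ ℤ) (d : ℤ) (χ : Alt k a b n) : Prop :=
  ∀ i : Fin n → Ix a b, χ (eb k a b ∘ i) ∈ degLE lam d

theorem EB.map_mem {n : ℕ} {lam : ℤ × ℤ →+ ℤ} {d : ℤ} {χ : Alt k a b n} (h : EB lam d χ)
    (u : Fin n → VM k a b) (du : Fin n → ℤ) (hu : ∀ j, u j ∈ filt k lam (eb k a b) 0 (du j)) :
    χ u ∈ degLE lam (d + ∑ j, du j) :=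
  map_mem_degLE_of_filt χ (fun i _ => by simpa using h i) u du hu

/-- Cocycles: closed forms whose values on standard tuples are supported in a box. -/
structure InZ (ω : Alt k a b (b + 2)) : Prop where
  closed : wedgeEv (evm k a b) (b + 2) ω = 0
  neg_x : EB (-xd) 0 ω
  x : EB xd a ω
  neg_z : EB (-zd) 0 ω
  z : EB zd b ω

/-- Contraction of a form with the extreme vectors of a chart. -/
def theta (ε : Fin (a + 1) → VM k a b) (ω : Alt k a b (b + 2)) : Alt k a b b :=
  (ω.curryLeft (ε 0)).curryLeft (ε (Fin.last a))

theorem theta_apply (ε : Fin (a + 1) → VM k a b) (ω : Alt k a b (b + 2)) (u : Fin b → VM k a b) :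
    theta ε ω u = ω (vecCons (ε 0) (vecCons (ε (Fin.last a)) u)) := rfl

/-- The syzygies in both directions. -/
def vv (ε : Fin (a + 1) → VM k a b) : Gx a b → VM k a b := Sum.elim (gv ε) (fv k a b)

/-- The number of syzygies in the `x`-direction. -/
def gw : Gx a b → ℤ := Sum.elim (fun _ => 1) (fun _ => 0)

theorem gw_nonneg (s : Gx a b) : 0 ≤ gw s := by
  rcases s with s | s <;> simp [gw]

theorem sum_vecCons (n : ℕ) (x : ℤ) (v : Fin n → ℤ) :
    ∑ j, vecCons x v j = x + ∑ j, v j := by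
  rw [Fin.sum_univ_succ]
  simp

theorem vecCons_mem_filt {n : ℕ} {lam : ℤ × ℤ →+ ℤ} {u : VM k a b} {v : Fin n → VM k a b}
    {d : ℤ} {dv : Fin n → ℤ} (hu : u ∈ filt k lam (eb k a b) 0 d)
    (hv : ∀ j, v j ∈ filt k lam (eb k a b) 0 (dv j)) (j : Fin (n + 1)) :
    vecCons u v j ∈ filt k lam (eb k a b) 0 (vecCons d dv j) := by
  refine Fin.cases ?_ (fun j => ?_) j
  · simpa using hu
  · simpa using hv j

namespace Chart

variable (C : Chart k a b)

theorem ev_vv (s : Gx a b) : evm k a b (vv C.ε s) = 0 := by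
  rcases s with l | s
  · exact C.ev_gv l
  · exact evm_fv k a b s

theorem vv_mem (s : Gx a b) :
    vv C.ε s ∈ filt k C.lam (eb k a b) 0 (C.wF + gw s * (C.wE - C.wF)) := by
  rcases s with l | s
  · rw [show C.wF + gw (Sum.inl l : Gx a b) * (C.wE - C.wF) = C.wE by simp [gw]]
    exact C.gv_mem l
  · rw [show C.wF + gw (Sum.inr s : Gx a b) * (C.wE - C.wF) = C.wF by simp [gw]]
    exact C.c_mem (Sum.inr s)

theorem vv_mem_x (s : Gx a b) : vv C.ε s ∈ filt k xd (eb k a b) 0 (gw s) := by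
  rcases s with l | s
  · exact C.gv_mem_x l
  · exact C.c_mem_x (Sum.inr s)

theorem vv_mem_neg_x (s : Gx a b) : vv C.ε s ∈ filt k (-xd) (eb k a b) 0 0 := by
  rcases s with l | s
  · exact C.gv_mem_neg_x l
  · exact C.c_mem_neg_x (Sum.inr s)

theorem theta_mem {ω : Alt k a b (b + 2)} {d : ℤ} (hω : EB C.lam d ω) (u : Fin b → VM k a b)
    (du : Fin b → ℤ) (hu : ∀ j, u j ∈ filt k C.lam (eb k a b) 0 (du j)) :
    theta C.ε ω u ∈ degLE C.lam (d + (C.wE + (C.wE + ∑ j, du j))) := by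
  have := hω.map_mem _ _ (vecCons_mem_filt (C.ε_mem 0) (vecCons_mem_filt (C.ε_mem (Fin.last a)) hu))
  rwa [sum_vecCons, sum_vecCons] at this

theorem theta_vv_mem {ω : Alt k a b (b + 2)} {d : ℤ} (hω : EB C.lam d ω) (y : Fin b → Gx a b) :
    theta C.ε ω (vv C.ε ∘ y) ∈
      degLE C.lam (d + (C.wE + (C.wE + (b * C.wF + (∑ j, gw (y j)) * (C.wE - C.wF))))) := by
  have := C.theta_mem hω (vv C.ε ∘ y) _ (fun j => C.vv_mem (y j))
  rwa [Finset.sum_add_distrib, ← Finset.sum_mul, Finset.sum_const, Finset.card_univ,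
    Fintype.card_fin, nsmul_eq_mul] at this

end Chart

theorem cf_eq_zero_of_degLE {lam : ℤ × ℤ →+ ℤ} {d : ℤ} {f : Lau k} (hf : f ∈ degLE lam d)
    {s : ℤ × ℤ} (hs : d < lam s) : cf s f = 0 := hf s hs

theorem map_vecCons_add {n : ℕ} (χ : Alt k a b (n + 1)) (u u' : VM k a b) (v : Fin n → VM k a b) :
    χ (vecCons (u + u') v) = χ (vecCons u v) + χ (vecCons u' v) := by
  exact congrArg (fun ψ => ψ v) (χ.curryLeft.map_add u u')

theorem map_vecCons_vecCons_add {n : ℕ} (χ : Alt k a b (n + 2)) (u t w : VM k a b)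
    (v : Fin n → VM k a b) :
    χ (vecCons w (vecCons (u + t) v)) =
      χ (vecCons w (vecCons u v)) + χ (vecCons w (vecCons t v)) :=
  map_vecCons_add (χ.curryLeft w) u t v

/-- The contractions with the extreme vectors at `z = 0` and `z = ∞` have the same coefficients
in intermediate `x`-degrees. -/
theorem cf_theta_eq {ω : Alt k a b (b + 2)} (hω : InZ ω) (u : Fin b → VM k a b)
    (hev : ∀ j, evm k a b (u j) = 0) (du : Fin b → ℤ)
    (hu : ∀ j, u j ∈ filt k (-xd) (eb k a b) 0 0)
    (hu' : ∀ j, u j ∈ filt k xd (eb k a b) 0 (du j)) {c : ℤ} (d : ℤ) (hc : ∑ j, du j < c)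
    (hca : c < a) : cf (c, d) (theta (ei k a b) ω u) = cf (c, d) (theta (ez k a b) ω u) := by
  let Z := chartZ k a b
  let I := chartI k a b
  have key : ∀ m, ∃ κ : VM k a b, ei k a b m = ez k a b m + κ ∧ evm k a b κ = 0 ∧
      κ ∈ filt k (-xd) (eb k a b) 0 0 ∧ κ ∈ filt k xd (eb k a b) 0 0 := by
    intro m
    refine ⟨ei k a b m - ez k a b m, by abel, ?_, ?_, ?_⟩
    · rw [map_sub]
      exact sub_eq_zero.mpr ((I.ev_ε m).trans (Z.ev_ε m).symm)
    · exact AddSubgroup.sub_mem _ (I.c_mem_neg_x (Sum.inl m)) (Z.c_mem_neg_x (Sum.inl m))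
    · exact AddSubgroup.sub_mem _ (I.c_mem_x (Sum.inl m)) (Z.c_mem_x (Sum.inl m))
  obtain ⟨κ₀, h₀, hev₀, hn₀, hx₀⟩ := key 0
  obtain ⟨κ₁, h₁, hev₁, hn₁, hx₁⟩ := key (Fin.last a)
  have e0 : evm k a b (ez k a b 0) = 1 := (Z.ev_ε 0).trans (by simp [mon_zero_zero])
  have ea : evm k a b (ez k a b (Fin.last a)) = mon ((a : ℤ), 0) := (Z.ev_ε (Fin.last a)).trans (by simp)
  have hker : ∀ κ : VM k a b, evm k a b κ = 0 → ∀ j, evm k a b (vecCons κ u j) = 0 := by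
    intro κ hκ j
    refine Fin.cases ?_ (fun j => ?_) j
    · simpa using hκ
    · simpa using hev j
  have hrel : ∀ κ : VM k a b, evm k a b κ = 0 →
      ω (vecCons (ez k a b (Fin.last a)) (vecCons κ u)) =
        mon ((a : ℤ), 0) * ω (vecCons (ez k a b 0) (vecCons κ u)) := by
    intro κ hκ
    have := map_vecCons_vecCons_of_closed (evm k a b) ω hω.closed (ez k a b 0)
      (ez k a b (Fin.last a)) (vecCons κ u) (hker κ hκ)
    rwa [e0, ea, one_mul] at this
  have t4 : ω (vecCons κ₀ (vecCons κ₁ u)) = 0 := by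
    refine map_eq_zero_of_closed (evm k a b) ω hω.closed _ e0 _ fun j => ?_
    refine Fin.cases ?_ (fun j => ?_) j
    · simpa using hev₀
    · simpa using hker κ₁ hev₁ j
  have t3 : cf (c, d) (ω (vecCons κ₀ (vecCons (ez k a b (Fin.last a)) u))) = 0 := by
    rw [map_vecCons_swap, hrel κ₀ hev₀, map_neg, cf_mon_mul, neg_eq_zero]
    have hm := hω.neg_x.map_mem _ _ (vecCons_mem_filt (Z.c_mem_neg_x (Sum.inl 0))
      (vecCons_mem_filt hn₀ hu))
    refine cf_eq_zero_of_degLE hm ?_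
    rw [sum_vecCons, sum_vecCons]
    simpa using hca
  have t2 : cf (c, d) (ω (vecCons (ez k a b 0) (vecCons κ₁ u))) = 0 := by
    have hm := hω.x.map_mem _ _ (vecCons_mem_filt (Z.c_mem_x (Sum.inl (Fin.last a)))
      (vecCons_mem_filt hx₁ hu'))
    have := cf_eq_zero_of_degLE hm (s := (c + a, d)) (by
      rw [sum_vecCons, sum_vecCons]
      simp
      omega)
    have h2 := hrel κ₁ hev₁
    rw [show cvec Z.ε (Sum.inl (Fin.last a)) = ez k a b (Fin.last a) from rfl, h2,
      cf_mon_mul] at this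
    simpa using this
  rw [theta_apply, theta_apply, h₀, h₁, map_vecCons_add, map_vecCons_vecCons_add,
    map_vecCons_vecCons_add, t4]
  simp [t2, t3]

/-- The coefficients of the obstruction to splitting a cocycle. -/
def Tc (ω : Alt k a b (b + 2)) (c : ℤ) (s : Fin b → Fin (a + 1) × Fin b) : k :=
  cf (c, 0) (theta (ez k a b) ω (fv k a b ∘ s))

theorem cf_theta_vv_eq {ω : Alt k a b (b + 2)} (hω : InZ ω) (y : Fin b → Gx a b) {c : ℤ} (d : ℤ)
    (hc : ∑ j, gw (y j) < c) (hca : c < a) :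
    cf (c, d) (theta (ei k a b) ω (vv (ei k a b) ∘ y)) =
      cf (c, d) (theta (ez k a b) ω (vv (ei k a b) ∘ y)) :=
  cf_theta_eq hω _ (fun j => (chartI k a b).ev_vv (y j)) (fun j => gw (y j))
    (fun j => (chartI k a b).vv_mem_neg_x (y j)) (fun j => (chartI k a b).vv_mem_x (y j)) d hc hca

theorem cf_theta_ei_eq_zero {ω : Alt k a b (b + 2)} (hω : InZ ω) (y : Fin b → Gx a b) (c : ℤ)
    {d : ℤ} (hd : -((∑ j, gw (y j)) * (b + 1)) < d) :
    cf (c, d) (theta (ei k a b) ω (vv (ei k a b) ∘ y)) = 0 := by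
  refine cf_eq_zero_of_degLE ((chartI k a b).theta_vv_mem hω.z y) ?_
  simp only [chartI, AddMonoidHom.coe_snd]
  linarith

theorem cf_theta_ez_eq_zero {ω : Alt k a b (b + 2)} (hω : InZ ω) (y : Fin b → Gx a b) (c : ℤ)
    {d : ℤ} (hd : d < 0) : cf (c, d) (theta (ez k a b) ω (vv (ez k a b) ∘ y)) = 0 := by
  refine cf_eq_zero_of_degLE ((chartZ k a b).theta_vv_mem hω.neg_z y) ?_
  simp [chartZ, hd]

theorem cf_theta_fv_eq_zero {ω : Alt k a b (b + 2)} (hω : InZ ω)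
    (s : Fin b → Fin (a + 1) × Fin b) {c d : ℤ} (hc : 0 < c) (hca : c < a) (hd : d ≠ 0) :
    cf (c, d) (theta (ez k a b) ω (fv k a b ∘ s)) = 0 := by
  have hs : ∑ j, gw (Sum.inr (s j) : Gx a b) = 0 := by simp [gw]
  rcases lt_or_gt_of_ne hd with h | h
  · exact cf_theta_ez_eq_zero hω (fun j => Sum.inr (s j)) c h
  · have h1 := cf_theta_vv_eq hω (fun j => Sum.inr (s j)) d (by rwa [hs]) hca
    rw [cf_theta_ei_eq_zero hω _ c (by rw [hs]; simpa using h)] at h1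
    exact h1.symm

theorem cf_update_gv_ei (χ : Alt k a b b) (u : Fin b → VM k a b) (j : Fin b) (l : Fin a) (c d : ℤ) :
    cf (c, d) (χ (Function.update u j (gv (ei k a b) l))) =
      cf (c, d) (χ (Function.update u j (gv (ez k a b) l))) +
      ∑ n : Fin b, (cf (c, d + 1 + n) (χ (Function.update u j (fv k a b (l.succ, n)))) -
        cf (c - 1, d + 1 + n) (χ (Function.update u j (fv k a b (l.castSucc, n))))) := by
  rw [gv_ei_eq, χ.map_update_add, map_add, χ.map_update_sum, map_sum]
  congr 1
  refine Finset.sum_congr rfl fun n _ => ?_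
  rw [χ.map_update_smul, χ.map_update_sub, χ.map_update_smul, smul_eq_mul, smul_eq_mul,
    cf_mon_mul, map_sub, cf_mon_mul]
  congr 2 <;> (congr 1; simp; ring)

theorem sum_gw_update (y : Fin b → Gx a b) (j : Fin b) (v : Gx a b) :
    ∑ i, gw (Function.update y j v i) = ∑ i, gw (y i) - gw (y j) + gw v := by
  have h : (fun i => gw (Function.update y j v i)) = Function.update (fun i => gw (y i)) j (gw v) := by
    funext i
    by_cases h : i = j
    · subst h; simp
    · simp [h]
  rw [h, Finset.sum_update_of_mem (Finset.mem_univ j)]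
  have := Finset.sum_sdiff (Finset.subset_univ {j}) (f := fun i => gw (y i))
  rw [Finset.sum_singleton] at this
  linarith

theorem vv_comp_update (ε : Fin (a + 1) → VM k a b) (y : Fin b → Gx a b) (j : Fin b) (v : Gx a b) :
    vv ε ∘ Function.update y j v = Function.update (vv ε ∘ y) j (vv ε v) := by
  rw [Function.comp_update]

theorem Tc_update_succ {ω : Alt k a b (b + 2)} (hω : InZ ω) {c : ℤ} (hc : 2 ≤ c) (hca : c < a)
    (s : Fin b → Fin (a + 1) × Fin b) (j : Fin b) (l : Fin a) (n : Fin b) :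
    Tc ω c (Function.update s j (l.succ, n)) =
      Tc ω (c - 1) (Function.update s j (l.castSucc, n)) := by
  have hf : ∀ (c d : ℤ) v, 0 < c → c < a → d ≠ 0 →
      cf (c, d) (theta (ez k a b) ω (Function.update (fv k a b ∘ s) j (fv k a b v))) = 0 := by
    intro c d v h1 h2 h3
    rw [← Function.comp_update]
    exact cf_theta_fv_eq_zero hω _ h1 h2 h3
  let y : Fin b → Gx a b := Function.update (fun i => Sum.inr (s i)) j (Sum.inl l)
  have hy : ∑ i, gw (y i) = 1 := by
    rw [sum_gw_update]
    simp [gw]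
  have hvv : ∀ ε, vv ε ∘ y = Function.update (fv k a b ∘ s) j (gv ε l) := fun ε =>
    vv_comp_update ε _ j _
  have h1 := cf_theta_vv_eq hω y (-1 - (n : ℤ)) (c := c) (by rw [hy]; omega) hca
  have hn := n.2
  rw [cf_theta_ei_eq_zero hω y c (by rw [hy]; omega), hvv, cf_update_gv_ei, ← hvv,
    cf_theta_ez_eq_zero hω y c (by omega), zero_add, Finset.sum_eq_single n] at h1
  · rw [show -1 - (n : ℤ) + 1 + n = 0 by ring, ← Function.comp_update, ← Function.comp_update] at h1
    exact sub_eq_zero.mp h1.symm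
  · intro n' _ hne
    have : (n' : ℤ) ≠ n := by
      intro h
      exact hne (Fin.ext (by omega))
    rw [hf _ _ _ (by omega) hca (by omega), hf _ _ _ (by omega) (by omega) (by omega), sub_zero]
  · simp

/-- If the obstruction coefficients vanish, then so do all coefficients of intermediate
`x`-degree of the contracted form. -/
theorem cf_theta_hybrid_eq_zero {ω : Alt k a b (b + 2)} (hω : InZ ω)
    (hT : ∀ (c : ℤ) s, 0 < c → c < a → Tc ω c s = 0) (r : ℕ) :
    ∀ y : Fin b → Gx a b, ∑ j, gw (y j) = r → ∀ (t : Finset (Fin b)) (c d : ℤ), r < c → c < a →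
      cf (c, d) (theta (ez k a b) ω
        (fun j => if j ∈ t then vv (ei k a b) (y j) else vv (ez k a b) (y j))) = 0 := by
  induction r with
  | zero =>
    intro y hy t c d hc hca
    have hf : ∀ j, ∃ s, y j = Sum.inr s := by
      intro j
      have h0 := (Finset.sum_eq_zero_iff_of_nonneg (fun j _ => gw_nonneg (y j))).mp
        (by simpa using hy) j (Finset.mem_univ j)
      rcases hj : y j with l | s
      · rw [hj] at h0
        simp [gw] at h0
      · exact ⟨s, rfl⟩
    choose s hs using hf
    have : (fun j => if j ∈ t then vv (ei k a b) (y j) else vv (ez k a b) (y j)) =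
        fv k a b ∘ s := by
      funext j
      simp [hs, vv]
    rw [this]
    by_cases hd : d = 0
    · subst hd
      exact hT c s (by simpa using hc) hca
    · exact cf_theta_fv_eq_zero hω s (by simpa using hc) hca hd
  | succ r ih =>
    intro y hy t c d hc hca
    push_cast at hc hy
    have hstep : ∀ t : Finset (Fin b), cf (c, d) (theta (ez k a b) ω
        (fun j => if j ∈ t then vv (ei k a b) (y j) else vv (ez k a b) (y j))) =
        cf (c, d) (theta (ez k a b) ω (vv (ez k a b) ∘ y)) := by
      intro t
      induction t using Finset.induction_on with
      | empty => rfl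
      | insert j t hj iht =>
        rw [← iht]
        set u : Fin b → VM k a b :=
          fun j => if j ∈ t then vv (ei k a b) (y j) else vv (ez k a b) (y j) with hu
        have h1 : (fun i => if i ∈ insert j t then vv (ei k a b) (y i) else vv (ez k a b) (y i)) =
            Function.update u j (vv (ei k a b) (y j)) := by
          funext i
          by_cases h : i = j
          · subst h; simp
          · simp [h, hu]
        have h2 : u = Function.update u j (vv (ez k a b) (y j)) := by
          funext i
          by_cases h : i = j
          · subst h; simp [hu, hj]
          · simp [h]
        have h3 : ∀ s, Function.update u j (fv k a b s) = fun i => if i ∈ t then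
            vv (ei k a b) (Function.update y j (Sum.inr s) i) else
            vv (ez k a b) (Function.update y j (Sum.inr s) i) := by
          intro s
          funext i
          by_cases h : i = j
          · subst h; simp [hj, vv]
          · simp [h, hu]
        rw [h1]
        conv_rhs => rw [h2]
        rcases hyj : y j with l | s
        · change cf (c, d) (theta (ez k a b) ω (Function.update u j (gv (ei k a b) l))) =
            cf (c, d) (theta (ez k a b) ω (Function.update u j (gv (ez k a b) l)))
          rw [cf_update_gv_ei]
          have hsum : ∀ s, ∑ i, gw (Function.update y j (Sum.inr s) i) = (r : ℤ) := by
            intro s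
            rw [sum_gw_update, hy, hyj]
            simp [gw]
          rw [Finset.sum_eq_zero, add_zero]
          intro n _
          rw [h3, h3, ih _ (hsum _) t _ _ (by omega) hca, ih _ (hsum _) t _ _ (by omega) (by omega),
            sub_zero]
        · rfl
    rw [hstep]
    by_cases hd : d < 0
    · exact cf_theta_ez_eq_zero hω y c hd
    · have h1 := hstep Finset.univ
      have h2 := cf_theta_vv_eq hω y d (c := c) (by rw [hy]; omega) hca
      rw [cf_theta_ei_eq_zero hω y c (by rw [hy]; nlinarith)] at h2
      rw [← h1, h2]
      simp
      rfl

theorem cf_theta_ez_vv {ω : Alt k a b (b + 2)} (hω : InZ ω)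
    (hT : ∀ (c : ℤ) s, 0 < c → c < a → Tc ω c s = 0) (y : Fin b → Gx a b) (c d : ℤ)
    (hc : ∑ j, gw (y j) < c) (hca : c < a) :
    cf (c, d) (theta (ez k a b) ω (vv (ez k a b) ∘ y)) = 0 := by
  obtain ⟨r, hr⟩ := Int.eq_ofNat_of_zero_le (Finset.sum_nonneg fun j _ => gw_nonneg (y j))
  exact cf_theta_hybrid_eq_zero hω hT r y hr ∅ c d (by omega) hca

theorem cf_theta_ei_vv {ω : Alt k a b (b + 2)} (hω : InZ ω)
    (hT : ∀ (c : ℤ) s, 0 < c → c < a → Tc ω c s = 0) (y : Fin b → Gx a b) (c d : ℤ)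
    (hc : ∑ j, gw (y j) < c) (hca : c < a) :
    cf (c, d) (theta (ei k a b) ω (vv (ei k a b) ∘ y)) = 0 := by
  obtain ⟨r, hr⟩ := Int.eq_ofNat_of_zero_le (Finset.sum_nonneg fun j _ => gw_nonneg (y j))
  rw [cf_theta_vv_eq hω y d hc hca]
  have := cf_theta_hybrid_eq_zero hω hT r y hr Finset.univ c d (by omega) hca
  simp only [Finset.mem_univ, if_true] at this
  exact this

end TAnalysis

section TCombinatorics

variable {k : Type*} [Field k] {a b : ℕ}

theorem sum_fst_update (s : Fin b → Fin (a + 1) × Fin b) (j : Fin b) (v : Fin (a + 1) × Fin b) :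
    ∑ i, ((Function.update s j v i).1 : ℤ) = ∑ i, ((s i).1 : ℤ) - ((s j).1 : ℤ) + (v.1 : ℤ) := by
  have h : (fun i => ((Function.update s j v i).1 : ℤ)) =
      Function.update (fun i => ((s i).1 : ℤ)) j (v.1 : ℤ) := by
    funext i
    by_cases h : i = j
    · subst h; simp
    · simp [h]
  rw [h, Finset.sum_update_of_mem (Finset.mem_univ j)]
  have := Finset.sum_sdiff (Finset.subset_univ {j}) (f := fun i => ((s i).1 : ℤ))
  rw [Finset.sum_singleton] at this
  linarith

theorem Tc_update_add_one {ω : Alt k a b (b + 2)} (hω : InZ ω) {c : ℤ} (hc : 1 ≤ c)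
    (hca : c + 1 < a) (s : Fin b → Fin (a + 1) × Fin b) (j : Fin b) (m : Fin (a + 1))
    (hm : (m : ℕ) = (s j).1 + 1) : Tc ω (c + 1) (Function.update s j (m, (s j).2)) = Tc ω c s := by
  have hlt : ((s j).1 : ℕ) < a := by have := m.2; omega
  have h := Tc_update_succ hω (c := c + 1) (by omega) hca s j ⟨(s j).1, hlt⟩ (s j).2
  rw [add_sub_cancel_right] at h
  have e1 : (⟨(s j).1, hlt⟩ : Fin a).succ = m := Fin.ext (by simp [hm])
  have e2 : ((⟨(s j).1, hlt⟩ : Fin a).castSucc, (s j).2) = s j := rfl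
  rwa [e1, e2, Function.update_eq_self] at h

theorem Tc_update_sub_one {ω : Alt k a b (b + 2)} (hω : InZ ω) {c : ℤ} (hc : 2 ≤ c)
    (hca : c < a) (s : Fin b → Fin (a + 1) × Fin b) (j : Fin b) (m : Fin (a + 1))
    (hm : ((s j).1 : ℕ) = m + 1) : Tc ω (c - 1) (Function.update s j (m, (s j).2)) = Tc ω c s := by
  have := Tc_update_add_one hω (c := c - 1) (by omega) (by omega)
    (Function.update s j (m, (s j).2)) j (s j).1 (by simpa using hm)
  rw [sub_add_cancel] at this
  simpa using this.symm

theorem Tc_eq {ω : Alt k a b (b + 2)} (hω : InZ ω) (ha : 3 ≤ a) (D : ℕ) :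
    ∀ (c c' : ℤ) (s s' : Fin b → Fin (a + 1) × Fin b), 0 < c → c < a → 0 < c' → c' < a →
      (∀ i, (s i).2 = (s' i).2) →
      c - ∑ i, ((s i).1 : ℤ) = c' - ∑ i, ((s' i).1 : ℤ) →
      ∑ i, (((s i).1 : ℤ) - ((s' i).1 : ℤ)).natAbs = D → Tc ω c s = Tc ω c' s' := by
  induction D using Nat.strong_induction_on with
  | _ D ih =>
  have main : ∀ (c c' : ℤ) (s s' : Fin b → Fin (a + 1) × Fin b), 0 < c → c < a → 0 < c' → c' < a →
      (∀ i, (s i).2 = (s' i).2) →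
      c - ∑ i, ((s i).1 : ℤ) = c' - ∑ i, ((s' i).1 : ℤ) →
      ∑ i, (((s i).1 : ℤ) - ((s' i).1 : ℤ)).natAbs = D →
      (∃ j, ((s' j).1 : ℕ) < (s j).1) → Tc ω c s = Tc ω c' s' := by
    intro c c' s s' hc hca hc' hca' hn hsum hD hj
    have left : ∀ (j : Fin b) (m : Fin (a + 1)), (((m : ℕ) : ℤ) - ((s' j).1 : ℤ)).natAbs <
        (((s j).1 : ℤ) - ((s' j).1 : ℤ)).natAbs →
        ∑ i, (((Function.update s j (m, (s j).2) i).1 : ℤ) - ((s' i).1 : ℤ)).natAbs < D := by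
      intro j m h
      rw [← hD]
      refine Finset.sum_lt_sum (fun i _ => ?_) ⟨j, Finset.mem_univ j, by simpa using h⟩
      by_cases hij : i = j
      · subst hij; simpa using h.le
      · simp [hij]
    have right : ∀ (j : Fin b) (m : Fin (a + 1)), (((s j).1 : ℤ) - ((m : ℕ) : ℤ)).natAbs <
        (((s j).1 : ℤ) - ((s' j).1 : ℤ)).natAbs →
        ∑ i, (((s i).1 : ℤ) - ((Function.update s' j (m, (s' j).2) i).1 : ℤ)).natAbs < D := by
      intro j m h
      rw [← hD]
      refine Finset.sum_lt_sum (fun i _ => ?_) ⟨j, Finset.mem_univ j, by simpa using h⟩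
      by_cases hij : i = j
      · subst hij; simpa using h.le
      · simp [hij]
    have nl : ∀ (j : Fin b) (m : Fin (a + 1)) i,
        (Function.update s j (m, (s j).2) i).2 = (s' i).2 := by
      intro j m i
      by_cases hij : i = j
      · subst hij; simpa using hn i
      · simpa [hij] using hn i
    have nr : ∀ (j : Fin b) (m : Fin (a + 1)) i,
        (s i).2 = (Function.update s' j (m, (s' j).2) i).2 := by
      intro j m i
      by_cases hij : i = j
      · subst hij; simpa using hn i
      · simpa [hij] using hn i
    obtain ⟨j, hj⟩ := hj
    have b1 := (s j).1.2
    by_cases h1 : 2 ≤ c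
    · let m : Fin (a + 1) := ⟨(s j).1 - 1, by omega⟩
      have hm : ((s j).1 : ℕ) = m + 1 := by simp only [m]; omega
      rw [← Tc_update_sub_one hω h1 hca s j m hm]
      refine ih _ (left j m (by omega)) _ _ _ _ (by omega) (by omega) hc' hca' (nl j m) ?_ rfl
      rw [sum_fst_update]
      simp only []
      omega
    by_cases h2 : c' + 1 < a
    · let m : Fin (a + 1) := ⟨(s' j).1 + 1, by omega⟩
      have hm : (m : ℕ) = (s' j).1 + 1 := rfl
      rw [← Tc_update_add_one hω (by omega) h2 s' j m hm]
      refine ih _ (right j m (by omega)) _ _ _ _ hc hca (by omega) h2 (nr j m) ?_ rfl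
      rw [sum_fst_update]
      simp only []
      omega
    obtain ⟨i, -, hi⟩ := Finset.exists_lt_of_sum_lt
      (show ∑ i, ((s i).1 : ℤ) < ∑ i, ((s' i).1 : ℤ) by omega)
    have b2 := (s' i).1.2
    let m : Fin (a + 1) := ⟨(s i).1 + 1, by omega⟩
    have hm : (m : ℕ) = (s i).1 + 1 := rfl
    rw [← Tc_update_add_one hω (by omega) (by omega) s i m hm]
    refine ih _ (left i m (by omega)) _ _ _ _ (by omega) (by omega) hc' hca' (nl i m) ?_ rfl
    rw [sum_fst_update]
    simp only []
    omega
  intro c c' s s' hc hca hc' hca' hn hsum hD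
  by_cases h : ∃ j, ((s' j).1 : ℕ) < (s j).1
  · exact main c c' s s' hc hca hc' hca' hn hsum hD h
  by_cases h' : ∃ j, ((s j).1 : ℕ) < (s' j).1
  · refine (main c' c s' s hc' hca' hc hca (fun i => (hn i).symm) hsum.symm ?_ h').symm
    rw [← hD]
    exact Finset.sum_congr rfl fun i _ => by omega
  push Not at h h'
  have hs : s = s' := funext fun i => Prod.ext (Fin.ext (le_antisymm (h i) (h' i))) (hn i)
  subst hs
  rw [show c = c' by linarith]

theorem Tc_eq_zero_of_not_injective {ω : Alt k a b (b + 2)} (hω : InZ ω) (ha : 3 ≤ a) {c : ℤ}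
    (hc : 0 < c) (hca : c < a) (s : Fin b → Fin (a + 1) × Fin b) {j₁ j₂ : Fin b} (hne : j₁ ≠ j₂)
    (h : (s j₁).2 = (s j₂).2) : Tc ω c s = 0 := by
  have b1 := (s j₁).1.2
  have b2 := (s j₂).1.2
  have key : ∀ (c' : ℤ) (m : Fin (a + 1)), 0 < c' → c' < a →
      c' - 2 * (m : ℤ) = c - (((s j₁).1 : ℤ) + ((s j₂).1 : ℤ)) → Tc ω c s = 0 := by
    intro c' m h1 h2 h3
    let s' := Function.update (Function.update s j₁ (m, (s j₁).2)) j₂ (m, (s j₂).2)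
    have hs : Tc ω c s = Tc ω c' s' := by
      refine Tc_eq hω ha _ c c' s s' hc hca h1 h2 (fun i => ?_) ?_ rfl
      · simp only [s']
        by_cases hi2 : i = j₂
        · subst hi2; simp
        by_cases hi1 : i = j₁
        · subst hi1; simp [hi2]
        simp [hi1, hi2]
      · simp only [s', sum_fst_update, Function.update_of_ne hne.symm]
        linarith
    rw [hs, Tc, AlternatingMap.map_eq_zero_of_eq _ _ (i := j₁) (j := j₂) ?_ hne, map_zero]
    simp [s', Function.update_of_ne hne, h]
  by_cases hev : (((s j₁).1 : ℕ) + ((s j₂).1 : ℕ)) % 2 = 0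
  · exact key c ⟨(((s j₁).1 : ℕ) + ((s j₂).1 : ℕ)) / 2, by omega⟩ hc hca (by simp only []; omega)
  by_cases h1 : 2 ≤ c
  · exact key (c - 1) ⟨(((s j₁).1 : ℕ) + ((s j₂).1 : ℕ)) / 2, by omega⟩ (by omega) (by omega)
      (by simp only []; omega)
  · exact key (c + 1) ⟨(((s j₁).1 : ℕ) + ((s j₂).1 : ℕ)) / 2 + 1, by omega⟩ (by omega) (by omega)
      (by simp only []; omega)

theorem Tc_eq_zero {ω : Alt k a b (b + 2)} (hω : InZ ω) (ha : 3 ≤ a)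
    (h : ∀ (c : ℤ) (m : Fin b → Fin (a + 1)), 0 < c → c < a → Tc ω c (fun i => (m i, i)) = 0)
    (c : ℤ) (s : Fin b → Fin (a + 1) × Fin b) (hc : 0 < c) (hca : c < a) : Tc ω c s = 0 := by
  by_cases hinj : Function.Injective fun i => (s i).2
  · let σ : Equiv.Perm (Fin b) := Equiv.ofBijective _ (Finite.injective_iff_bijective.mp hinj)
    have hs : fv k a b ∘ s = (fv k a b ∘ fun i => ((s (σ.symm i)).1, i)) ∘ σ := by
      funext i
      simp only [Function.comp_apply, Equiv.symm_apply_apply]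
      rfl
    have h0 := h c (fun i => (s (σ.symm i)).1) hc hca
    rw [Tc] at h0 ⊢
    rw [hs, AlternatingMap.map_perm]
    rcases Int.units_eq_one_or (Equiv.Perm.sign σ) with h1 | h1 <;> rw [h1] <;> simp [h0]
  · simp only [Function.Injective] at hinj
    push Not at hinj
    obtain ⟨j₁, j₂, h1, h2⟩ := hinj
    exact Tc_eq_zero_of_not_injective hω ha hc hca s h2 h1

theorem exists_sum_eq (t : ℕ) (ht : t ≤ a * b) :
    ∃ m : Fin b → Fin (a + 1), ∑ i, ((m i : ℕ) : ℤ) = t := by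
  induction t with
  | zero => exact ⟨fun _ => 0, by simp⟩
  | succ t ih =>
    obtain ⟨m, hm⟩ := ih (by omega)
    have : ∃ j, (m j : ℕ) < a := by
      by_contra hcon
      push Not at hcon
      have h1 : ∑ i : Fin b, (a : ℤ) ≤ ∑ i, ((m i : ℕ) : ℤ) :=
        Finset.sum_le_sum fun i _ => by exact_mod_cast hcon i
      rw [hm] at h1
      simp only [Finset.sum_const, Finset.card_univ, Fintype.card_fin, nsmul_eq_mul] at h1
      have h2 : b * a ≤ t := by exact_mod_cast h1
      rw [mul_comm] at h2
      omega
    obtain ⟨j, hj⟩ := this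
    have h := sum_fst_update (fun i => (m i, i)) j (⟨m j + 1, by omega⟩, j)
    refine ⟨fun i => (Function.update (fun i => (m i, i)) j (⟨m j + 1, by omega⟩, j) i).1, ?_⟩
    rw [h]
    simp only [hm]
    push_cast
    ring

variable (a b) in
theorem exists_index (ha : 3 ≤ a) (j : ℕ) (hj : j < a * b + a - 1) :
    ∃ (q : ℤ × (Fin b → Fin (a + 1))), 0 < q.1 ∧ q.1 < a ∧
      a - q.1 + ∑ i, ((q.2 i : ℕ) : ℤ) = j + 1 := by
  by_cases h : j + 1 < a
  · exact ⟨(a - (j + 1), fun _ => 0), by simp only []; omega, by simp only []; omega, by simp⟩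
  · obtain ⟨m, hm⟩ := exists_sum_eq (a := a) (b := b) (j + 2 - a) (by omega)
    refine ⟨(1, m), by simp, by simp; omega, ?_⟩
    simp only [hm]
    omega

variable (a b) in
/-- A choice of indices representing the obstruction coefficients. -/
def repIx (ha : 3 ≤ a) (j : Fin (a * b + a - 1)) : ℤ × (Fin b → Fin (a + 1)) :=
  (exists_index a b ha j j.2).choose

theorem repIx_spec (ha : 3 ≤ a) (j : Fin (a * b + a - 1)) :
    0 < (repIx a b ha j).1 ∧ (repIx a b ha j).1 < a ∧
      a - (repIx a b ha j).1 + ∑ i, (((repIx a b ha j).2 i : ℕ) : ℤ) = j + 1 :=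
  (exists_index a b ha j j.2).choose_spec

theorem Tc_eq_zero_of_repIx {ω : Alt k a b (b + 2)} (hω : InZ ω) (ha : 3 ≤ a)
    (h : ∀ j, Tc ω (repIx a b ha j).1 (fun i => ((repIx a b ha j).2 i, i)) = 0)
    (c : ℤ) (s : Fin b → Fin (a + 1) × Fin b) (hc : 0 < c) (hca : c < a) : Tc ω c s = 0 := by
  refine Tc_eq_zero hω ha (fun c m hc hca => ?_) c s hc hca
  have h0 : 0 ≤ ∑ i, ((m i : ℕ) : ℤ) := Finset.sum_nonneg fun i _ => by positivity
  have h1 : ∑ i, ((m i : ℕ) : ℤ) ≤ ∑ i : Fin b, (a : ℤ) :=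
    Finset.sum_le_sum fun i _ => by have := (m i).2; omega
  simp only [Finset.sum_const, Finset.card_univ, Fintype.card_fin, nsmul_eq_mul] at h1
  rw [mul_comm, ← Nat.cast_mul] at h1
  obtain ⟨t, ht⟩ := Int.eq_ofNat_of_zero_le h0
  have hlt : (a - c + t - 1).toNat < a * b + a - 1 := by omega
  obtain ⟨s1, s2, s3⟩ := repIx_spec ha ⟨_, hlt⟩
  rw [← h ⟨_, hlt⟩]
  refine Tc_eq hω ha _ _ _ _ _ hc hca s1 s2 (fun _ => rfl) ?_ rfl
  simp only [] at s3 ⊢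
  omega

end TCombinatorics
section Primitive

variable {k : Type*} [Field k] {a b : ℕ}

namespace Chart

variable (C : Chart k a b)

theorem bvec_mem (m : Fin (a + 1)) (s : Kx a b) :
    bvec C.ε (C.ε m) s ∈ filt k C.lam (eb k a b) 0 (bwt C.wE C.wE C.wF s) := by
  rcases s with u | l | s
  · exact C.ε_mem m
  · exact C.gv_mem l
  · exact C.c_mem (Sum.inr s)

theorem bvec_mem_x (m : Fin (a + 1)) (s : Kx a b) :
    bvec C.ε (C.ε m) s ∈ filt k xd (eb k a b) 0 (bwt 0 1 0 s) := by
  rcases s with u | l | s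
  · exact C.c_mem_x (Sum.inl m)
  · exact C.gv_mem_x l
  · exact C.c_mem_x (Sum.inr s)

theorem bvec_mem_neg_x (m : Fin (a + 1)) (s : Kx a b) :
    bvec C.ε (C.ε m) s ∈ filt k (-xd) (eb k a b) 0 0 := by
  rcases s with u | l | s
  · exact C.c_mem_neg_x (Sum.inl m)
  · exact C.gv_mem_neg_x l
  · exact C.c_mem_neg_x (Sum.inr s)

theorem ev_ε_zero : evm k a b (C.ε 0) = 1 :=
  (C.ev_ε 0).trans (by simp [mon_zero_zero])

/-- The part of the contracted form with exponents satisfying a condition. -/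
def thetaPart (ω : Alt k a b (b + 2)) (P : ℤ × ℤ → Prop) [DecidablePred P] : Alt k a b b :=
  truncForm C.bbasis (trunc P) ((mon (-(a : ℤ), 0) : Lau k) • theta C.ε ω)

theorem thetaPart_apply (ω : Alt k a b (b + 2)) (P : ℤ × ℤ → Prop) [DecidablePred P]
    (y : Fin b → Kx a b) : C.thetaPart ω P (bvec C.ε (C.ε 0) ∘ y) =
      trunc P ((mon (-(a : ℤ), 0) : Lau k) * theta C.ε ω (bvec C.ε (C.ε 0) ∘ y)) := by
  rw [thetaPart, ← C.coe_bbasis, truncForm_apply]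
  rfl

/-- The primitive of a cocycle defined by a chart. -/
def prim (ω : Alt k a b (b + 2)) : Alt k a b (b + 1) :=
  ω.curryLeft (C.ε 0) - wedgeEv (evm k a b) b (C.thetaPart ω fun s => 0 ≤ s.1)

variable {C} {ω : Alt k a b (b + 2)}

theorem wedgeEv_prim (hω : wedgeEv (evm k a b) (b + 2) ω = 0) :
    wedgeEv (evm k a b) (b + 1) (C.prim ω) = ω := by
  rw [prim, map_sub, wedgeEv_wedgeEv, sub_zero]
  ext v
  rw [wedgeEv_curryLeft_of_closed _ _ hω, C.ev_ε_zero, one_mul]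

theorem prim_eq (hω : wedgeEv (evm k a b) (b + 2) ω = 0) :
    C.prim ω = (mon (-(a : ℤ), 0) : Lau k) • ω.curryLeft (C.ε (Fin.last a)) +
      wedgeEv (evm k a b) b (C.thetaPart ω fun s => ¬ 0 ≤ s.1) := by
  rw [prim, sub_eq_iff_eq_add, add_assoc, ← map_add, add_comm (C.thetaPart ω fun s => ¬ 0 ≤ s.1),
    thetaPart, thetaPart, truncForm_add_truncForm_not, map_smul]
  ext v
  have h := wedgeEv_vecCons (evm k a b) (ω.curryLeft (C.ε 0)) (C.ε (Fin.last a)) v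
  rw [wedgeEv_curryLeft_of_closed _ _ hω, C.ev_ε_zero, one_mul, C.ev_ε] at h
  have h2 : wedgeEv (evm k a b) b (theta C.ε ω) v =
      mon ((a : ℤ), 0) * ω.curryLeft (C.ε 0) v - ω (vecCons (C.ε (Fin.last a)) v) := by
    rw [h]
    simp [theta]
  rw [AlternatingMap.add_apply, AlternatingMap.smul_apply, AlternatingMap.smul_apply, h2,
    smul_eq_mul, smul_eq_mul, mul_sub, ← mul_assoc, mon_mul_mon]
  simp [mon_zero_zero]

theorem removeNth_comp {n : ℕ} {S T : Type*} (w : S → T) (i : Fin (n + 1) → S) (j : Fin (n + 1)) :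
    j.removeNth (w ∘ i) = w ∘ (i ∘ j.succAbove) := rfl

theorem prim_neg_x (hω : EB (-xd) 0 ω) : EB (-xd) 0 (C.prim ω) := by
  intro i
  have := map_mem_degLE_of_filt (d := 0) (C.prim ω) (w := bvec C.ε (C.ε 0)) (wt := 0)
    (lam := -xd) ?_ (eb k a b ∘ i) (fun _ => 0) (fun j => C.eb_mem_bvec_neg_x (i j))
  · simpa using this
  intro i _
  have h1 := hω.map_mem _ _ (vecCons_mem_filt (C.c_mem_neg_x (Sum.inl 0))
    (fun j => C.bvec_mem_neg_x 0 (i j)))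
  rw [sum_vecCons] at h1
  simp only [Finset.sum_const_zero, add_zero, Pi.zero_apply] at h1 ⊢
  refine Submodule.sub_mem _ h1 (wedgeEv_mem_degLE _ _ _ 0 (fun _ => 0) (fun j => ?_) fun j => ?_)
  · rcases hj : i j with u | s
    · simp only [Function.comp_apply, hj]
      exact C.ev_ε_zero ▸ one_mem_degLE
    · simp only [Function.comp_apply, hj]
      rw [show evm k a b (bvec C.ε (C.ε 0) (Sum.inr s)) = 0 from C.ev_vv s]
      exact Submodule.zero_mem _
  · rw [removeNth_comp, thetaPart_apply]
    intro s hs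
    rw [cf_trunc, if_neg]
    simpa using hs

theorem prim_lam {d : ℤ} (hd : d + C.wE = 0) (hω : EB C.lam d ω) : EB C.lam 0 (C.prim ω) := by
  intro i
  have := map_mem_degLE_of_filt (d := 0) (C.prim ω) (w := bvec C.ε (C.ε 0))
    (wt := bwt C.wE C.wE C.wF) (lam := C.lam) ?_ (eb k a b ∘ i) (fun _ => 0)
    (fun j => C.eb_mem_bvec (i j))
  · simpa using this
  intro i _
  have h1 := hω.map_mem _ _ (vecCons_mem_filt (C.ε_mem 0) (fun j => C.bvec_mem 0 (i j)))
  rw [sum_vecCons, ← add_assoc, hd] at h1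
  refine Submodule.sub_mem _ h1 (wedgeEv_mem_degLE _ _ _ _
    (fun j => bwt C.wE C.wE C.wF (i j) - C.wE) (fun j => ?_) fun j => ?_)
  · rcases hj : i j with u | s
    · simp only [Function.comp_apply, hj]
      simp only [bwt, Sum.elim_inl, sub_self]
      exact C.ev_ε_zero ▸ one_mem_degLE
    · simp only [Function.comp_apply, hj]
      rw [show evm k a b (bvec C.ε (C.ε 0) (Sum.inr s)) = 0 from C.ev_vv s]
      exact Submodule.zero_mem _
  · rw [removeNth_comp, thetaPart_apply]
    refine trunc_mem_degLE _ ?_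
    have h2 := C.theta_mem hω (bvec C.ε (C.ε 0) ∘ (i ∘ j.succAbove)) _
      (fun l => C.bvec_mem 0 (i (j.succAbove l)))
    refine degLE_mono ?_ (mul_mem_degLE (mon_mem_degLE (C.lam_x (-(a : ℤ))).le) h2)
    rw [Fin.sum_univ_succAbove _ j]
    linarith

theorem prim_x (hc : wedgeEv (evm k a b) (b + 2) ω = 0) (hω : EB xd a ω)
    (hT : ∀ (y : Fin b → Gx a b) (c d : ℤ), ∑ j, gw (y j) < c → c < a →
      cf (c, d) (theta C.ε ω (vv C.ε ∘ y)) = 0) : EB xd 0 (C.prim ω) := by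
  intro i
  have := map_mem_degLE_of_filt (d := 0) (C.prim ω) (w := bvec C.ε (C.ε (Fin.last a)))
    (wt := bwt 0 1 0) (lam := xd) ?_ (eb k a b ∘ i) (fun _ => 0)
    (fun j => C.eb_mem_bvec_x (i j))
  · simpa using this
  intro i hi
  rw [prim_eq hc, AlternatingMap.add_apply]
  have h1 := hω.map_mem _ _ (vecCons_mem_filt (C.c_mem_x (Sum.inl (Fin.last a)))
    (fun j => C.bvec_mem_x (Fin.last a) (i j)))
  rw [sum_vecCons] at h1
  refine Submodule.add_mem _ ?_ ?_
  · have h2 := mul_mem_degLE (mon_mem_degLE (le_refl (xd (-(a : ℤ), 0)))) h1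
    refine degLE_mono (by simp) h2
  rw [wedgeEv_apply]
  refine Submodule.sum_mem _ fun j _ => neg_one_pow_mul_mem _ _ ?_
  rcases hj : i j with u | s
  · have hr : ∀ l, ∃ s, i (j.succAbove l) = Sum.inr s := by
      intro l
      rcases hl : i (j.succAbove l) with u' | s
      · exact absurd (hi (hl.trans hj.symm)) (Fin.succAbove_ne j l)
      · exact ⟨s, rfl⟩
    choose y hy using hr
    have e1 : j.removeNth (bvec C.ε (C.ε (Fin.last a)) ∘ i) =
        bvec C.ε (C.ε 0) ∘ (Sum.inr ∘ y) := by
      rw [removeNth_comp]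
      funext l
      simp only [Function.comp_apply, hy]
      rfl
    have e2 : bvec C.ε (C.ε 0) ∘ (Sum.inr ∘ y) = vv C.ε ∘ y := rfl
    have e3 : ∑ l, bwt 0 1 0 (i l) = ∑ l, gw (y l) := by
      rw [Fin.sum_univ_succAbove _ j]
      simp only [hj, hy]
      simp only [bwt, Sum.elim_inl, Sum.elim_inr, zero_add]
      rfl
    rw [e1, thetaPart_apply, e2, e3]
    simp only [Function.comp_apply, hj]
    rw [show evm k a b (bvec C.ε (C.ε (Fin.last a)) (Sum.inl u)) = mon ((a : ℤ), 0) from C.ev_ε _]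
    rintro ⟨c, d⟩ hs
    rw [cf_mon_mul, cf_trunc]
    split_ifs with h
    · rfl
    · rw [cf_mon_mul]
      simp only [AddMonoidHom.coe_fst, zero_add, Prod.mk_sub_mk, sub_zero, sub_neg_eq_add,
        sub_add_cancel] at hs h ⊢
      exact hT y c d hs (by omega)
  · simp only [Function.comp_apply, hj]
    rw [show evm k a b (bvec C.ε (C.ε (Fin.last a)) (Sum.inr s)) = 0 from C.ev_vv s, zero_mul]
    exact Submodule.zero_mem _

end Chart

end Primitive
section XFree

variable {k : Type*} [Field k] {a b : ℕ}

namespace EB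

variable {n : ℕ} {lam : ℤ × ℤ →+ ℤ} {d d' : ℤ} {χ χ' : Alt k a b n}

theorem add (h : EB lam d χ) (h' : EB lam d χ') : EB lam d (χ + χ') :=
  fun i => Submodule.add_mem _ (h i) (h' i)

theorem sub (h : EB lam d χ) (h' : EB lam d χ') : EB lam d (χ - χ') :=
  fun i => Submodule.sub_mem _ (h i) (h' i)

theorem neg (h : EB lam d χ) : EB lam d (-χ) := fun i => Submodule.neg_mem _ (h i)

theorem mono (hd : d ≤ d') (h : EB lam d χ) : EB lam d' χ := fun i => degLE_mono hd (h i)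

theorem truncForm (P : ℤ × ℤ → Prop) [DecidablePred P] (h : EB lam d χ) :
    EB lam d (truncForm (eb k a b) (trunc P) χ) := by
  intro i
  rw [truncForm_apply]
  exact trunc_mem_degLE _ (h i)

theorem wedgeEv (h : EB lam d χ) {e : ℤ}
    (he : ∀ s : Ix a b, lam (((s.1 : ℕ) : ℤ), ((s.2 : ℕ) : ℤ)) ≤ e) :
    EB lam (e + d) (wedgeEv (evm k a b) n χ) := by
  intro i
  refine wedgeEv_mem_degLE _ _ _ _ (fun _ => e) (fun j => ?_) fun j => ?_
  · rw [Function.comp_apply, evm_eb]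
    exact mon_mem_degLE (he _)
  · rw [add_sub_cancel_left]
    exact h _

end EB

theorem trunc_mem_degLE_of_imp {lam : ℤ × ℤ →+ ℤ} {d : ℤ} (P : ℤ × ℤ → Prop) [DecidablePred P]
    (h : ∀ s, P s → lam s ≤ d) (f : Lau k) : trunc P f ∈ degLE lam d := by
  intro s hs
  rw [cf_trunc, if_neg fun hP => absurd (h s hP) (by omega)]

theorem EB_truncForm_of_imp {n : ℕ} {lam : ℤ × ℤ →+ ℤ} {d : ℤ} (P : ℤ × ℤ → Prop)
    [DecidablePred P] (h : ∀ s, P s → lam s ≤ d) (χ : Alt k a b n) :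
    EB lam d (truncForm (eb k a b) (trunc P) χ) := by
  intro i
  rw [truncForm_apply]
  exact trunc_mem_degLE_of_imp P h _

/-- Forms whose values on standard tuples do not involve `x`. -/
structure XFree {n : ℕ} (χ : Alt k a b n) : Prop where
  x : EB xd 0 χ
  neg_x : EB (-xd) 0 χ

namespace XFree

variable {n : ℕ} {χ χ' : Alt k a b n}

theorem add (h : XFree χ) (h' : XFree χ') : XFree (χ + χ') := ⟨h.x.add h'.x, h.neg_x.add h'.neg_x⟩

theorem sub (h : XFree χ) (h' : XFree χ') : XFree (χ - χ') := ⟨h.x.sub h'.x, h.neg_x.sub h'.neg_x⟩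

theorem truncForm (P : ℤ × ℤ → Prop) [DecidablePred P] (h : XFree χ) :
    XFree (truncForm (eb k a b) (trunc P) χ) := ⟨h.x.truncForm P, h.neg_x.truncForm P⟩

theorem cf_eq_zero (h : XFree χ) {u : Fin n → VM k a b}
    (hx : ∀ j, u j ∈ filt k xd (eb k a b) 0 0) (hn : ∀ j, u j ∈ filt k (-xd) (eb k a b) 0 0)
    {c : ℤ} (hc : c ≠ 0) (d : ℤ) : cf (c, d) (χ u) = 0 := by
  have h1 := h.x.map_mem u (fun _ => 0) hx
  have h2 := h.neg_x.map_mem u (fun _ => 0) hn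
  simp only [Finset.sum_const_zero, add_zero] at h1 h2
  rcases lt_or_gt_of_ne hc with hlt | hgt
  · exact cf_eq_zero_of_degLE h2 (by simpa using hlt)
  · exact cf_eq_zero_of_degLE h1 (by simpa using hgt)

end XFree

/-- A closed form not involving `x` vanishes on tuples avoiding a power of `x`. -/
theorem map_eq_zero_of_avoids {n : ℕ} {ζ : Alt k a b (n + 1)} (hx : XFree ζ)
    (hζ : wedgeEv (evm k a b) (n + 1) ζ = 0) (m : Fin (a + 1)) {u : Fin (n + 1) → VM k a b}
    (hux : ∀ j, u j ∈ filt k xd (eb k a b) 0 0) (hun : ∀ j, u j ∈ filt k (-xd) (eb k a b) 0 0)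
    (hu : ∀ j, evm k a b (u j) = 0 ∨ ∃ m' : Fin (a + 1), m' ≠ m ∧
      evm k a b (u j) = mon (((m' : ℕ) : ℤ), 0)) : ζ u = 0 := by
  let Z := chartZ k a b
  refine lau_ext fun ⟨c, d⟩ => ?_
  rw [map_zero]
  by_cases hc : c = 0
  swap
  · exact hx.cf_eq_zero hux hun hc d
  subst hc
  have h := wedgeEv_curryLeft_of_closed _ ζ hζ (Z.ε m) u
  rw [Z.ev_ε, wedgeEv_apply] at h
  have h2 := congrArg (cf (((m : ℕ) : ℤ), d)) h
  rw [cf_mon_mul, map_sum] at h2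
  simp only [Prod.mk_sub_mk, sub_self, sub_zero] at h2
  rw [← h2]
  refine Finset.sum_eq_zero fun j _ => ?_
  have h3 : cf (((m : ℕ) : ℤ), d) (evm k a b (u j) * (ζ.curryLeft (Z.ε m)) (j.removeNth u)) = 0 := by
    rcases hu j with h0 | ⟨m', hm, h0⟩
    · rw [h0, zero_mul, map_zero]
    · rw [h0, cf_mon_mul]
      simp only [Prod.mk_sub_mk, sub_zero]
      refine hx.cf_eq_zero (u := vecCons (Z.ε m) (j.removeNth u)) (fun l => ?_) (fun l => ?_) ?_ _
      · refine Fin.cases ?_ (fun l => ?_) l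
        · exact Z.c_mem_x (Sum.inl m)
        · exact hux _
      · refine Fin.cases ?_ (fun l => ?_) l
        · exact Z.c_mem_neg_x (Sum.inl m)
        · exact hun _
      · intro h
        exact hm (Fin.ext (by omega))
  rcases neg_one_pow_eq_or (Lau k) (j : ℕ) with h | h
  · rw [h, one_mul, h3]
  · rw [h, neg_one_mul, map_neg, h3, neg_zero]

namespace Chart

variable (C : Chart k a b)

theorem ev_cvec (m : Fin (a + 1)) (j : Jx a b) (hj : j ≠ Sum.inl m) :
    evm k a b (cvec C.ε j) = 0 ∨ ∃ m' : Fin (a + 1), m' ≠ m ∧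
      evm k a b (cvec C.ε j) = mon (((m' : ℕ) : ℤ), 0) := by
  rcases j with m' | s
  · exact Or.inr ⟨m', fun h => hj (by rw [h]), C.ev_ε m'⟩
  · exact Or.inl (evm_fv k a b s)

theorem map_cvec_eq_zero {n : ℕ} {ζ : Alt k a b (n + 1)} (hx : XFree ζ)
    (hζ : wedgeEv (evm k a b) (n + 1) ζ = 0) (m : Fin (a + 1)) (i : Fin (n + 1) → Jx a b)
    (hi : ∀ j, i j ≠ Sum.inl m) : ζ (cvec C.ε ∘ i) = 0 :=
  map_eq_zero_of_avoids hx hζ m (fun j => C.c_mem_x (i j)) (fun j => C.c_mem_neg_x (i j))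
    (fun j => C.ev_cvec m (i j) (hi j))

end Chart

/-- A closed form not involving `x` takes the same values on the vectors of both charts. -/
theorem map_cvec_ei_eq {n : ℕ} {ζ : Alt k a b (n + 1)} (hx : XFree ζ)
    (hζ : wedgeEv (evm k a b) (n + 1) ζ = 0) (i : Fin (n + 1) → Jx a b)
    (hi : Function.Injective i) : ζ (cvec (ei k a b) ∘ i) = ζ (cvec (ez k a b) ∘ i) := by
  let Z := chartZ k a b
  let I := chartI k a b
  have hstep : ∀ t : Finset (Fin (n + 1)),
      ζ (fun j => if j ∈ t then cvec (ei k a b) (i j) else cvec (ez k a b) (i j)) =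
        ζ (cvec (ez k a b) ∘ i) := by
    intro t
    induction t using Finset.induction_on with
    | empty => rfl
    | insert j t hj iht =>
      rw [← iht]
      set u : Fin (n + 1) → VM k a b :=
        fun j => if j ∈ t then cvec (ei k a b) (i j) else cvec (ez k a b) (i j) with hu
      have h1 : (fun l => if l ∈ insert j t then cvec (ei k a b) (i l) else
          cvec (ez k a b) (i l)) = Function.update u j (cvec (ei k a b) (i j)) := by
        funext l
        by_cases h : l = j
        · subst h; simp
        · simp [h, hu]
      have h2 : u = Function.update u j (cvec (ez k a b) (i j)) := by
        funext l
        by_cases h : l = j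
        · subst h; simp [hu, hj]
        · simp [h]
      rw [h1]
      conv_rhs => rw [h2]
      rw [← sub_eq_zero, ← ζ.map_update_sub]
      rcases hij : i j with m | s
      · refine map_eq_zero_of_avoids hx hζ m (fun l => ?_) (fun l => ?_) (fun l => ?_)
        · by_cases h : l = j
          · subst h
            rw [Function.update_self]
            exact AddSubgroup.sub_mem _ (I.c_mem_x (Sum.inl m)) (Z.c_mem_x (Sum.inl m))
          · rw [Function.update_of_ne h, hu]
            dsimp only
            split_ifs
            · exact I.c_mem_x _
            · exact Z.c_mem_x _
        · by_cases h : l = j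
          · subst h
            rw [Function.update_self]
            exact AddSubgroup.sub_mem _ (I.c_mem_neg_x (Sum.inl m)) (Z.c_mem_neg_x (Sum.inl m))
          · rw [Function.update_of_ne h, hu]
            dsimp only
            split_ifs
            · exact I.c_mem_neg_x _
            · exact Z.c_mem_neg_x _
        · by_cases h : l = j
          · subst h
            rw [Function.update_self, map_sub]
            exact Or.inl (sub_eq_zero.mpr ((I.ev_ε m).trans (Z.ev_ε m).symm))
          · rw [Function.update_of_ne h, hu]
            have hne : i l ≠ Sum.inl m := fun h' => h (hi (h'.trans hij.symm))
            dsimp only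
            split_ifs
            · exact I.ev_cvec m (i l) hne
            · exact Z.ev_cvec m (i l) hne
      · exact ζ.map_coord_zero j (by rw [Function.update_self]; exact sub_self _)
  have h := hstep Finset.univ
  simp only [Finset.mem_univ, if_true] at h
  exact h

/-- Forms vanishing on the tuples of vectors of the chart at zero that miss some `ε`. -/
def Van {n : ℕ} (χ : Alt k a b n) : Prop :=
  ∀ i : Fin n → Jx a b, (∃ m, ∀ j, i j ≠ Sum.inl m) → χ (cvec (ez k a b) ∘ i) = 0

theorem Van.closed {n : ℕ} {χ : Alt k a b n} (h : Van χ) : wedgeEv (evm k a b) n χ = 0 := by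
  let Z := chartZ k a b
  refine Z.cbasis.ext_alternating fun i hi => ?_
  have e : (fun j => Z.cbasis (i j)) = cvec (ez k a b) ∘ i := by
    rw [Z.coe_cbasis]
    rfl
  rw [e, wedgeEv_apply, AlternatingMap.zero_apply]
  refine Finset.sum_eq_zero fun j _ => ?_
  rcases hij : i j with m | s
  · have : χ (j.removeNth (cvec (ez k a b) ∘ i)) = 0 :=
      h (i ∘ j.succAbove) ⟨m, fun l hl => Fin.succAbove_ne j l (hi (hl.trans hij.symm))⟩
    rw [this, mul_zero, mul_zero]
  · have : evm k a b ((cvec (ez k a b) ∘ i) j) = 0 := by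
      rw [Function.comp_apply, hij]
      exact evm_fv k a b s
    rw [this, zero_mul, mul_zero]

theorem van_of_closed {n : ℕ} {ζ : Alt k a b (n + 1)} (hx : XFree ζ)
    (hζ : wedgeEv (evm k a b) (n + 1) ζ = 0) : Van ζ :=
  fun i ⟨m, hm⟩ => (chartZ k a b).map_cvec_eq_zero hx hζ m i hm

theorem EB_x_of_cvec {n : ℕ} {χ : Alt k a b n}
    (h : ∀ i, Function.Injective i → χ (cvec (ez k a b) ∘ i) ∈ degLE xd 0) : EB xd 0 χ := by
  intro i
  have := map_mem_degLE_of_filt (d := 0) χ (w := cvec (ez k a b)) (wt := 0) (lam := xd)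
    (fun i hi => by simpa using h i hi) (eb k a b ∘ i) (fun _ => 0)
    (fun j => (chartZ k a b).eb_mem_x (i j))
  simpa using this

theorem EB_neg_x_of_cvec {n : ℕ} {χ : Alt k a b n}
    (h : ∀ i, Function.Injective i → χ (cvec (ez k a b) ∘ i) ∈ degLE (-xd) 0) : EB (-xd) 0 χ := by
  intro i
  have := map_mem_degLE_of_filt (d := 0) χ (w := cvec (ez k a b)) (wt := 0) (lam := -xd)
    (fun i hi => by simpa using h i hi) (eb k a b ∘ i) (fun _ => 0)
    (fun j => (chartZ k a b).eb_mem_neg_x (i j))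
  simpa using this

theorem EB_neg_z_of_cvec {n : ℕ} {χ : Alt k a b n}
    (h : ∀ i, Function.Injective i → χ (cvec (ez k a b) ∘ i) ∈ degLE (-zd) 0) : EB (-zd) 0 χ := by
  intro i
  have := map_mem_degLE_of_filt (d := 0) χ (w := cvec (ez k a b)) (wt := cwt 0 0) (lam := -zd)
    (fun i hi => by
      rw [show ∑ j, cwt 0 0 (i j) = 0 from
        Finset.sum_eq_zero fun j _ => by rcases i j with m | s <;> rfl]
      exact h i hi) (eb k a b ∘ i) (fun _ => 0)
    (fun j => (chartZ k a b).eb_mem (i j))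
  simpa using this

theorem XFree.cvec_x {n : ℕ} {χ : Alt k a b n} (h : XFree χ) (i : Fin n → Jx a b) :
    χ (cvec (ez k a b) ∘ i) ∈ degLE xd 0 := by
  have := h.x.map_mem _ (fun _ => 0) (fun j => (chartZ k a b).c_mem_x (i j))
  rw [Finset.sum_const_zero, add_zero] at this
  exact this

theorem XFree.cvec_neg_x {n : ℕ} {χ : Alt k a b n} (h : XFree χ) (i : Fin n → Jx a b) :
    χ (cvec (ez k a b) ∘ i) ∈ degLE (-xd) 0 := by
  have := h.neg_x.map_mem _ (fun _ => 0) (fun j => (chartZ k a b).c_mem_neg_x (i j))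
  rw [Finset.sum_const_zero, add_zero] at this
  exact this

theorem EB.cvec_neg_z {n : ℕ} {χ : Alt k a b n} (h : EB (-zd) 0 χ) (i : Fin n → Jx a b) :
    χ (cvec (ez k a b) ∘ i) ∈ degLE (-zd) 0 := by
  have := h.map_mem _ _ (fun j => (chartZ k a b).c_mem (i j))
  rw [show ∑ j, cwt (chartZ k a b).wE (chartZ k a b).wF (i j) = 0 from
    Finset.sum_eq_zero fun j _ => by rcases i j with m | s <;> rfl] at this
  exact this

theorem sum_cwt (i : Fin (b + 1) → Jx a b) (hi : Function.Injective i)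
    (hm : ∀ m, ∃ j, i j = Sum.inl m) :
    ∑ j, cwt (-(b : ℤ)) 1 (i j) = -((a * b + a : ℕ) : ℤ) := by
  classical
  have h1 : ∀ s : Jx a b, cwt (-(b : ℤ)) 1 s =
      1 - ∑ m : Fin (a + 1), if s = Sum.inl m then ((b : ℤ) + 1) else 0 := by
    rintro (m | s)
    · simp [cwt]
    · simp [cwt]
  rw [Finset.sum_congr rfl fun j _ => h1 (i j), Finset.sum_sub_distrib, Finset.sum_comm]
  have h2 : ∀ m : Fin (a + 1), ∑ j, (if i j = Sum.inl m then ((b : ℤ) + 1) else 0) = b + 1 := by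
    intro m
    obtain ⟨j, hj⟩ := hm m
    rw [Finset.sum_eq_single j]
    · rw [if_pos hj]
    · intro l _ hl
      exact if_neg fun h => hl (hi (h.trans hj.symm))
    · simp
  rw [Finset.sum_congr rfl fun m _ => h2 m]
  simp only [Finset.sum_const, Finset.card_univ, Fintype.card_fin, nsmul_eq_mul]
  push_cast
  ring

/-- Values of a closed form, regular at infinity, on the tuples containing all the `ε`. -/
theorem map_cvec_mem_of_z {ζ : Alt k a b (b + 1)} (hx : XFree ζ)
    (hζ : wedgeEv (evm k a b) (b + 1) ζ = 0) (hz : EB zd 0 ζ) (i : Fin (b + 1) → Jx a b)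
    (hi : Function.Injective i) (hm : ∀ m, ∃ j, i j = Sum.inl m) :
    ζ (cvec (ez k a b) ∘ i) ∈ degLE zd (-((a * b + a : ℕ) : ℤ)) := by
  have := hz.map_mem _ _ (fun j => (chartI k a b).c_mem (i j))
  rw [zero_add] at this
  rw [← map_cvec_ei_eq hx hζ i hi, ← sum_cwt i hi hm]
  exact this

theorem EB_z_of_cvec {ζ : Alt k a b (b + 1)} (hx : XFree ζ) (hv : Van ζ)
    (h : ∀ i, ζ (cvec (ez k a b) ∘ i) ∈ degLE zd (-((a * b + a : ℕ) : ℤ))) : EB zd 0 ζ := by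
  intro i
  have := map_mem_degLE_of_filt (d := 0) ζ (w := cvec (ei k a b)) (wt := cwt (-(b : ℤ)) 1)
    (lam := zd) (fun i hi => by
      rw [zero_add, map_cvec_ei_eq hx hv.closed i hi]
      by_cases hm : ∀ m, ∃ j, i j = Sum.inl m
      · rw [sum_cwt i hi hm]
        exact h i
      · push Not at hm
        rw [hv i hm]
        exact Submodule.zero_mem _) (eb k a b ∘ i) (fun _ => 0)
    (fun j => (chartI k a b).eb_mem (i j))
  simpa using this

/-- Truncation of a form with respect to the vectors of the chart at zero. -/
def ctr {n : ℕ} (P : ℤ × ℤ → Prop) [DecidablePred P] (χ : Alt k a b n) : Alt k a b n :=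
  truncForm (chartZ k a b).cbasis (trunc P) χ

theorem ctr_apply {n : ℕ} (P : ℤ × ℤ → Prop) [DecidablePred P] (χ : Alt k a b n)
    (i : Fin n → Jx a b) :
    ctr P χ (cvec (ez k a b) ∘ i) = trunc P (χ (cvec (ez k a b) ∘ i)) := by
  have := truncForm_apply (chartZ k a b).cbasis (trunc P) χ i
  rw [(chartZ k a b).coe_cbasis] at this
  exact this

theorem Van.ctr {n : ℕ} {χ : Alt k a b n} (h : Van χ) (P : ℤ × ℤ → Prop) [DecidablePred P] :
    Van (ctr P χ) := fun i hi => by rw [ctr_apply, h i hi, map_zero]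

theorem XFree.ctr {n : ℕ} {χ : Alt k a b n} (h : XFree χ) (P : ℤ × ℤ → Prop) [DecidablePred P] :
    XFree (ctr P χ) where
  x := EB_x_of_cvec fun i _ => by rw [ctr_apply]; exact trunc_mem_degLE _ (h.cvec_x i)
  neg_x := EB_neg_x_of_cvec fun i _ => by rw [ctr_apply]; exact trunc_mem_degLE _ (h.cvec_neg_x i)

end XFree
section Classes

variable {k : Type*} [Field k] {a b : ℕ}

theorem InZ.sub {ω ω' : Alt k a b (b + 2)} (h : InZ ω) (h' : InZ ω') : InZ (ω - ω') where
  closed := by rw [map_sub, h.closed, h'.closed, sub_zero]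
  neg_x := h.neg_x.sub h'.neg_x
  x := h.x.sub h'.x
  neg_z := h.neg_z.sub h'.neg_z
  z := h.z.sub h'.z

theorem InZ.add {ω ω' : Alt k a b (b + 2)} (h : InZ ω) (h' : InZ ω') : InZ (ω + ω') where
  closed := by rw [map_add, h.closed, h'.closed, zero_add]
  neg_x := h.neg_x.add h'.neg_x
  x := h.x.add h'.x
  neg_z := h.neg_z.add h'.neg_z
  z := h.z.add h'.z

theorem Tc_add (ω ω' : Alt k a b (b + 2)) (c : ℤ) (s : Fin b → Fin (a + 1) × Fin b) :
    Tc (ω + ω') c s = Tc ω c s + Tc ω' c s := by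
  simp [Tc, theta_apply]

theorem Tc_sub (ω ω' : Alt k a b (b + 2)) (c : ℤ) (s : Fin b → Fin (a + 1) × Fin b) :
    Tc (ω - ω') c s = Tc ω c s - Tc ω' c s := by
  simp [Tc, theta_apply]

theorem Tc_wedgeEv {σ : Alt k a b (b + 1)} (hσ : EB (-xd) 0 σ) {c : ℤ} (hca : c < a)
    (s : Fin b → Fin (a + 1) × Fin b) : Tc (wedgeEv (evm k a b) (b + 1) σ) c s =
      cf (c, 0) (σ (vecCons (ez k a b (Fin.last a)) (fv k a b ∘ s))) := by
  let Z := chartZ k a b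
  have e0 : evm k a b (ez k a b 0) = 1 := Z.ev_ε_zero
  have ea : evm k a b (ez k a b (Fin.last a)) = mon ((a : ℤ), 0) := Z.ev_ε (Fin.last a)
  rw [Tc, theta_apply,
    wedgeEv_vecCons_vecCons_of_ker _ _ _ _ (fv k a b ∘ s) (fun j => evm_fv k a b (s j)), e0,
    ea, one_mul, map_sub, cf_mon_mul, sub_eq_self]
  have h := hσ.map_mem _ _ (vecCons_mem_filt (Z.c_mem_neg_x (Sum.inl 0))
    (fun j => Z.c_mem_neg_x (Sum.inr (s j))))
  rw [sum_vecCons] at h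
  exact cf_eq_zero_of_degLE h (by simpa using hca)

theorem cf_map_last_eq_zero {σ : Alt k a b (b + 1)} (hσ : EB xd 0 σ) {c : ℤ} (hc : 0 < c)
    (s : Fin b → Fin (a + 1) × Fin b) :
    cf (c, 0) (σ (vecCons (ez k a b (Fin.last a)) (fv k a b ∘ s))) = 0 := by
  let Z := chartZ k a b
  have h := hσ.map_mem _ _ (vecCons_mem_filt (Z.c_mem_x (Sum.inl (Fin.last a)))
    (fun j => Z.c_mem_x (Sum.inr (s j))))
  rw [sum_vecCons] at h
  exact cf_eq_zero_of_degLE h (by simpa using hc)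

theorem XFree.Tc_wedgeEv {σ : Alt k a b (b + 1)} (hσ : XFree σ) {c : ℤ} (hc : 0 < c) (hca : c < a)
    (s : Fin b → Fin (a + 1) × Fin b) : Tc (wedgeEv (evm k a b) (b + 1) σ) c s = 0 := by
  rw [SegreVeronese.Tc_wedgeEv hσ.neg_x hca, cf_map_last_eq_zero hσ.x hc]

variable (k a b) in
/-- Tuples of standard basis vectors are evaluated by forgetting the first index. -/
def dproj : VM k a b →ₗ[Lau k] (Fin (b + 1) → Lau k) :=
  (eb k a b).constr (Lau k) fun s => (mon (((s.1 : ℕ) : ℤ), 0) : Lau k) • Pi.single s.2 1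

theorem dproj_eb (s : Ix a b) : dproj k a b (eb k a b s) =
    (mon (((s.1 : ℕ) : ℤ), 0) : Lau k) • Pi.single s.2 1 := by
  simp [dproj]

variable (k a b) in
/-- The determinant of the images in the free module of rank `b + 1`. -/
def detForm : Alt k a b (b + 1) := Matrix.detRowAlternating.compLinearMap (dproj k a b)

theorem detForm_closed : wedgeEv (evm k a b) (b + 1) (detForm k a b) = 0 := by
  let ev' : (Fin (b + 1) → Lau k) →ₗ[Lau k] Lau k :=
    (Pi.basisFun (Lau k) (Fin (b + 1))).constr (Lau k) fun n => mon (0, ((n : ℕ) : ℤ))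
  have hev : ∀ v, evm k a b v = ev' (dproj k a b v) := by
    intro v
    have : evm k a b = ev' ∘ₗ dproj k a b := by
      refine (eb k a b).ext fun s => ?_
      have h1 : ev' (Pi.single s.2 1) = mon (0, ((s.2 : ℕ) : ℤ)) := by
        have := (Pi.basisFun (Lau k) (Fin (b + 1))).constr_basis (Lau k)
          (fun n => (mon (0, ((n : ℕ) : ℤ)) : Lau k)) s.2
        rwa [Pi.basisFun_apply] at this
      rw [LinearMap.comp_apply, dproj_eb, map_smul, h1, evm_eb, smul_eq_mul, mon_mul_mon]
      simp
    rw [this]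
    rfl
  have h0 : wedgeEv ev' (b + 1) Matrix.detRowAlternating = 0 := by
    refine (Pi.basisFun (Lau k) (Fin (b + 1))).ext_alternating fun i hi => ?_
    have := Fintype.card_le_of_injective i hi
    simp at this
  refine AlternatingMap.ext fun v => ?_
  have h1 := congrArg (fun χ => χ (dproj k a b ∘ v)) h0
  rw [AlternatingMap.zero_apply, wedgeEv_apply]
  refine Eq.trans ?_ h1
  simp only [wedgeEv_apply]
  refine Finset.sum_congr rfl fun j _ => ?_
  rw [hev]
  rfl

theorem detRowAlternating_single_mem {lam : ℤ × ℤ →+ ℤ} {n : ℕ} (i : Fin n → Fin n) :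
    Matrix.detRowAlternating (fun j => (Pi.single (i j) 1 : Fin n → Lau k)) ∈ degLE lam 0 := by
  by_cases hi : Function.Injective i
  · let σ : Equiv.Perm (Fin n) := Equiv.ofBijective i (Finite.injective_iff_bijective.mp hi)
    have h := (Matrix.detRowAlternating (R := Lau k)).map_perm (fun j => Pi.single j 1) σ
    have h1 : Matrix.detRowAlternating (fun j => (Pi.single j 1 : Fin n → Lau k)) = 1 := by
      rw [← Matrix.det_one (n := Fin n) (R := Lau k)]
      change Matrix.det _ = _
      congr 1
      ext j l
      simp [Matrix.one_apply, Pi.single_apply, eq_comm]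
    rw [h1] at h
    have h2 : (fun j => (Pi.single (i j) 1 : Fin n → Lau k)) = (fun j => Pi.single j 1) ∘ σ := rfl
    rw [h2, h]
    rcases Int.units_eq_one_or (Equiv.Perm.sign σ) with h3 | h3
    · simpa [h3] using one_mem_degLE
    · simpa [h3] using one_mem_degLE
  · rw [AlternatingMap.map_eq_zero_of_not_injective]
    · exact Submodule.zero_mem _
    · intro h
      exact hi fun j l hjl => h (by simp only [hjl])

theorem detForm_mem {lam : ℤ × ℤ →+ ℤ} (hlam : ∀ n : ℤ, lam (n, 0) = 0) :
    EB lam 0 (detForm k a b) := by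
  intro i
  have h1 : detForm k a b (eb k a b ∘ i) = Matrix.detRowAlternating fun j =>
      (mon ((((i j).1 : ℕ) : ℤ), 0) : Lau k) • (Pi.single (i j).2 1 : Fin (b + 1) → Lau k) := by
    rw [detForm, AlternatingMap.compLinearMap_apply]
    congr 1
    funext j
    exact dproj_eb (i j)
  have h2 := (Matrix.detRowAlternating (n := Fin (b + 1)) (R := Lau k)).map_smul_univ
    (fun j => mon ((((i j).1 : ℕ) : ℤ), 0)) (fun j => Pi.single (i j).2 1)
  rw [h1]
  refine (congrArg (· ∈ degLE lam 0) h2).mpr ?_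
  have h3 := prod_mem_degLE Finset.univ (fun _ => (0 : ℤ))
    (fun j => (mon ((((i j).1 : ℕ) : ℤ), 0) : Lau k)) (lam := lam)
    (fun j _ => mon_mem_degLE (hlam _).le)
  have h4 := mul_mem_degLE h3 (detRowAlternating_single_mem (k := k) (lam := lam)
    (fun j => (i j).2))
  simpa using h4

theorem detForm_triangular (m : Fin b → Fin (a + 1)) :
    detForm k a b (vecCons (ez k a b (Fin.last a)) (fv k a b ∘ fun i => (m i, i))) =
      mon (a + ∑ i, ((m i : ℕ) : ℤ), 0) := by
  have h0 : dproj k a b (ez k a b (Fin.last a)) = (mon ((a : ℤ), 0) : Lau k) • Pi.single 0 1 := by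
    rw [ez, dproj_eb]
    simp
  have h1 : ∀ i : Fin b, dproj k a b (fv k a b (m i, i)) = (mon (((m i : ℕ) : ℤ), 0) : Lau k) •
      (Pi.single i.succ 1 - (mon (0, 1) : Lau k) • Pi.single i.castSucc 1) := by
    intro i
    rw [fv, map_sub, map_smul, dproj_eb, dproj_eb, smul_sub, smul_comm]
  let A : Matrix (Fin (b + 1)) (Fin (b + 1)) (Lau k) := Matrix.of fun j =>
    dproj k a b (vecCons (ez k a b (Fin.last a)) (fv k a b ∘ fun i => (m i, i)) j)
  have hA0 : A 0 = (mon ((a : ℤ), 0) : Lau k) • Pi.single 0 1 := h0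
  have hA1 : ∀ i : Fin b, A i.succ = (mon (((m i : ℕ) : ℤ), 0) : Lau k) •
      (Pi.single i.succ 1 - (mon (0, 1) : Lau k) • Pi.single i.castSucc 1) := h1
  change A.det = _
  rw [Matrix.det_of_isLowerTriangular A, Fin.prod_univ_succ, hA0]
  · have h2 : ∀ i : Fin b, A i.succ i.succ = mon (((m i : ℕ) : ℤ), 0) := by
      intro i
      have : i.succ ≠ i.castSucc := (Fin.castSucc_lt_succ (i := i)).ne'
      rw [hA1]
      simp [this]
    rw [Finset.prod_congr rfl fun i _ => h2 i]
    have h3 : ∀ T : Finset (Fin b), ∏ i ∈ T, (mon (((m i : ℕ) : ℤ), 0) : Lau k) =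
        mon (∑ i ∈ T, ((m i : ℕ) : ℤ), 0) := by
      intro T
      induction T using Finset.induction_on with
      | empty => simp [mon_zero_zero]
      | insert j T hj ih =>
        rw [Finset.prod_insert hj, Finset.sum_insert hj, ih, mon_mul_mon]
        simp
    rw [h3]
    simp [mon_mul_mon]
  · intro j l hjl
    have hjl : j < l := hjl
    revert hjl
    refine Fin.cases (fun hjl => ?_) (fun i hjl => ?_) j
    · rw [hA0]
      simp [hjl.ne']
    · have h2 : i.castSucc < l := lt_trans Fin.castSucc_lt_succ hjl
      rw [hA1]
      simp [ne_of_gt hjl, ne_of_gt h2]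

/-- The coefficient of the determinantal forms. -/
def powSum (c : Fin (a * b + a - 1) → k) : Lau k := ∑ j, c j • mon (-((j : ℕ) : ℤ) - 1, 0)

variable (k a b) in
/-- The determinantal classes before truncation. -/
def zetaDet : (Fin (a * b + a - 1) → k) →ₗ[k] Alt k a b (b + 1) where
  toFun c := powSum c • detForm k a b
  map_add' c c' := by
    simp [powSum, add_smul, Finset.sum_add_distrib]
  map_smul' r c := by
    simp only [powSum, Pi.smul_apply, smul_eq_mul, mul_smul, ← Finset.smul_sum, RingHom.id_apply]
    refine AlternatingMap.ext fun v => ?_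
    exact smul_mul_assoc _ _ _

theorem zetaDet_closed (c : Fin (a * b + a - 1) → k) :
    wedgeEv (evm k a b) (b + 1) (zetaDet k a b c) = 0 := by
  change wedgeEv (evm k a b) (b + 1) (powSum c • detForm k a b) = 0
  rw [map_smul, detForm_closed, smul_zero]

theorem zetaDet_mem {lam : ℤ × ℤ →+ ℤ} (hlam : ∀ n : ℤ, lam (n, 0) = 0)
    (c : Fin (a * b + a - 1) → k) : EB lam 0 (zetaDet k a b c) := by
  intro i
  have h := mul_mem_degLE (f := powSum c) (lam := lam) (d := 0)
    (Submodule.sum_mem _ fun j _ => Submodule.smul_mem _ _ (mon_mem_degLE (hlam _).le))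
    (detForm_mem (k := k) hlam i)
  rwa [add_zero] at h

theorem wedgeEv_smul {n : ℕ} (r : k) (χ : Alt k a b n) :
    wedgeEv (evm k a b) n (r • χ) = r • wedgeEv (evm k a b) n χ := by
  refine AlternatingMap.ext fun v => ?_
  rw [AlternatingMap.smul_apply, wedgeEv_apply, wedgeEv_apply, Finset.smul_sum]
  refine Finset.sum_congr rfl fun i _ => ?_
  rw [AlternatingMap.smul_apply, mul_smul_comm, mul_smul_comm]

variable (k a b) in
/-- Truncation followed by the differential. -/
def wtr (P : ℤ × ℤ → Prop) [DecidablePred P] : Alt k a b (b + 1) →ₗ[k] Alt k a b (b + 2) where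
  toFun ζ := wedgeEv (evm k a b) (b + 1) (truncForm (eb k a b) (trunc P) ζ)
  map_add' ζ ζ' := by rw [truncForm_add, map_add]
  map_smul' r ζ := by rw [truncForm_smul, wedgeEv_smul, RingHom.id_apply]

theorem wtr_apply (P : ℤ × ℤ → Prop) [DecidablePred P] (ζ : Alt k a b (b + 1)) :
    wtr k a b P ζ = wedgeEv (evm k a b) (b + 1) (truncForm (eb k a b) (trunc P) ζ) := rfl

theorem wtr_eq_neg (P : ℤ × ℤ → Prop) [DecidablePred P] {ζ : Alt k a b (b + 1)}
    (hζ : wedgeEv (evm k a b) (b + 1) ζ = 0) :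
    wtr k a b P ζ = - wedgeEv (evm k a b) (b + 1) (truncForm (eb k a b) (trunc fun s => ¬ P s) ζ) := by
  rw [eq_neg_iff_add_eq_zero, wtr_apply, ← map_add, truncForm_add_truncForm_not, hζ]

theorem inZ_wtr_det (c : Fin (a * b + a - 1) → k) :
    InZ (wtr k a b (fun s => 0 ≤ s.1) (zetaDet k a b c)) where
  closed := wedgeEv_wedgeEv _ _
  neg_x := by
    refine (EB.wedgeEv (EB_truncForm_of_imp _ ?_ _) (e := 0) ?_).mono (d := 0 + 0) (by simp)
    · simp
    · simp
  x := by
    rw [wtr_eq_neg _ (zetaDet_closed c)]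
    refine ((EB.wedgeEv (EB_truncForm_of_imp (d := -1) _ ?_ _) (e := a) ?_).mono (by simp)).neg
    · intro s hs
      simp only [not_le, AddMonoidHom.coe_fst] at hs ⊢
      omega
    · intro s
      have := s.1.2
      simp only [AddMonoidHom.coe_fst]
      omega
  neg_z := by
    refine (EB.wedgeEv ((zetaDet_mem (by simp) c).truncForm _) (e := 0) ?_).mono (d := 0 + 0)
      (by simp)
    simp
  z := by
    refine (EB.wedgeEv ((zetaDet_mem (by simp) c).truncForm _) (e := b) ?_).mono (d := b + 0)
      (by simp)
    intro s
    have := s.2.2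
    simp only [AddMonoidHom.coe_snd]
    omega

theorem Tc_wtr_det (ha : 3 ≤ a) (c : Fin (a * b + a - 1) → k) (j : Fin (a * b + a - 1)) :
    Tc (wtr k a b (fun s => 0 ≤ s.1) (zetaDet k a b c)) (repIx a b ha j).1
      (fun i => ((repIx a b ha j).2 i, i)) = c j := by
  obtain ⟨h1, h2, h3⟩ := repIx_spec ha j
  rw [wtr_apply, Tc_wedgeEv (EB_truncForm_of_imp _ (by simp) _) h2]
  have h4 := truncForm_add_truncForm_not (eb k a b) (fun s => 0 ≤ s.1) (zetaDet k a b c)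
  rw [← eq_sub_iff_add_eq] at h4
  rw [h4, AlternatingMap.sub_apply, map_sub, cf_map_last_eq_zero (EB_truncForm_of_imp _ (by
    intro s hs
    simp only [not_le, AddMonoidHom.coe_fst] at hs ⊢
    omega) _) h1, sub_zero]
  change cf _ (powSum c * detForm k a b _) = _
  rw [detForm_triangular, powSum, Finset.sum_mul, map_sum, Finset.sum_eq_single j]
  · rw [smul_mul_assoc, map_smul, mon_mul_mon, cf_mon, if_pos, smul_eq_mul, mul_one]
    simp only [Prod.mk_add_mk, add_zero, Prod.mk.injEq, and_true]
    linarith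
  · intro l _ hl
    rw [smul_mul_assoc, map_smul, mon_mul_mon, cf_mon, if_neg, smul_zero]
    simp only [Prod.mk_add_mk, add_zero, Prod.mk.injEq, and_true]
    intro h
    exact hl (Fin.ext (by omega))
  · simp

end Classes
section Core

variable {k : Type*} [Field k] {a b : ℕ}

theorem map_comp_mem_of_srt {n : ℕ} {S : Type*} [Fintype S] {χ : Alt k a b n} {w : S → VM k a b}
    (N : Submodule k (Lau k)) (i : Fin n → S) (hi : Function.Injective i)
    (h : ∀ U : {U : Finset S // U.card = n}, (∀ s, s ∈ U.1 ↔ ∃ j, i j = s) → χ (w ∘ srt U) ∈ N) :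
    χ (w ∘ i) ∈ N := by
  obtain ⟨U, σ, h1, h2⟩ := exists_srt i hi
  have h3 := χ.map_perm (w ∘ srt U) σ
  rw [Function.comp_assoc, ← h1] at h3
  rw [h3]
  rcases Int.units_eq_one_or (Equiv.Perm.sign σ) with h4 | h4
  · simpa [h4] using h U h2
  · simpa [h4] using h U h2

/-- The sets of `b + 1` vectors of a chart containing all the `ε`. -/
abbrev FullU (a b : ℕ) : Type :=
  {U : {U : Finset (Jx a b) // U.card = b + 1} // ∀ m, Sum.inl m ∈ U.1}

/-- The coefficients of the forms parametrized by full sets. -/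
def chainVal (c : FullU a b × Fin (a * b + a - 1) → k)
    (U : {U : Finset (Jx a b) // U.card = b + 1}) : Lau k :=
  if h : ∀ m, Sum.inl m ∈ U.1 then
    ∑ j : Fin (a * b + a - 1), c (⟨U, h⟩, j) • mon (0, -((j : ℕ) : ℤ) - 1) else 0

theorem chainVal_mem {lam : ℤ × ℤ →+ ℤ} (hlam : ∀ n : ℤ, lam (0, n) = 0)
    (c : FullU a b × Fin (a * b + a - 1) → k) (U : {U : Finset (Jx a b) // U.card = b + 1}) :
    chainVal c U ∈ degLE lam 0 := by
  rw [chainVal]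
  split_ifs
  · exact Submodule.sum_mem _ fun j _ => Submodule.smul_mem _ _ (mon_mem_degLE (hlam _).le)
  · exact Submodule.zero_mem _

theorem cf_chainVal (c : FullU a b × Fin (a * b + a - 1) → k) (U : FullU a b)
    (j : Fin (a * b + a - 1)) : cf (0, -((j : ℕ) : ℤ) - 1) (chainVal c U.1) = c (U, j) := by
  rw [chainVal, dif_pos U.2, map_sum, Finset.sum_eq_single j]
  · simp [cf_mon]
  · intro l _ hl
    rw [map_smul, cf_mon, if_neg, smul_zero]
    simp only [Prod.mk.injEq, true_and]
    intro h
    exact hl (Fin.ext (by omega))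
  · simp

theorem cf_chainVal_of_nonneg (c : FullU a b × Fin (a * b + a - 1) → k)
    (U : {U : Finset (Jx a b) // U.card = b + 1}) {s : ℤ × ℤ}
    (hs : 0 ≤ s.2 ∨ s.2 ≤ -((a * b + a : ℕ) : ℤ)) : cf s (chainVal c U) = 0 := by
  rw [chainVal]
  split_ifs
  · rw [map_sum]
    refine Finset.sum_eq_zero fun j _ => ?_
    rw [map_smul, cf_mon, if_neg, smul_zero]
    rintro rfl
    have := j.2
    simp only at hs
    omega
  · rw [map_zero]

variable (k a b) in
/-- The forms parametrized by full sets, before truncation. -/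
def zetaChain : (FullU a b × Fin (a * b + a - 1) → k) →ₗ[k] Alt k a b (b + 1) where
  toFun c := formOf (chartZ k a b).cbasis (chainVal c)
  map_add' c c' := by
    refine form_ext (chartZ k a b).cbasis fun U => ?_
    rw [AlternatingMap.add_apply, formOf_srt, formOf_srt, formOf_srt, chainVal, chainVal, chainVal]
    split_ifs
    · simp [add_smul, Finset.sum_add_distrib]
    · simp
  map_smul' r c := by
    refine form_ext (chartZ k a b).cbasis fun U => ?_
    rw [RingHom.id_apply, AlternatingMap.smul_apply, formOf_srt, formOf_srt, chainVal, chainVal]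
    split_ifs
    · simp [mul_smul, Finset.smul_sum]
    · simp

theorem zetaChain_srt (c : FullU a b × Fin (a * b + a - 1) → k)
    (U : {U : Finset (Jx a b) // U.card = b + 1}) :
    zetaChain k a b c (cvec (ez k a b) ∘ srt U) = chainVal c U := by
  have := formOf_srt (chartZ k a b).cbasis (chainVal c) U
  rw [(chartZ k a b).coe_cbasis] at this
  exact this

theorem zetaChain_van (c : FullU a b × Fin (a * b + a - 1) → k) : Van (zetaChain k a b c) := by
  rintro i ⟨m, hm⟩
  by_cases hi : Function.Injective i
  · refine (Submodule.mem_bot k).mp (map_comp_mem_of_srt ⊥ i hi fun U hU => ?_)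
    rw [zetaChain_srt, chainVal, dif_neg]
    · exact Submodule.zero_mem _
    · intro h
      obtain ⟨j, hj⟩ := (hU _).mp (h m)
      exact hm j hj
  · exact AlternatingMap.map_eq_zero_of_not_injective _ _ fun h => hi h.of_comp

theorem zetaChain_xFree (c : FullU a b × Fin (a * b + a - 1) → k) :
    XFree (zetaChain k a b c) where
  x := EB_x_of_cvec fun i hi => map_comp_mem_of_srt _ i hi fun U _ => by
    rw [zetaChain_srt]
    exact chainVal_mem (by simp) c U
  neg_x := EB_neg_x_of_cvec fun i hi => map_comp_mem_of_srt _ i hi fun U _ => by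
    rw [zetaChain_srt]
    exact chainVal_mem (by simp) c U

theorem inZ_wtr_chain (c : FullU a b × Fin (a * b + a - 1) → k) :
    InZ (wtr k a b (fun s => 0 ≤ s.2) (zetaChain k a b c)) where
  closed := wedgeEv_wedgeEv _ _
  neg_x := by
    refine (EB.wedgeEv ((zetaChain_xFree c).truncForm _).neg_x (e := 0) ?_).mono (d := 0 + 0)
      (by simp)
    simp
  x := by
    refine (EB.wedgeEv ((zetaChain_xFree c).truncForm _).x (e := a) ?_).mono (d := a + 0)
      (by simp)
    intro s
    have := s.1.2
    simp only [AddMonoidHom.coe_fst]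
    omega
  neg_z := by
    refine (EB.wedgeEv (EB_truncForm_of_imp _ ?_ _) (e := 0) ?_).mono (d := 0 + 0) (by simp)
    · simp
    · simp
  z := by
    rw [wtr_eq_neg _ (zetaChain_van c).closed]
    refine ((EB.wedgeEv (EB_truncForm_of_imp (d := -1) _ ?_ _) (e := b) ?_).mono (by simp)).neg
    · intro s hs
      simp only [not_le, AddMonoidHom.coe_snd] at hs ⊢
      omega
    · intro s
      have := s.2.2
      simp only [AddMonoidHom.coe_snd]
      omega

/-- Forms with constant values on standard tuples. -/
structure IsConst {n : ℕ} (η : Alt k a b n) : Prop where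
  xFree : XFree η
  neg_z : EB (-zd) 0 η
  z : EB zd 0 η

/-- Parameters of the syzygies modulo the trivial ones. -/
abbrev Par (k : Type*) (a b : ℕ) : Type _ :=
  (Fin (a * b + a - 1) → k) × (FullU a b × Fin (a * b + a - 1) → k)

variable (k a b) in
/-- Representatives of the syzygies modulo the trivial ones. -/
def psi : Par k a b →ₗ[k] Alt k a b (b + 2) :=
  (wtr k a b (fun s => 0 ≤ s.1) ∘ₗ zetaDet k a b).coprod
    (wtr k a b (fun s => 0 ≤ s.2) ∘ₗ zetaChain k a b)

theorem psi_apply (c : Par k a b) : psi k a b c =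
    wtr k a b (fun s => 0 ≤ s.1) (zetaDet k a b c.1) +
      wtr k a b (fun s => 0 ≤ s.2) (zetaChain k a b c.2) := rfl

theorem inZ_psi (c : Par k a b) : InZ (psi k a b c) :=
  (inZ_wtr_det c.1).add (inZ_wtr_chain c.2)

theorem eq_zero_of_psi_eq (ha : 3 ≤ a) {c : Par k a b} {η : Alt k a b (b + 1)} (hη : IsConst η)
    (h : psi k a b c = wedgeEv (evm k a b) (b + 1) η) : c = 0 := by
  obtain ⟨c1, c2⟩ := c
  rw [psi_apply] at h
  dsimp only at h
  have h1 : c1 = 0 := by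
    funext j
    obtain ⟨p1, p2, -⟩ := repIx_spec (b := b) ha j
    have h2 := congrArg (fun ω => Tc ω (repIx a b ha j).1 (fun i => ((repIx a b ha j).2 i, i))) h
    rw [Tc_add, Tc_wtr_det, wtr_apply, ((zetaChain_xFree c2).truncForm _).Tc_wedgeEv p1 p2,
      hη.xFree.Tc_wedgeEv p1 p2, add_zero] at h2
    exact h2
  subst h1
  rw [map_zero, map_zero, zero_add, wtr_apply] at h
  have h3 := truncForm_add_truncForm_not (eb k a b) (fun s => 0 ≤ s.2) (zetaChain k a b c2)
  set σ := truncForm (eb k a b) (trunc fun s => 0 ≤ s.2) (zetaChain k a b c2) with hσ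
  set σ' := truncForm (eb k a b) (trunc fun s => ¬ 0 ≤ s.2) (zetaChain k a b c2) with hσ'
  have hσx : XFree σ := (zetaChain_xFree c2).truncForm _
  have hσx' : XFree σ' := (zetaChain_xFree c2).truncForm _
  have c0 : wedgeEv (evm k a b) (b + 1) (η + σ') = 0 := by
    rw [map_add, ← h, ← map_add, h3, (zetaChain_van c2).closed]
  have z0 : EB (-zd) 0 (σ - η) := (EB_truncForm_of_imp _ (by simp) _).sub hη.neg_z
  have z1 : EB zd 0 (η + σ') := hη.z.add (EB_truncForm_of_imp _ (by
    intro s hs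
    simp only [not_le, AddMonoidHom.coe_snd] at hs ⊢
    omega) _)
  have hc : c2 = 0 := by
    funext ⟨U, j⟩
    rw [← cf_chainVal c2 U j, ← zetaChain_srt, ← h3,
      show σ + σ' = (σ - η) + (η + σ') by abel, AlternatingMap.add_apply, map_add]
    have e1 := z0.cvec_neg_z (srt U.1)
    have e2 := map_cvec_mem_of_z (hη.xFree.add hσx') c0 z1 (srt U.1) (srt_injective U.1)
      (fun m => (mem_range_srt U.1 _).mpr (U.2 m))
    have := j.2
    rw [cf_eq_zero_of_degLE e1, cf_eq_zero_of_degLE e2, add_zero, Pi.zero_apply]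
    · simp only [AddMonoidHom.coe_snd]
      omega
    · simp only [AddMonoidHom.neg_apply, AddMonoidHom.coe_snd]
      omega
  rw [hc]
  rfl

theorem exists_psi_add (ha : 3 ≤ a) {ω : Alt k a b (b + 2)} (hω : InZ ω) :
    ∃ (c : Par k a b) (η : Alt k a b (b + 1)), IsConst η ∧
      ω = psi k a b c + wedgeEv (evm k a b) (b + 1) η := by
  set c1 : Fin (a * b + a - 1) → k :=
    fun j => Tc ω (repIx a b ha j).1 (fun i => ((repIx a b ha j).2 i, i)) with hc1
  set ω' := ω - wtr k a b (fun s => 0 ≤ s.1) (zetaDet k a b c1) with hω'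
  have hZ : InZ ω' := hω.sub (inZ_wtr_det c1)
  have hT : ∀ (c : ℤ) s, 0 < c → c < a → Tc ω' c s = 0 := fun c s hc hca =>
    Tc_eq_zero_of_repIx hZ ha (fun j => by rw [hω', Tc_sub, Tc_wtr_det, sub_self]) c s hc hca
  set η := (chartZ k a b).prim ω' with hη
  set η' := (chartI k a b).prim ω' with hη'
  have wη : wedgeEv (evm k a b) (b + 1) η = ω' := (chartZ k a b).wedgeEv_prim hZ.closed
  have wη' : wedgeEv (evm k a b) (b + 1) η' = ω' := (chartI k a b).wedgeEv_prim hZ.closed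
  have xη : XFree η := ⟨(chartZ k a b).prim_x hZ.closed hZ.x
    (fun y c d h1 h2 => cf_theta_ez_vv hZ hT y c d h1 h2), (chartZ k a b).prim_neg_x hZ.neg_x⟩
  have xη' : XFree η' := ⟨(chartI k a b).prim_x hZ.closed hZ.x
    (fun y c d h1 h2 => cf_theta_ei_vv hZ hT y c d h1 h2), (chartI k a b).prim_neg_x hZ.neg_x⟩
  have zη : EB (-zd) 0 η := (chartZ k a b).prim_lam (d := 0) (by rfl) hZ.neg_z
  have zη' : EB zd 0 η' := (chartI k a b).prim_lam (d := b) (by exact add_neg_cancel _) hZ.z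
  set ζ := η - η' with hζ
  have xζ : XFree ζ := xη.sub xη'
  have vζ : Van ζ := van_of_closed xζ (by rw [hζ, map_sub, wη, wη', sub_self])
  set c2 : FullU a b × Fin (a * b + a - 1) → k := fun x =>
    cf (0, -((x.2 : ℕ) : ℤ) - 1) (ζ (cvec (ez k a b) ∘ srt x.1.1)) with hc2
  set ζp := ctr (fun s => 0 ≤ s.2) ζ with hζp
  set ζm := ctr (fun s => s.2 ≤ -((a * b + a : ℕ) : ℤ)) ζ with hζm
  have hsum : ζ = ζp + zetaChain k a b c2 + ζm := by
    refine form_ext (chartZ k a b).cbasis fun U => ?_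
    rw [(chartZ k a b).coe_cbasis]
    change ζ (cvec (ez k a b) ∘ srt U) = ζp (cvec (ez k a b) ∘ srt U) +
      zetaChain k a b c2 (cvec (ez k a b) ∘ srt U) + ζm (cvec (ez k a b) ∘ srt U)
    rw [ctr_apply, ctr_apply, zetaChain_srt]
    by_cases hU : ∀ m, Sum.inl m ∈ U.1
    · refine lau_ext fun s => ?_
      rw [map_add, map_add, cf_trunc, cf_trunc]
      by_cases h0 : s.1 = 0
      · by_cases h1 : 0 ≤ s.2
        · rw [if_pos h1, cf_chainVal_of_nonneg _ _ (Or.inl h1), if_neg (by omega), add_zero,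
            add_zero]
        · by_cases h2 : s.2 ≤ -((a * b + a : ℕ) : ℤ)
          · rw [if_neg h1, cf_chainVal_of_nonneg _ _ (Or.inr h2), if_pos h2, add_zero, zero_add]
          · rw [if_neg h1, if_neg h2, zero_add, add_zero]
            have h3 := cf_chainVal c2 ⟨U, hU⟩ ⟨(-s.2 - 1).toNat, by omega⟩
            have h4 : (0, -(((-s.2 - 1).toNat : ℕ) : ℤ) - 1) = s :=
              Prod.ext h0.symm (by dsimp only; omega)
            dsimp only at h3
            rw [hc2] at h3 ⊢
            dsimp only at h3
            rw [h4] at h3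
            exact h3.symm
      · have e1 := (xζ.cf_eq_zero (u := cvec (ez k a b) ∘ srt U)
          (fun j => (chartZ k a b).c_mem_x (srt U j))
          (fun j => (chartZ k a b).c_mem_neg_x (srt U j)) h0 s.2)
        have e2 : cf s (chainVal c2 U) = 0 := by
          rcases lt_or_gt_of_ne h0 with h | h
          · exact cf_eq_zero_of_degLE (chainVal_mem (lam := -xd) (by simp) c2 U) (by simpa using h)
          · exact cf_eq_zero_of_degLE (chainVal_mem (lam := xd) (by simp) c2 U) (by simpa using h)
        rw [Prod.mk.eta] at e1
        rw [e1, e2]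
        simp
    · have e1 : ζ (cvec (ez k a b) ∘ srt U) = 0 := by
        push Not at hU
        obtain ⟨m, hm⟩ := hU
        exact vζ _ ⟨m, fun j hj => hm ((mem_range_srt U _).mp ⟨j, hj⟩)⟩
      rw [e1, chainVal, dif_neg hU]
      simp
  set σ := truncForm (eb k a b) (trunc fun s => 0 ≤ s.2) (zetaChain k a b c2) with hσ
  set σ' := truncForm (eb k a b) (trunc fun s => ¬ 0 ≤ s.2) (zetaChain k a b c2) with hσ'
  have h3 : σ + σ' = zetaChain k a b c2 :=
    truncForm_add_truncForm_not (eb k a b) (fun s => 0 ≤ s.2) (zetaChain k a b c2)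
  have hσx : XFree σ := (zetaChain_xFree c2).truncForm _
  have hp : XFree ζp := xζ.ctr _
  have hm : XFree ζm := xζ.ctr _
  have heq : η - σ - ζp = η' + σ' + ζm := by
    rw [← h3, hζ] at hsum
    rw [sub_eq_iff_eq_add] at hsum
    rw [hsum]
    abel
  refine ⟨(c1, c2), η - σ - ζp, ⟨(xη.sub hσx).sub hp, ?_, ?_⟩, ?_⟩
  · refine (zη.sub (EB_truncForm_of_imp _ (by simp) _)).sub (EB_neg_z_of_cvec fun i _ => ?_)
    rw [ctr_apply]
    exact trunc_mem_degLE_of_imp _ (by simp) _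
  · rw [heq]
    refine (zη'.add (EB_truncForm_of_imp _ (by
      intro s hs
      simp only [not_le, AddMonoidHom.coe_snd] at hs ⊢
      omega) _)).add (EB_z_of_cvec hm (vζ.ctr _) fun i => ?_)
    rw [ctr_apply]
    exact trunc_mem_degLE_of_imp _ (fun s hs => hs) _
  · rw [map_sub, map_sub, wη, psi_apply, (vζ.ctr _).closed, wtr_apply _ (zetaChain k a b c2), hω']
    abel

end Core

section Volume

/-- Concatenation of two tuples. -/
def cat {M : Type*} {r m N : ℕ} (h : r + m = N) (v : Fin r → M) (u : Fin m → M) : Fin N → M :=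
  fun i => if hi : (i : ℕ) < r then v ⟨i, hi⟩ else u ⟨i - r, by omega⟩

section Cat

variable {M : Type*} {r m N : ℕ}

theorem cat_left (h : r + m = N) (v : Fin r → M) (u : Fin m → M) (i : Fin r) :
    cat h v u ⟨i, by omega⟩ = v i := by
  simp [cat]

theorem cat_right (h : r + m = N) (v : Fin r → M) (u : Fin m → M) (j : Fin m) :
    cat h v u ⟨r + j, by omega⟩ = u j := by
  simp [cat]

theorem cat_update_left (h : r + m = N) (v : Fin r → M) (u : Fin m → M) (i : Fin r) (x : M) :
    cat h (Function.update v i x) u = Function.update (cat h v u) ⟨i, by omega⟩ x := by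
  funext l
  by_cases hl : (l : ℕ) < r
  · by_cases hli : (l : ℕ) = i
    · have h1 : l = ⟨i, by omega⟩ := Fin.ext hli
      rw [h1, cat_left, Function.update_self, Function.update_self]
    · have h1 : l ≠ ⟨i, by omega⟩ := fun h => hli (congrArg Fin.val h)
      have h2 : (⟨l, hl⟩ : Fin r) ≠ i := fun h => hli (congrArg Fin.val h)
      simp [cat, hl, h1, h2]
  · have h1 : l ≠ ⟨i, by omega⟩ := fun h => hl (by rw [h]; exact i.2)
    simp [cat, hl, h1]

theorem cat_update_right (h : r + m = N) (v : Fin r → M) (u : Fin m → M) (j : Fin m) (x : M) :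
    cat h v (Function.update u j x) = Function.update (cat h v u) ⟨r + j, by omega⟩ x := by
  funext l
  by_cases hl : (l : ℕ) < r
  · have h1 : l ≠ ⟨r + j, by omega⟩ := fun h => by rw [h] at hl; simp at hl
    simp [cat, hl, h1]
  · by_cases hli : (l : ℕ) = r + j
    · have h1 : l = ⟨r + j, by omega⟩ := Fin.ext hli
      rw [h1, cat_right, Function.update_self, Function.update_self]
    · have h1 : l ≠ ⟨r + j, by omega⟩ := fun h => hli (congrArg Fin.val h)
      have h2 : (⟨l - r, by omega⟩ : Fin m) ≠ j := fun h => hli (by rw [← h]; dsimp only; omega)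
      simp [cat, hl, h1, h2]

theorem cat_of_lt (h : r + m = N) (v : Fin r → M) (u : Fin m → M) {l : Fin N} (i : Fin r)
    (hi : (l : ℕ) = i) : cat h v u l = v i := by
  have : l = ⟨i, by omega⟩ := Fin.ext hi
  rw [this, cat_left]

theorem cat_of_le (h : r + m = N) (v : Fin r → M) (u : Fin m → M) {l : Fin N} (j : Fin m)
    (hj : (l : ℕ) = r + j) : cat h v u l = u j := by
  have : l = ⟨r + j, by omega⟩ := Fin.ext hj
  rw [this, cat_right]

theorem removeNth_cat_left (h : r + 1 + m = N + 1) (h' : r + m = N) (v : Fin (r + 1) → M)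
    (u : Fin m → M) (i : Fin (r + 1)) :
    Fin.removeNth (⟨i, by omega⟩ : Fin (N + 1)) (cat h v u) = cat h' (i.removeNth v) u := by
  funext l
  by_cases hl : (l : ℕ) < r
  · rw [cat_of_lt h' _ _ ⟨l, hl⟩ rfl]
    refine cat_of_lt h _ _ _ ?_
    simp only [Fin.succAbove, Fin.lt_def, Fin.val_castSucc]
    split_ifs <;> simp
  · rw [cat_of_le h' _ _ ⟨l - r, by omega⟩ (by simp only; omega)]
    refine cat_of_le h _ _ _ ?_
    simp only [Fin.succAbove, Fin.lt_def, Fin.val_castSucc]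
    rw [if_neg (by omega)]
    simp only [Fin.val_succ]
    omega

theorem removeNth_cat_right (h : r + (m + 1) = N + 1) (h' : r + m = N) (v : Fin r → M)
    (u : Fin (m + 1) → M) (j : Fin (m + 1)) :
    Fin.removeNth (⟨r + j, by omega⟩ : Fin (N + 1)) (cat h v u) = cat h' v (j.removeNth u) := by
  funext l
  by_cases hl : (l : ℕ) < r
  · rw [cat_of_lt h' _ _ ⟨l, hl⟩ rfl]
    refine cat_of_lt h _ _ _ ?_
    simp only [Fin.succAbove, Fin.lt_def, Fin.val_castSucc]
    rw [if_pos (by omega), Fin.val_castSucc]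
  · rw [cat_of_le h' _ _ ⟨l - r, by omega⟩ (by simp only; omega)]
    refine cat_of_le h _ _ _ ?_
    simp only [Fin.succAbove, Fin.lt_def, Fin.val_castSucc]
    split_ifs <;> simp only [Fin.val_succ, Fin.val_castSucc] <;> omega

theorem sum_fin_cat {A : Type*} [AddCommMonoid A] (h : r + m = N) (f : Fin N → A) :
    ∑ l, f l = ∑ i : Fin r, f ⟨i, by omega⟩ + ∑ j : Fin m, f ⟨r + j, by omega⟩ := by
  subst h
  exact Fin.sum_univ_add f

theorem comp_cat {M' : Type*} (g : M → M') (h : r + m = N) (v : Fin r → M) (u : Fin m → M) :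
    g ∘ cat h v u = cat h (g ∘ v) (g ∘ u) := by
  funext l
  simp only [Function.comp_apply, cat]
  split_ifs <;> rfl

end Cat

variable {R M : Type*} [CommRing R] [AddCommGroup M] [Module R M] {r m N : ℕ}

/-- Iterated contraction of an alternating form. -/
def contr (h : r + m = N) (ω : M [⋀^Fin N]→ₗ[R] R) (v : Fin r → M) : M [⋀^Fin m]→ₗ[R] R where
  toFun u := ω (cat h v u)
  map_update_add' u j x y := by
    have : ‹DecidableEq (Fin m)› = instDecidableEqFin m := Subsingleton.elim _ _
    subst this
    rw [cat_update_right, cat_update_right, cat_update_right, ω.map_update_add]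
  map_update_smul' u j c x := by
    have : ‹DecidableEq (Fin m)› = instDecidableEqFin m := Subsingleton.elim _ _
    subst this
    rw [cat_update_right, cat_update_right, ω.map_update_smul]
  map_eq_zero_of_eq' u i j hij hne := by
    refine ω.map_eq_zero_of_eq _ (i := ⟨r + i, by omega⟩) (j := ⟨r + j, by omega⟩) ?_ ?_
    · rw [cat_right, cat_right, hij]
    · intro h
      exact hne (Fin.ext (by simpa using h))

theorem contr_apply (h : r + m = N) (ω : M [⋀^Fin N]→ₗ[R] R) (v : Fin r → M) (u : Fin m → M) :
    contr h ω v u = ω (cat h v u) := rfl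

theorem alternating_sum_apply {ι : Type*} (s : Finset ι) (f : ι → M [⋀^Fin m]→ₗ[R] R)
    (u : Fin m → M) : (∑ i ∈ s, f i) u = ∑ i ∈ s, f i u := by
  classical
  induction s using Finset.induction_on with
  | empty => simp
  | insert i s hi ih => rw [Finset.sum_insert hi, Finset.sum_insert hi, AlternatingMap.add_apply, ih]

theorem contr_update_add (h : r + m = N) (ω : M [⋀^Fin N]→ₗ[R] R) (v : Fin r → M) (i : Fin r)
    (x y : M) : contr h ω (Function.update v i (x + y)) =
      contr h ω (Function.update v i x) + contr h ω (Function.update v i y) := by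
  refine AlternatingMap.ext fun u => ?_
  rw [AlternatingMap.add_apply, contr_apply, contr_apply, contr_apply, cat_update_left,
    cat_update_left, cat_update_left, ω.map_update_add]

theorem contr_update_smul (h : r + m = N) (ω : M [⋀^Fin N]→ₗ[R] R) (v : Fin r → M) (i : Fin r)
    (c : R) (x : M) : contr h ω (Function.update v i (c • x)) =
      c • contr h ω (Function.update v i x) := by
  refine AlternatingMap.ext fun u => ?_
  rw [AlternatingMap.smul_apply, contr_apply, contr_apply, cat_update_left,
    cat_update_left, ω.map_update_smul]

theorem contr_eq_zero (h : r + m = N) (ω : M [⋀^Fin N]→ₗ[R] R) (v : Fin r → M) {i j : Fin r}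
    (hv : v i = v j) (hij : i ≠ j) : contr h ω v = 0 := by
  refine AlternatingMap.ext fun u => ?_
  refine ω.map_eq_zero_of_eq _ (i := ⟨i, by omega⟩) (j := ⟨j, by omega⟩) ?_ ?_
  · rw [cat_left, cat_left, hv]
  · intro h
    exact hij (Fin.ext (by simpa using h))

/-- The Leibniz rule for contractions of a closed form. -/
theorem wedgeEv_contr (ev : M →ₗ[R] R) (h : r + 1 + m = N) (h' : r + (m + 1) = N)
    (ω : M [⋀^Fin N]→ₗ[R] R) (hω : wedgeEv ev N ω = 0) (v : Fin (r + 1) → M) :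
    ∑ i : Fin (r + 1), ((-1) ^ (i : ℕ) * ev (v i)) • contr h' ω (i.removeNth v) =
      (-1 : R) ^ r • wedgeEv ev m (contr h ω v) := by
  refine AlternatingMap.ext fun u => ?_
  have hN : r + 1 + (m + 1) = N + 1 := by omega
  have h1 := congrArg (fun χ => χ (cat hN v u)) hω
  simp only [AlternatingMap.zero_apply] at h1
  rw [wedgeEv_apply, sum_fin_cat hN] at h1
  simp only [cat_left, cat_right] at h1
  simp only [removeNth_cat_left hN h' v u, removeNth_cat_right hN h v u] at h1
  rw [alternating_sum_apply, AlternatingMap.smul_apply, wedgeEv_apply, smul_eq_mul,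
    Finset.mul_sum]
  rw [add_eq_zero_iff_eq_neg, ← Finset.sum_neg_distrib] at h1
  refine Eq.trans (Finset.sum_congr rfl fun i _ => ?_) (h1.trans (Finset.sum_congr rfl fun j _ => ?_))
  · rw [AlternatingMap.smul_apply, contr_apply, smul_eq_mul, mul_assoc]
  · rw [contr_apply]
    ring

end Volume
section Bihomogeneous

variable {k : Type*} [Field k] {a b d e : ℕ}

/-- The exponent of a monomial of bidegree `(d, e)`. -/
def mexp (d e : ℕ) (s : Ix a b) : Fin 4 →₀ ℕ :=
  Finsupp.equivFunOnFinite.symm ![s.1, d - s.1, s.2, e - s.2]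

theorem mexp_injective (d e : ℕ) : Function.Injective (mexp d e : Ix a b → Fin 4 →₀ ℕ) := by
  intro s t h
  have h0 := DFunLike.congr_fun h 0
  have h2 := DFunLike.congr_fun h 2
  exact Prod.ext (Fin.ext h0) (Fin.ext h2)

theorem mexp_spec (hd : d = a) (he : e = b) (s : Ix a b) :
    mexp d e s 0 + mexp d e s 1 = d ∧ mexp d e s 2 + mexp d e s 3 = e := by
  have h1 := s.1.2
  have h2 := s.2.2
  change (s.1 : ℕ) + (d - s.1) = d ∧ (s.2 : ℕ) + (e - s.2) = e
  omega

theorem exists_mexp (hd : d = a) (he : e = b) {m : Fin 4 →₀ ℕ} (h1 : m 0 + m 1 = d)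
    (h2 : m 2 + m 3 = e) : ∃ s : Ix a b, mexp d e s = m := by
  refine ⟨(⟨m 0, by omega⟩, ⟨m 2, by omega⟩), Finsupp.ext fun i => ?_⟩
  fin_cases i
  · rfl
  · change d - m 0 = m 1
    omega
  · rfl
  · change e - m 2 = m 3
    omega

variable (k) in
/-- The monomials of bidegree `(d, e)`. -/
def bmon (hd : d = a) (he : e = b) (s : Ix a b) : Bihom k d e :=
  ⟨monomial (mexp d e s) 1, fun m hm => by
    classical
    rw [mem_support_iff, coeff_monomial] at hm
    obtain rfl : mexp d e s = m := by
      by_contra h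
      rw [if_neg h] at hm
      exact hm rfl
    exact mexp_spec hd he s⟩

theorem coeff_sum_bmon (hd : d = a) (he : e = b) (c : Ix a b → k) (m : Fin 4 →₀ ℕ) :
    coeff m ((∑ s, c s • bmon k hd he s : Bihom k d e) : MvPolynomial (Fin 4) k) =
      ∑ s, if mexp d e s = m then c s else 0 := by
  classical
  rw [Submodule.coe_sum, coeff_sum]
  refine Finset.sum_congr rfl fun s _ => ?_
  rw [Submodule.coe_smul, coeff_smul, bmon, coeff_monomial]
  simp

variable (k) in
/-- Coordinates on the space of bihomogeneous polynomials. -/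
def bihomEquiv (hd : d = a) (he : e = b) : Bihom k d e ≃ₗ[k] (Ix a b → k) where
  toFun f s := coeff (mexp d e s) (f : MvPolynomial (Fin 4) k)
  map_add' f g := by
    funext s
    simp
  map_smul' r f := by
    funext s
    simp
  invFun c := ∑ s, c s • bmon k hd he s
  left_inv f := by
    refine Subtype.ext (MvPolynomial.ext _ _ fun m => ?_)
    rw [coeff_sum_bmon]
    by_cases hm : m 0 + m 1 = d ∧ m 2 + m 3 = e
    · obtain ⟨s, rfl⟩ := exists_mexp hd he hm.1 hm.2
      rw [Finset.sum_eq_single s (fun t _ ht => if_neg fun h => ht (mexp_injective d e h))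
        (by simp), if_pos rfl]
    · have h0 : coeff m (f : MvPolynomial (Fin 4) k) = 0 := by
        by_contra h
        exact hm (f.2 m (mem_support_iff.mpr h))
      rw [h0]
      refine Finset.sum_eq_zero fun s _ => if_neg fun h => hm ?_
      rw [← h]
      exact mexp_spec hd he s
  right_inv c := by
    funext t
    refine (coeff_sum_bmon hd he c _).trans ?_
    rw [Finset.sum_eq_single t (fun s _ hs => if_neg fun h => hs (mexp_injective d e h))
        (by simp), if_pos rfl]

variable (k) in
/-- The monomial basis. -/
def bihomBasis (hd : d = a) (he : e = b) : Module.Basis (Ix a b) k (Bihom k d e) :=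
  Module.Basis.ofEquivFun (bihomEquiv k hd he)

theorem bihomBasis_apply (hd : d = a) (he : e = b) (s : Ix a b) :
    bihomBasis k hd he s = bmon k hd he s := by
  rw [bihomBasis, Module.Basis.coe_ofEquivFun]
  change ∑ t, Pi.single (M := fun _ => k) s 1 t • bmon k hd he t = _
  rw [Finset.sum_eq_single s]
  · simp
  · intro t _ ht
    simp [ht]
  · simp

variable (k) in
/-- Dehomogenization. -/
def phi : MvPolynomial (Fin 4) k →ₐ[k] Lau k := aeval ![mon (1, 0), 1, mon (0, 1), 1]

theorem mon_pow (s : ℤ × ℤ) (n : ℕ) : (mon s : Lau k) ^ n = mon (n • s) := by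
  induction n with
  | zero => rw [pow_zero, zero_smul, mon_zero]
  | succ n ih => rw [pow_succ, ih, mon_mul_mon, succ_nsmul]

theorem phi_monomial (m : Fin 4 →₀ ℕ) :
    phi k (monomial m 1) = mon (((m 0 : ℕ) : ℤ), ((m 2 : ℕ) : ℤ)) := by
  rw [phi, aeval_monomial, Finsupp.prod_fintype _ _ (fun i => by simp), Fin.prod_univ_four, map_one, one_mul]
  simp [mon_pow, mon_mul_mon]

theorem phi_bmon (hd : d = a) (he : e = b) (s : Ix a b) :
    phi k (bmon k hd he s : MvPolynomial (Fin 4) k) = mon (((s.1 : ℕ) : ℤ), ((s.2 : ℕ) : ℤ)) :=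
  phi_monomial _

theorem phi_eq_sum (hd : d = a) (he : e = b) (f : Bihom k d e) :
    phi k (f : MvPolynomial (Fin 4) k) =
      ∑ s : Ix a b, bihomEquiv k hd he f s • mon (((s.1 : ℕ) : ℤ), ((s.2 : ℕ) : ℤ)) := by
  conv_lhs => rw [← (bihomEquiv k hd he).symm_apply_apply f]
  change phi k ((∑ s, bihomEquiv k hd he f s • bmon k hd he s : Bihom k d e) :
    MvPolynomial (Fin 4) k) = _
  rw [Submodule.coe_sum, map_sum]
  refine Finset.sum_congr rfl fun s _ => ?_
  rw [Submodule.coe_smul, map_smul, phi_bmon]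

theorem cf_phi (hd : d = a) (he : e = b) (f : Bihom k d e) (s : Ix a b) :
    cf (((s.1 : ℕ) : ℤ), ((s.2 : ℕ) : ℤ)) (phi k (f : MvPolynomial (Fin 4) k)) =
      bihomEquiv k hd he f s := by
  rw [phi_eq_sum hd he, map_sum, Finset.sum_eq_single s]
  · simp [cf_mon]
  · intro t _ ht
    rw [map_smul, cf_mon, if_neg, smul_zero]
    intro h
    simp only [Prod.mk.injEq, Nat.cast_inj] at h
    exact ht (Prod.ext (Fin.ext h.1) (Fin.ext h.2))
  · simp

/-- Laurent polynomials with exponents in a rectangle. -/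
structure Box (d e : ℕ) (g : Lau k) : Prop where
  x : g ∈ degLE xd d
  neg_x : g ∈ degLE (-xd) 0
  z : g ∈ degLE zd e
  neg_z : g ∈ degLE (-zd) 0

theorem box_phi (f : Bihom k d e) : Box d e (phi k (f : MvPolynomial (Fin 4) k)) := by
  have hmem : ∀ (lam : ℤ × ℤ →+ ℤ) (l : ℤ),
      (∀ s : Ix d e, lam (((s.1 : ℕ) : ℤ), ((s.2 : ℕ) : ℤ)) ≤ l) →
      phi k (f : MvPolynomial (Fin 4) k) ∈ degLE lam l := by
    intro lam l h
    rw [phi_eq_sum rfl rfl]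
    exact Submodule.sum_mem _ fun s _ => Submodule.smul_mem _ _ (mon_mem_degLE (h s))
  refine ⟨hmem _ _ fun s => ?_, hmem _ _ fun s => ?_, hmem _ _ fun s => ?_, hmem _ _ fun s => ?_⟩
  · have := s.1.2
    simp only [AddMonoidHom.coe_fst]
    omega
  · simp
  · have := s.2.2
    simp only [AddMonoidHom.coe_snd]
    omega
  · simp

theorem Box.exists_phi {g : Lau k} (hg : Box d e g) :
    ∃ f : Bihom k d e, phi k (f : MvPolynomial (Fin 4) k) = g := by
  let c : Ix d e → k := fun s => cf (((s.1 : ℕ) : ℤ), ((s.2 : ℕ) : ℤ)) g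
  let f := (bihomEquiv k rfl rfl).symm c
  have key : ∀ g' : Lau k, Box d e g' →
      (∀ s : Ix d e, cf (((s.1 : ℕ) : ℤ), ((s.2 : ℕ) : ℤ)) g' = c s) → g' = g := by
    intro g' hg' h
    refine lau_ext fun t => ?_
    obtain ⟨t1, t2⟩ := t
    by_cases h1 : 0 ≤ t1
    swap
    · rw [cf_eq_zero_of_degLE hg'.neg_x (by simpa using h1),
        cf_eq_zero_of_degLE hg.neg_x (by simpa using h1)]
    by_cases h2 : t1 ≤ d
    swap
    · rw [cf_eq_zero_of_degLE hg'.x (by simpa using h2),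
        cf_eq_zero_of_degLE hg.x (by simpa using h2)]
    by_cases h3 : 0 ≤ t2
    swap
    · rw [cf_eq_zero_of_degLE hg'.neg_z (by simpa using h3),
        cf_eq_zero_of_degLE hg.neg_z (by simpa using h3)]
    by_cases h4 : t2 ≤ e
    swap
    · rw [cf_eq_zero_of_degLE hg'.z (by simpa using h4),
        cf_eq_zero_of_degLE hg.z (by simpa using h4)]
    lift t1 to ℕ using h1
    lift t2 to ℕ using h3
    exact h (⟨t1, by omega⟩, ⟨t2, by omega⟩)
  refine ⟨f, key _ (box_phi f) fun s => ?_⟩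
  rw [cf_phi rfl rfl, LinearEquiv.apply_symm_apply]

theorem eq_zero_of_phi_eq_zero {f : Bihom k d e}
    (h : phi k (f : MvPolynomial (Fin 4) k) = 0) : f = 0 := by
  refine (bihomEquiv k rfl rfl).map_eq_zero_iff.mp (funext fun s => ?_)
  rw [← cf_phi, h, map_zero, Pi.zero_apply]

end Bihomogeneous
section Duality

variable {k : Type*} [Field k] {a b : ℕ}

variable (k a b) in
/-- The inclusion of the linear forms into the free module. -/
def incl : RS k a b 1 →ₗ[k] VM k a b :=
  (bihomBasis k (one_mul a) (one_mul b)).constr k (eb k a b)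

theorem incl_basis (s : Ix a b) :
    incl k a b (bihomBasis k (one_mul a) (one_mul b) s) = eb k a b s := by
  rw [incl, Module.Basis.constr_basis]

theorem evm_incl (v : RS k a b 1) :
    evm k a b (incl k a b v) = phi k (v : MvPolynomial (Fin 4) k) := by
  have h : (evm k a b).restrictScalars k ∘ₗ incl k a b =
      (phi k).toLinearMap ∘ₗ (RS k a b 1).subtype := by
    refine (bihomBasis k (one_mul a) (one_mul b)).ext fun s => ?_
    rw [LinearMap.comp_apply, LinearMap.comp_apply, incl_basis, bihomBasis_apply]
    exact (evm_eb k a b s).trans (phi_bmon (one_mul a) (one_mul b) s).symm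
  exact DFunLike.congr_fun h v

variable (k a b) in
/-- The volume form. -/
def vol : Alt k a b ((a + 1) * (b + 1)) := formOf (eb k a b) fun _ => 1

theorem vol_sq {i : Fin ((a + 1) * (b + 1)) → Ix a b} (hi : Function.Injective i) :
    vol k a b (eb k a b ∘ i) * vol k a b (eb k a b ∘ i) = 1 ∧
      ∃ c : k, vol k a b (eb k a b ∘ i) = c • 1 := by
  obtain ⟨U, σ, rfl, -⟩ := exists_srt i hi
  have h1 := (vol k a b).map_perm (eb k a b ∘ srt U) σ
  rw [vol, formOf_srt, Function.comp_assoc] at h1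
  rw [vol, h1]
  rcases Int.units_eq_one_or (Equiv.Perm.sign σ) with h | h
  · exact ⟨by simp [h], 1, by simp [h]⟩
  · exact ⟨by simp [h], -1, by simp [h]⟩

theorem vol_closed : wedgeEv (evm k a b) _ (vol k a b) = 0 := by
  refine (eb k a b).ext_alternating fun i hi => ?_
  have := Fintype.card_le_of_injective i hi
  simp at this

variable {r m : ℕ}

theorem smul_one_smul_alt (c : k) (χ : Alt k a b m) : (c • (1 : Lau k)) • χ = c • χ := by
  refine AlternatingMap.ext fun u => ?_
  rw [AlternatingMap.smul_apply, AlternatingMap.smul_apply, smul_one_smul]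

theorem smul_smul_alt (c : k) (f : Lau k) (χ : Alt k a b m) : (c • f) • χ = c • f • χ := by
  refine AlternatingMap.ext fun u => ?_
  exact smul_mul_assoc c f _

variable (k) in
/-- Contraction of the volume form with linear forms. -/
def volAlt (h : r + m = (a + 1) * (b + 1)) : RS k a b 1 [⋀^Fin r]→ₗ[k] Alt k a b m where
  toFun v := contr h (vol k a b) (incl k a b ∘ v)
  map_update_add' v i x y := by
    have : ‹DecidableEq (Fin r)› = instDecidableEqFin r := Subsingleton.elim _ _
    subst this
    rw [Function.comp_update, Function.comp_update, Function.comp_update, map_add,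
      contr_update_add]
  map_update_smul' v i c x := by
    have : ‹DecidableEq (Fin r)› = instDecidableEqFin r := Subsingleton.elim _ _
    subst this
    rw [Function.comp_update, Function.comp_update, map_smul, ← smul_one_smul (Lau k) c,
      contr_update_smul, smul_one_smul_alt]
  map_eq_zero_of_eq' v i j hv hij :=
    contr_eq_zero h _ _ (congrArg (incl k a b) hv) hij

variable (k) in
/-- The comparison of the Koszul complex with the complex of alternating forms. -/
def dual (h : r + m = (a + 1) * (b + 1)) (q : ℕ) :
    ((⋀[k]^r (RS k a b 1)) ⊗[k] (RS k a b q)) →ₗ[k] Alt k a b m :=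
  TensorProduct.lift (LinearMap.mk₂ k
    (fun x f => phi k (f : MvPolynomial (Fin 4) k) •
      exteriorPower.alternatingMapLinearEquiv (volAlt k h) x)
    (fun x y f => by rw [map_add, smul_add])
    (fun c x f => by rw [map_smul, smul_comm])
    (fun x f g => by rw [Submodule.coe_add, map_add, add_smul])
    (fun c x f => by rw [Submodule.coe_smul, map_smul, smul_smul_alt]))

theorem dual_wedge (h : r + m = (a + 1) * (b + 1)) (q : ℕ) (v : Fin r → RS k a b 1)
    (f : RS k a b q) : dual k h q (wedge k r v ⊗ₜ[k] f) =
      phi k (f : MvPolynomial (Fin 4) k) • contr h (vol k a b) (incl k a b ∘ v) := by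
  have h1 := exteriorPower.alternatingMapLinearEquiv_apply_ιMulti (volAlt k h) v
  change phi k (f : MvPolynomial (Fin 4) k) •
    exteriorPower.alternatingMapLinearEquiv (volAlt k h) (exteriorPower.ιMulti k r v) = _
  rw [h1]
  rfl

theorem neg_one_pow_smul (n : ℕ) (f : Lau k) : (-1 : k) ^ n • f = (-1 : Lau k) ^ n * f := by
  rcases Nat.even_or_odd n with h | h <;> simp [h.neg_one_pow]

theorem neg_one_pow_smul_alt (n : ℕ) (χ : Alt k a b m) :
    (-1 : k) ^ n • χ = (-1 : Lau k) ^ n • χ := by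
  rcases Nat.even_or_odd n with h | h <;> simp [h.neg_one_pow]

theorem dual_koszul {δ : KoszulMaps k a b} (hδ : IsKoszul k a b δ) (n q : ℕ)
    (h : n + 1 + m = (a + 1) * (b + 1)) (h' : n + (m + 1) = (a + 1) * (b + 1))
    (γ : (⋀[k]^(n + 1) (RS k a b 1)) ⊗[k] (RS k a b q)) :
    dual k h' (q + 1) (δ n q γ) =
      (-1 : k) ^ n • wedgeEv (evm k a b) m (dual k h q γ) := by
  let W : Alt k a b m →ₗ[k] Alt k a b (m + 1) :=
    { toFun := wedgeEv (evm k a b) m, map_add' := map_add _, map_smul' := wedgeEv_smul }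
  have hmap : dual k h' (q + 1) ∘ₗ δ n q = (-1 : k) ^ n • (W ∘ₗ dual k h q) := by
    refine TensorProduct.ext (exteriorPower.linearMap_ext (AlternatingMap.ext fun v => ?_))
    refine LinearMap.ext fun f => ?_
    change dual k h' (q + 1) (δ n q (wedge k (n + 1) v ⊗ₜ[k] f)) =
      (-1 : k) ^ n • wedgeEv (evm k a b) m (dual k h q (wedge k (n + 1) v ⊗ₜ[k] f))
    rw [hδ, map_sum, dual_wedge, map_smul]
    have h1 := congrArg (fun χ => phi k (f : MvPolynomial (Fin 4) k) • χ)
      (wedgeEv_contr (evm k a b) h h' (vol k a b) vol_closed (incl k a b ∘ v))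
    rw [Finset.smul_sum] at h1
    refine Eq.trans (Finset.sum_congr rfl fun i _ => ?_) (h1.trans ?_)
    · rw [map_smul, dual_wedge]
      change (-1 : k) ^ (i : ℕ) • phi k ((v i : MvPolynomial (Fin 4) k) * f) • _ = _
      rw [map_mul, Function.comp_apply, evm_incl, smul_smul, ← smul_smul_alt]
      congr 1
      rw [neg_one_pow_smul]
      ring
    · rw [smul_comm]
      exact (neg_one_pow_smul_alt n _).symm
  exact DFunLike.congr_fun hmap γ

end Duality

section DualityImage

variable {k : Type*} [Field k] {a b : ℕ} {r m : ℕ}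

variable (k a b) in
/-- The monomial basis of the linear forms. -/
abbrev linBasis : Module.Basis (Ix a b) k (RS k a b 1) :=
  bihomBasis k (one_mul a) (one_mul b)

/-- The Koszul chain with given coefficients. -/
def chain {q : ℕ} (f : {U : Finset (Ix a b) // U.card = r} → RS k a b q) :
    (⋀[k]^r (RS k a b 1)) ⊗[k] (RS k a b q) :=
  ∑ U, wedge k r (linBasis k a b ∘ srt U) ⊗ₜ[k] f U

theorem exists_chain {q : ℕ} (γ : (⋀[k]^r (RS k a b 1)) ⊗[k] (RS k a b q)) :
    ∃ f : {U : Finset (Ix a b) // U.card = r} → RS k a b q, chain f = γ := by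
  let := finOrd (Ix a b)
  obtain ⟨c, hc⟩ := TensorProduct.eq_repr_basis_left ((linBasis k a b).exteriorPower r) γ
  refine ⟨fun U => c ⟨U.1, U.2⟩, ?_⟩
  rw [← hc, Finsupp.sum_fintype _ _ (fun i => TensorProduct.tmul_zero _ _)]
  let e : {U : Finset (Ix a b) // U.card = r} ≃ Set.powersetCard (Ix a b) r :=
    ⟨fun U => ⟨U.1, U.2⟩, fun U => ⟨U.1, U.2⟩, fun _ => rfl, fun _ => rfl⟩
  refine Fintype.sum_equiv e _ _ fun U => ?_
  rw [exteriorPower.basis_apply]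
  rfl

/-- The complement of a set of indices. -/
def compl (h : r + m = (a + 1) * (b + 1)) (T : {U : Finset (Ix a b) // U.card = m}) :
    {U : Finset (Ix a b) // U.card = r} :=
  ⟨T.1ᶜ, by
    rw [Finset.card_compl, T.2]
    simp
    omega⟩

theorem cat_injective {M : Type*} {N : ℕ} (h : r + m = N) {v : Fin r → M} {u : Fin m → M}
    (hv : Function.Injective v) (hu : Function.Injective u) (hvu : ∀ i j, v i ≠ u j) :
    Function.Injective (cat h v u) := by
  intro i j hij
  unfold cat at hij
  split_ifs at hij with h1 h2 h2
  · have := Fin.mk.inj_iff.mp (hv hij)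
    exact Fin.ext this
  · exact absurd hij (hvu _ _)
  · exact absurd hij.symm (hvu _ _)
  · have := Fin.mk.inj_iff.mp (hu hij)
    exact Fin.ext (by omega)

theorem cat_compl_injective (h : r + m = (a + 1) * (b + 1))
    (T : {U : Finset (Ix a b) // U.card = m}) :
    Function.Injective (cat h (srt (compl h T)) (srt T)) := by
  refine cat_injective h (srt_injective _) (srt_injective _) fun i j hij => ?_
  have h1 := (mem_range_srt (compl h T) _).mp ⟨i, rfl⟩
  have h2 := (mem_range_srt T _).mp ⟨j, rfl⟩
  rw [hij] at h1
  exact Finset.mem_compl.mp h1 h2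

theorem incl_comp_linBasis (i : Fin r → Ix a b) :
    incl k a b ∘ (linBasis k a b ∘ i) = eb k a b ∘ i :=
  funext fun j => incl_basis (i j)

theorem dual_chain_apply (h : r + m = (a + 1) * (b + 1)) {q : ℕ}
    (f : {U : Finset (Ix a b) // U.card = r} → RS k a b q)
    (T : {U : Finset (Ix a b) // U.card = m}) :
    dual k h q (chain f) (eb k a b ∘ srt T) =
      phi k (f (compl h T) : MvPolynomial (Fin 4) k) *
        vol k a b (eb k a b ∘ cat h (srt (compl h T)) (srt T)) := by
  rw [chain, map_sum, alternating_sum_apply, Finset.sum_eq_single (compl h T)]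
  · rw [dual_wedge, AlternatingMap.smul_apply, contr_apply, incl_comp_linBasis, comp_cat,
      smul_eq_mul]
  · intro U _ hU
    rw [dual_wedge, AlternatingMap.smul_apply, contr_apply, incl_comp_linBasis]
    obtain ⟨s, hs, hsT⟩ : ∃ s ∈ U.1, s ∈ T.1 := by
      by_contra! hne
      refine hU (Subtype.ext (Finset.eq_of_subset_of_card_le
        (fun s hs => Finset.mem_compl.mpr (hne s hs)) ?_))
      rw [U.2]
      exact (compl h T).2.le
    obtain ⟨i, hi⟩ := (mem_range_srt U s).mpr hs
    obtain ⟨j, hj⟩ := (mem_range_srt T s).mpr hsT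
    rw [(vol k a b).map_eq_zero_of_eq _ (i := ⟨i, by omega⟩) (j := ⟨r + j, by omega⟩) ?_ ?_,
      smul_zero]
    · rw [cat_left, cat_right, Function.comp_apply, Function.comp_apply, hi, hj]
    · intro hij
      have := Fin.mk.inj_iff.mp hij
      omega
  · simp

/-- Forms whose values on standard tuples are supported in a box. -/
def BoxForm (d e : ℕ) (χ : Alt k a b m) : Prop := ∀ i : Fin m → Ix a b, Box d e (χ (eb k a b ∘ i))

theorem Box.mul_vol {d e : ℕ} {g : Lau k} (hg : Box d e g) {i : Fin ((a + 1) * (b + 1)) → Ix a b}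
    (hi : Function.Injective i) : Box d e (g * vol k a b (eb k a b ∘ i)) := by
  obtain ⟨-, c, hc⟩ := vol_sq (k := k) hi
  rw [hc, mul_smul_comm, mul_one]
  exact ⟨Submodule.smul_mem _ _ hg.x, Submodule.smul_mem _ _ hg.neg_x,
    Submodule.smul_mem _ _ hg.z, Submodule.smul_mem _ _ hg.neg_z⟩

theorem boxForm_dual (h : r + m = (a + 1) * (b + 1)) {q : ℕ}
    (γ : (⋀[k]^r (RS k a b 1)) ⊗[k] (RS k a b q)) :
    BoxForm (q * a) (q * b) (dual k h q γ) := by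
  obtain ⟨f, rfl⟩ := exists_chain γ
  have key : ∀ T, Box (q * a) (q * b) (dual k h q (chain f) (eb k a b ∘ srt T)) := fun T => by
    rw [dual_chain_apply]
    exact (box_phi _).mul_vol (cat_compl_injective h T)
  have mem : ∀ (N : Submodule k (Lau k)) (i : Fin m → Ix a b),
      (∀ T, dual k h q (chain f) (eb k a b ∘ srt T) ∈ N) →
      dual k h q (chain f) (eb k a b ∘ i) ∈ N := fun N i hN => by
    by_cases hi : Function.Injective i
    · exact map_comp_mem_of_srt N i hi fun T _ => hN T
    · rw [AlternatingMap.map_eq_zero_of_not_injective _ _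
        fun h => hi h.of_comp]
      exact N.zero_mem
  exact fun i => ⟨mem _ i fun T => (key T).x, mem _ i fun T => (key T).neg_x,
    mem _ i fun T => (key T).z, mem _ i fun T => (key T).neg_z⟩

theorem dual_injective (h : r + m = (a + 1) * (b + 1)) (q : ℕ) :
    Function.Injective (dual k h q : _ → Alt k a b m) := by
  refine (injective_iff_map_eq_zero _).mpr fun γ hγ => ?_
  obtain ⟨f, rfl⟩ := exists_chain γ
  have hf : f = 0 := by
    funext U
    have h1 := dual_chain_apply h f (compl ((add_comm m r).trans h) U)
    have hU : compl h (compl ((add_comm m r).trans h) U) = U := Subtype.ext (compl_compl _)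
    have hi := cat_compl_injective h (compl ((add_comm m r).trans h) U)
    rw [hγ, hU] at h1
    rw [hU] at hi
    refine eq_zero_of_phi_eq_zero ?_
    rw [← mul_one (phi k _), ← (vol_sq (k := k) hi).1, ← mul_assoc, ← h1]
    simp
  rw [hf, chain]
  simp

theorem BoxForm.exists_dual (h : r + m = (a + 1) * (b + 1)) {q : ℕ} {χ : Alt k a b m}
    (hχ : BoxForm (q * a) (q * b) χ) : ∃ γ, dual k h q γ = χ := by
  have h1 : ∀ T : {U : Finset (Ix a b) // U.card = m}, ∃ f : RS k a b q,
      phi k (f : MvPolynomial (Fin 4) k) = χ (eb k a b ∘ srt T) *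
        vol k a b (eb k a b ∘ cat h (srt (compl h T)) (srt T)) := fun T =>
    ((hχ _).mul_vol (cat_compl_injective h T)).exists_phi
  choose f hf using h1
  refine ⟨chain fun U => f (compl ((add_comm m r).trans h) U),
    form_ext (eb k a b) fun T => ?_⟩
  have hT : compl ((add_comm m r).trans h) (compl h T) = T := Subtype.ext (compl_compl _)
  rw [dual_chain_apply, hT, hf, mul_assoc, (vol_sq (cat_compl_injective h T)).1, mul_one]

end DualityImage

section Count

theorem card_fullU {a b : ℕ} (hab : a ≤ b) :
    Fintype.card (FullU a b) = Nat.choose ((a + 1) * b) (b - a) := by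
  let e : FullU a b ≃ {U : Finset (Fin (a + 1) × Fin b) // U.card = b - a} :=
    { toFun := fun U => ⟨U.1.1.toRight, by
        have h1 := U.1.1.card_toLeft_add_card_toRight
        have h2 : U.1.1.toLeft = Finset.univ :=
          Finset.eq_univ_iff_forall.mpr fun m => Finset.mem_toLeft.mpr (U.2 m)
        rw [h2, Finset.card_univ, Fintype.card_fin, U.1.2] at h1
        omega⟩
      invFun := fun U => ⟨⟨Finset.univ.disjSum U.1, by
        rw [Finset.card_disjSum, Finset.card_univ, Fintype.card_fin, U.2]
        omega⟩, fun m => Finset.inl_mem_disjSum.mpr (Finset.mem_univ m)⟩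
      left_inv := fun U => Subtype.ext (Subtype.ext (by
        ext x
        rcases x with m | s
        · simp [U.2 m]
        · simp))
      right_inv := fun U => Subtype.ext (by simp) }
  rw [Fintype.card_congr e, Fintype.card_finset_len, Fintype.card_prod, Fintype.card_fin,
    Fintype.card_fin]

theorem finrank_par (k : Type*) [Field k] {a b : ℕ} (hab : a ≤ b) (ha : 0 < a) :
    Module.finrank k (Par k a b) = (a * b + a - 1) *
      Nat.choose ((a + 1) * b) (a * b + a - 1 + 1) + (a * b + a - 1) := by
  have h1 : (a + 1) * b = b - a + (a * b + a - 1 + 1) := by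
    rw [Nat.add_mul, one_mul]
    omega
  rw [Module.finrank_prod, Module.finrank_fintype_fun_eq_card, Module.finrank_fintype_fun_eq_card,
    Fintype.card_prod, card_fullU hab, Fintype.card_fin, Nat.choose_symm_of_eq_add h1]
  ring

end Count

section Final

theorem finrank_quotient_comap_subtype {k V P : Type*} [Field k] [AddCommGroup V] [Module k V]
    [AddCommGroup P] [Module k P] {K L : Submodule k V} (Q : P →ₗ[k] K)
    (hinj : ∀ c, (Q c : V) ∈ L → c = 0) (hsurj : ∀ γ : K, ∃ c, (Q c - γ : V) ∈ L) :
    Module.finrank k (K ⧸ L.comap K.subtype) = Module.finrank k P := by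
  refine (LinearEquiv.ofBijective ((L.comap K.subtype).mkQ ∘ₗ Q)
    ⟨(injective_iff_map_eq_zero _).mpr fun c hc => ?_, fun y => ?_⟩).finrank_eq.symm
  · rw [LinearMap.comp_apply, Submodule.mkQ_apply, Submodule.Quotient.mk_eq_zero,
      Submodule.mem_comap] at hc
    exact hinj c hc
  · obtain ⟨γ, rfl⟩ := Submodule.mkQ_surjective _ y
    obtain ⟨c, hc⟩ := hsurj γ
    exact ⟨c, (Submodule.Quotient.eq _).mpr hc⟩

variable {k : Type*} [Field k] {a b : ℕ}

theorem IsConst.boxForm {m : ℕ} {η : Alt k a b m} (h : IsConst η) :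
    BoxForm (0 * a) (0 * b) η := fun i => by
  rw [zero_mul, zero_mul]
  exact ⟨h.xFree.x i, h.xFree.neg_x i, h.z i, h.neg_z i⟩

theorem BoxForm.isConst {m : ℕ} {η : Alt k a b m} (h : BoxForm (0 * a) (0 * b) η) :
    IsConst η := by
  rw [zero_mul, zero_mul] at h
  exact ⟨⟨fun i => (h i).x, fun i => (h i).neg_x⟩, fun i => (h i).neg_z, fun i => (h i).z⟩

theorem InZ.boxForm {ω : Alt k a b (b + 2)} (h : InZ ω) : BoxForm (1 * a) (1 * b) ω := fun i => by
  rw [one_mul, one_mul]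
  exact ⟨h.x i, h.neg_x i, h.z i, h.neg_z i⟩

theorem BoxForm.inZ {ω : Alt k a b (b + 2)} (h : BoxForm (1 * a) (1 * b) ω)
    (hω : wedgeEv (evm k a b) (b + 2) ω = 0) : InZ ω := by
  rw [one_mul, one_mul] at h
  exact ⟨hω, fun i => (h i).neg_x, fun i => (h i).x, fun i => (h i).neg_z, fun i => (h i).z⟩

theorem mem_ker_iff {δ : KoszulMaps k a b} (hδ : IsKoszul k a b δ) {n : ℕ}
    (h : n + 1 + (b + 2) = (a + 1) * (b + 1))
    (γ : (⋀[k]^(n + 1) (RS k a b 1)) ⊗[k] (RS k a b 1)) :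
    γ ∈ LinearMap.ker (δ n 1) ↔ InZ (dual k h 1 γ) := by
  have h' : n + (b + 2 + 1) = (a + 1) * (b + 1) := by omega
  have h1 := dual_koszul hδ n 1 h h' γ
  rw [LinearMap.mem_ker]
  constructor
  · intro hγ
    rw [hγ, map_zero] at h1
    refine (boxForm_dual h γ).inZ ?_
    exact (smul_eq_zero.mp h1.symm).resolve_left (pow_ne_zero _ (neg_ne_zero.mpr one_ne_zero))
  · intro hγ
    rw [hγ.closed, smul_zero] at h1
    exact dual_injective h' (1 + 1) (h1.trans (map_zero _).symm)

theorem mem_range_iff {δ : KoszulMaps k a b} (hδ : IsKoszul k a b δ) {n : ℕ}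
    (h : n + 1 + (b + 2) = (a + 1) * (b + 1))
    (γ : (⋀[k]^(n + 1) (RS k a b 1)) ⊗[k] (RS k a b 1)) :
    γ ∈ LinearMap.range (δ (n + 1) 0) ↔
      ∃ η, IsConst η ∧ dual k h 1 γ = wedgeEv (evm k a b) (b + 1) η := by
  have h0 : n + 1 + 1 + (b + 1) = (a + 1) * (b + 1) := by omega
  have hs : (-1 : k) ^ (n + 1) * (-1) ^ (n + 1) = 1 := by
    rw [← mul_pow, neg_mul_neg, one_mul, one_pow]
  constructor
  · rintro ⟨γ', rfl⟩
    refine ⟨(-1 : k) ^ (n + 1) • dual k h0 0 γ', ?_, ?_⟩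
    · rw [← map_smul]
      exact (boxForm_dual h0 _).isConst
    · rw [wedgeEv_smul]
      exact dual_koszul hδ (n + 1) 0 h0 h γ'
  · rintro ⟨η, hη, h1⟩
    obtain ⟨γ', rfl⟩ := hη.boxForm.exists_dual h0
    refine ⟨(-1 : k) ^ (n + 1) • γ', dual_injective h 1 ?_⟩
    rw [h1, map_smul, map_smul]
    refine (congrArg ((-1 : k) ^ (n + 1) • ·) (dual_koszul hδ (n + 1) 0 h0 h γ')).trans ?_
    change (-1 : k) ^ (n + 1) • (-1 : k) ^ (n + 1) • _ = _
    rw [smul_smul, hs, one_smul]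

theorem finrank_Kp1_eq_finrank_par (ha : 3 ≤ a) {δ : KoszulMaps k a b} (hδ : IsKoszul k a b δ)
    {n : ℕ} (h : n + 1 + (b + 2) = (a + 1) * (b + 1)) :
    Module.finrank k (Kp1 k a b δ n) = Module.finrank k (Par k a b) := by
  let D := LinearEquiv.ofInjective (dual k h 1) (dual_injective h 1)
  let P : Par k a b →ₗ[k] LinearMap.range (dual k h 1) :=
    (psi k a b).codRestrict _ fun c => (inZ_psi c).boxForm.exists_dual h
  have hP : ∀ c, dual k h 1 (D.symm (P c)) = psi k a b c := fun c =>
    congrArg Subtype.val (D.apply_symm_apply (P c))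
  let Q : Par k a b →ₗ[k] LinearMap.ker (δ n 1) :=
    (D.symm.toLinearMap ∘ₗ P).codRestrict _ fun c => (mem_ker_iff hδ h _).mpr (by
      change InZ (dual k h 1 (D.symm (P c)))
      rw [hP]
      exact inZ_psi c)
  have hQ : ∀ c, dual k h 1 (Q c : (⋀[k]^(n + 1) (RS k a b 1)) ⊗[k] (RS k a b 1)) = psi k a b c :=
    hP
  have hinj : ∀ c, (Q c : (⋀[k]^(n + 1) (RS k a b 1)) ⊗[k] (RS k a b 1)) ∈
      LinearMap.range (δ (n + 1) 0) → c = 0 := by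
    intro c hc
    obtain ⟨η, hη, h1⟩ := (mem_range_iff hδ h _).mp hc
    exact eq_zero_of_psi_eq ha hη ((hQ c).symm.trans h1)
  have hsurj : ∀ γ : LinearMap.ker (δ n 1), ∃ c,
      (Q c - γ : (⋀[k]^(n + 1) (RS k a b 1)) ⊗[k] (RS k a b 1)) ∈
        LinearMap.range (δ (n + 1) 0) := by
    rintro ⟨γ, hγ⟩
    have hz : InZ (dual k h 1 γ) := (mem_ker_iff hδ h γ).mp hγ
    obtain ⟨c, η, hη, h1⟩ := exists_psi_add ha hz
    refine ⟨c, ?_⟩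
    rw [← neg_sub, Submodule.neg_mem_iff]
    refine (mem_range_iff hδ h _).mpr ⟨η, hη, ?_⟩
    have h2 := map_sub (dual k h 1) γ (Q c)
    rw [h1, hQ, add_sub_cancel_left] at h2
    exact h2
  exact finrank_quotient_comap_subtype Q hinj hsurj

end Final

end SegreVeronese

/-- Let `3 ≤ a ≤ b` and set `p := ab + a − 1` (we write `p = n+1`).  Then
`κ_{p,1} = p · C((a+1)b, p+1) + p` for the Segre–Veronese embedding of `ℙ¹×ℙ¹`
by `O(a)⊠O(b)`. -/
theorem segre_kappa_p1_at_ab_add_a_sub_one (k : Type*) [Field k] (a b : ℕ)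
    (ha : 3 ≤ a) (hab : a ≤ b)
    (δ : KoszulMaps k a b) (hδ : IsKoszul k a b δ)
    (p n : ℕ) (hp : p = a * b + a - 1) (hn : n + 1 = p) :
    Module.finrank k (Kp1 k a b δ n) = p * Nat.choose ((a + 1) * b) (p + 1) + p := by
  subst hp
  have h : n + 1 + (b + 2) = (a + 1) * (b + 1) := by
    rw [hn, Nat.add_mul, one_mul, Nat.mul_add, mul_one]
    omega
  rw [SegreVeronese.finrank_Kp1_eq_finrank_par ha hδ h,
    SegreVeronese.finrank_par k hab (by omega)]

end
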